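/- Let D and D′ be domains in ℝ^n, n ≥ 3, let φ:(0,∞)→(0,∞) be nondecreasing with ∫_{t_*}^∞ (t/φ(t))^{1/(n−2)} dt < ∞ for some t_* ∈ (0,∞), and let f:D→D′ be a homeomorphism of finite distortion of class W^{1,φ}_loc. Suppose p ∈ (n, n + 1/(n−2)) and at a point x_0 ∈ D: k_p(x_0) = limsup_{ε→0} (⨍_{B(x_0,ε)} K_p(x,f)^{(n−1)/(p−n+1)} dm(x))^{(p−n+1)/(n−1)} < ∞. Then L(x_0,f) = limsup_{x→x_0} |f(x)−f(x_0)|/|x−x_0| ≤ c_{n,p} · k_p(x_0)^γ < ∞, where γ = (n−1)/(n(p−n+1)−p) and c_{n,p} is a positive constant depending only on n and p. -/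

import Mathlib

open MeasureTheory Metric Set Filter
open scoped ENNReal NNReal Topology RealInnerProductSpace Classical

noncomputable section

abbrev Eucl (n : ℕ) : Type := EuclideanSpace ℝ (Fin n)

/-- A `k`-dimensional surface in `ℝⁿ`: a continuous map defined on an open subset of the
one-point compactification of `ℝᵏ`. -/
structure Surface (n k : ℕ) where
  dom : Set (OnePoint (Eucl k))
  isOpen_dom : IsOpen dom
  toFun : OnePoint (Eucl k) → Eucl n
  continuousOn : ContinuousOn toFun dom

namespace Surface

variable {n k : ℕ}

/-- The multiplicity function `N(S,y)` of a surface. -/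
def mult (S : Surface n k) (y : Eucl n) : ℝ≥0∞ :=
  ((S.dom ∩ S.toFun ⁻¹' {y}).encard : ℕ∞)

/-- The integral `∫_S ρ dA = ∫ ρ(y) N(S,y) dH^k(y)` of `ρ` over the surface `S`. -/
def sint (S : Surface n k) (ρ : Eucl n → ℝ≥0∞) : ℝ≥0∞ :=
  ∫⁻ y, ρ y * S.mult y ∂(μH[(k : ℝ)] : Measure (Eucl n))

end Surface

/-- Admissible functions for a family of `k`-surfaces. -/
def surfAdm {n : ℕ} (k : ℕ) (Γ : Set (Surface n k)) : Set (Eucl n → ℝ≥0∞) :=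
  {ρ | Measurable ρ ∧ ∀ S ∈ Γ, 1 ≤ S.sint fun y => ρ y ^ k}

/-- The `p`-modulus of a family of `k`-surfaces. -/
def surfModulus {n : ℕ} (p : ℝ) (k : ℕ) (Γ : Set (Surface n k)) : ℝ≥0∞ :=
  ⨅ ρ ∈ surfAdm k Γ, ∫⁻ x, ρ x ^ p

/-- Extensively `p`-admissible functions: admissibility may fail on a subfamily of
`p`-modulus zero. -/
def extAdm {n : ℕ} (p : ℝ) (k : ℕ) (Γ : Set (Surface n k)) : Set (Eucl n → ℝ≥0∞) :=
  {ρ | Measurable ρ ∧ surfModulus p k {S ∈ Γ | ¬ 1 ≤ S.sint fun y => ρ y ^ k} = 0}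

/-- The family of the (injectively parametrized, nonempty) surfaces `S(x₀,r) ∩ D`,
`r ∈ I`. -/
def sphereFam {n : ℕ} (D : Set (Eucl n)) (x₀ : Eucl n) (I : Set ℝ) :
    Set (Surface n (n - 1)) :=
  {S | ∃ r ∈ I, S.dom.Nonempty ∧ Set.InjOn S.toFun S.dom ∧
      S.toFun '' S.dom = sphere x₀ r ∩ D}

/-- The image of a family of surfaces under a map `f`. -/
def imageFam {n k : ℕ} (f : Eucl n → Eucl n) (Γ : Set (Surface n k)) :
    Set (Surface n k) :=
  {S' | ∃ S ∈ Γ, S'.dom = S.dom ∧ Set.EqOn S'.toFun (f ∘ S.toFun) S.dom}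

/-- The spherical ring `R(x₀,a,b)`. -/
def ringA {n : ℕ} (x₀ : Eucl n) (a b : ℝ) : Set (Eucl n) :=
  {x | a < dist x x₀ ∧ dist x x₀ < b}

/-- `‖Q‖_α(r) = (∫_{D ∩ S(x₀,r)} Q^α dA)^{1/α}`. -/
def sphNorm {n : ℕ} (D : Set (Eucl n)) (x₀ : Eucl n) (Q : Eucl n → ℝ≥0∞)
    (α : ℝ) (r : ℝ) : ℝ≥0∞ :=
  (∫⁻ x in D ∩ sphere x₀ r, Q x ^ α ∂(μH[((n : ℝ) - 1)] : Measure (Eucl n))) ^ (1 / α)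

/-- `f` is a lower `Q`-homeomorphism w.r.t. the `p`-modulus at `x₀`. -/
def IsLowerQHomeoAt {n : ℕ} (D : Set (Eucl n)) (f : Eucl n → Eucl n)
    (Q : Eucl n → ℝ≥0∞) (p : ℝ) (x₀ : Eucl n) (d₀ : ℝ≥0∞) : Prop :=
  ∀ ε ε₀ : ℝ, 0 < ε → ε < ε₀ → ENNReal.ofReal ε₀ < d₀ →
    (⨅ ρ ∈ extAdm p (n - 1) (sphereFam D x₀ (Ioo ε ε₀)),
        ∫⁻ x in ringA x₀ ε ε₀, ρ x ^ p / Q x) ≤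
      surfModulus p (n - 1) (imageFam f (sphereFam D x₀ (Ioo ε ε₀)))

/-- `f` is a homeomorphism of `D` onto `D'`. -/
structure IsHomeoOn {n : ℕ} (f : Eucl n → Eucl n) (D D' : Set (Eucl n)) : Prop where
  continuousOn : ContinuousOn f D
  injOn : Set.InjOn f D
  image_eq : f '' D = D'
  isOpenMapOn : ∀ U : Set (Eucl n), U ⊆ D → IsOpen U → IsOpen (f '' U)

/-- `Df` is the weak (Sobolev) derivative of `f` on `D`, and `f ∈ W^{1,1}_loc(D)`. -/
def IsWeakDerivOn {n m : ℕ} (D : Set (Eucl n)) (f : Eucl n → Eucl m)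
    (Df : Eucl n → Eucl n →L[ℝ] Eucl m) : Prop :=
  LocallyIntegrableOn f D volume ∧ LocallyIntegrableOn Df D volume ∧
  ∀ ψ : Eucl n → ℝ, ContDiff ℝ (⊤ : ℕ∞) ψ → HasCompactSupport ψ → tsupport ψ ⊆ D →
    ∀ v : Eucl n, ∫ x, ψ x • Df x v = - ∫ x, fderiv ℝ ψ x v • f x

/-- The Frobenius norm `|∇f| = (Σ_{i,j} (∂f_i/∂x_j)²)^{1/2}` of a linear map. -/
def frobNorm {n m : ℕ} (A : Eucl n →L[ℝ] Eucl m) : ℝ :=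
  Real.sqrt (∑ i : Fin m, ∑ j : Fin n, (A (EuclideanSpace.single j 1) i) ^ 2)

/-- The Orlicz–Sobolev class `W^{1,φ}_loc(D)` (with explicit weak derivative `Df`). -/
def MemOrliczSobolevOn {n m : ℕ} (φ : ℝ → ℝ) (D : Set (Eucl n))
    (f : Eucl n → Eucl m) (Df : Eucl n → Eucl n →L[ℝ] Eucl m) : Prop :=
  IsWeakDerivOn D f Df ∧
  ∀ K : Set (Eucl n), K ⊆ D → IsCompact K →
    (∫⁻ x in K, ENNReal.ofReal (φ (frobNorm (Df x)))) < ⊤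

/-- `φ` is nondecreasing and positive on `(0,∞)`. -/
def NondecPos (φ : ℝ → ℝ) : Prop :=
  (∀ s t : ℝ, 0 < s → s ≤ t → φ s ≤ φ t) ∧ ∀ t : ℝ, 0 < t → 0 < φ t

/-- The Calderón-type condition `∫_{t₀}^∞ (t/φ(t))^{1/(n-2)} dt < ∞`. -/
def CalderonCond (n : ℕ) (φ : ℝ → ℝ) : Prop :=
  ∃ t₀ : ℝ, 0 < t₀ ∧
    IntegrableOn (fun t => (t / φ t) ^ (1 / ((n : ℝ) - 2))) (Ioi t₀) volume

/-- `f` (with a.e. derivative `Df`) has finite distortion on `D`. -/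
def HasFiniteDistortionOn {n : ℕ} (D : Set (Eucl n))
    (Df : Eucl n → Eucl n →L[ℝ] Eucl n) : Prop :=
  ∃ K : Eucl n → ℝ, AEMeasurable K (volume.restrict D) ∧
    ∀ᵐ x ∂volume.restrict D, 1 ≤ K x ∧ ‖Df x‖ ^ n ≤ K x * (Df x).det

/-- The distortion `K_p(x,f)` for a map with derivative `Df`. -/
def distortionKp {n : ℕ} (p : ℝ) (Df : Eucl n → Eucl n →L[ℝ] Eucl n)
    (x : Eucl n) : ℝ≥0∞ :=
  if (Df x).det ≠ 0 then ENNReal.ofReal (‖Df x‖ ^ p / (Df x).det)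
  else if Df x = 0 then 1 else ⊤

/-- The multiplicity function of a curve `γ : [0,1] → ℝⁿ`. -/
def curveMult {n : ℕ} (γ : ℝ → Eucl n) (y : Eucl n) : ℝ≥0∞ :=
  (({t ∈ Icc (0:ℝ) 1 | γ t = y}).encard : ℕ∞)

/-- The line integral `∫_γ ρ ds = ∫ ρ(y) N(γ,y) dH¹(y)`. -/
def curveInt {n : ℕ} (γ : ℝ → Eucl n) (ρ : Eucl n → ℝ≥0∞) : ℝ≥0∞ :=
  ∫⁻ y, ρ y * curveMult γ y ∂(μH[(1 : ℝ)] : Measure (Eucl n))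

/-- The family of curves joining `A` and `B` in `G`. -/
def curveJoin {n : ℕ} (A B G : Set (Eucl n)) : Set (ℝ → Eucl n) :=
  {γ | ContinuousOn γ (Icc 0 1) ∧ γ 0 ∈ A ∧ γ 1 ∈ B ∧ Set.MapsTo γ (Icc 0 1) G}

/-- The `q`-modulus of a family of curves. -/
def curveModulus {n : ℕ} (q : ℝ) (Γ : Set (ℝ → Eucl n)) : ℝ≥0∞ :=
  ⨅ ρ ∈ {ρ : Eucl n → ℝ≥0∞ | Measurable ρ ∧ ∀ γ ∈ Γ, 1 ≤ curveInt γ ρ},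
    ∫⁻ x, ρ x ^ q

/-- The `q`-capacity of the condenser `(A,C)`, via the modulus of joining curves. -/
def condenserCap {n : ℕ} (q : ℝ) (A C : Set (Eucl n)) : ℝ≥0∞ :=
  curveModulus q (curveJoin (frontier A) (frontier C) (A \ C))

/-- `L(x₀,f) = limsup_{x→x₀} |f(x)-f(x₀)|/|x-x₀|`. -/
def LAt {n : ℕ} (f : Eucl n → Eucl n) (x₀ : Eucl n) : ℝ≥0∞ :=
  limsup (fun x => edist (f x) (f x₀) / edist x x₀) (𝓝[≠] x₀)

/-- `k_p(x₀) = limsup_{ε→0} (⨍_{B(x₀,ε)} K_p(x,f)^{(n-1)/(p-n+1)} dm)^{(p-n+1)/(n-1)}`. -/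
def kpAt {n : ℕ} (p : ℝ) (Df : Eucl n → Eucl n →L[ℝ] Eucl n) (x₀ : Eucl n) : ℝ≥0∞ :=
  limsup (fun ε : ℝ =>
      ((∫⁻ x in ball x₀ ε, distortionKp p Df x ^ (((n:ℝ)-1)/(p-(n:ℝ)+1))) /
        volume (ball x₀ ε)) ^ ((p-(n:ℝ)+1)/((n:ℝ)-1)))
    (𝓝[>] (0:ℝ))

/-- `f` is absolutely continuous on `S` w.r.t. `d`-dimensional Hausdorff measure. -/
def ACOnSet {n m : ℕ} (f : Eucl n → Eucl m) (S : Set (Eucl n)) (d : ℝ) : Prop :=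
  ∀ ε : ℝ, 0 < ε → ∃ δ : ℝ, 0 < δ ∧ ∀ A : Set (Eucl n), A ⊆ S →
    (μH[d] : Measure (Eucl n)) A < ENNReal.ofReal δ →
      (μH[d] : Measure (Eucl m)) (f '' A) < ENNReal.ofReal ε

/-- `f` is locally absolutely continuous on `S` w.r.t. `H^d`. -/
def LocACOnSet {n m : ℕ} (f : Eucl n → Eucl m) (S : Set (Eucl n)) (d : ℝ) : Prop :=
  ∀ x ∈ S, ∃ V ∈ 𝓝 x, ACOnSet f (S ∩ V) d

/-- The Luzin (N)-property of `f` on `S` w.r.t. `d`-dimensional Hausdorff measure. -/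
def LusinNOn {n m : ℕ} (f : Eucl n → Eucl m) (S : Set (Eucl n)) (d : ℝ) : Prop :=
  ∀ A : Set (Eucl n), A ⊆ S → (μH[d] : Measure (Eucl n)) A = 0 →
    (μH[d] : Measure (Eucl m)) (f '' A) = 0

end


noncomputable section
namespace KP

section

def Pot {k : ℕ} (l : ℝ) (S : Set (Fin k → ℝ)) (g : (Fin k → ℝ) → ℝ≥0∞) (z : Fin k → ℝ) : ℝ≥0∞ :=
  ∫⁻ t in Ioo (0:ℝ) 1, ENNReal.ofReal ((t ^ k)⁻¹) * ∫⁻ w in S ∩ closedBall z (2 * l * t), g w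

lemma homothety_cv {k : ℕ} (c z : Fin k → ℝ) (l t : ℝ) (hz : z ∈ closedBall c l)
    (ht : 0 < t) (ht1 : t ≤ 1) (g : (Fin k → ℝ) → ℝ≥0∞) (hg : Measurable g) :
    ∫⁻ w in closedBall c l, g (z + t • (w - z)) ≤
      ENNReal.ofReal ((t ^ k)⁻¹) * ∫⁻ w in closedBall c l ∩ closedBall z (2 * l * t), g w := by
  set S := closedBall c l ∩ closedBall z (2 * l * t) with hS
  have hSm : MeasurableSet S := measurableSet_closedBall.inter measurableSet_closedBall
  have hgm : Measurable (S.indicator g) := hg.indicator hSm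
  have h1 : ∫⁻ w in closedBall c l, g (z + t • (w - z)) ≤ ∫⁻ w, S.indicator g (z + t • (w - z)) := by
    rw [← lintegral_indicator measurableSet_closedBall]
    refine lintegral_mono fun w => ?_
    by_cases hw : w ∈ closedBall c l
    · have hmem : z + t • (w - z) ∈ S := by
        refine ⟨?_, ?_⟩
        · exact (convex_closedBall c l).add_smul_sub_mem hz hw ⟨ht.le, ht1⟩
        · rw [mem_closedBall, dist_eq_norm, add_sub_cancel_left, norm_smul, Real.norm_eq_abs,
            abs_of_pos ht]
          have : ‖w - z‖ ≤ 2 * l := by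
            rw [← dist_eq_norm]
            have := dist_triangle_right w z c
            rw [mem_closedBall] at hz hw
            linarith
          nlinarith
      simp [hw, hmem]
    · simp [hw]
  refine h1.trans (le_of_eq ?_)
  rw [lintegral_sub_right_eq_self (fun w => S.indicator g (z + t • w)) z]
  have h2 : Measurable (fun v => S.indicator g (z + v)) := hgm.comp (measurable_const_add z)
  have h3 := lintegral_map (μ := (volume : Measure (Fin k → ℝ))) h2 (measurable_const_smul t)
  rw [← h3, Measure.map_addHaar_smul volume ht.ne', lintegral_smul_measure]
  rw [lintegral_add_left_eq_self (fun v => S.indicator g v) z, lintegral_indicator hSm]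
  simp only [Module.finrank_fintype_fun_eq_card, Fintype.card_fin, smul_eq_mul]
  rw [abs_of_pos (by positivity)]

lemma line_est {X V : Type*} [NormedAddCommGroup X] [NormedSpace ℝ X]
    [NormedAddCommGroup V] [NormedSpace ℝ V] (F : X → V) (hF : ContDiff ℝ 1 F) (z w : X) :
    ‖F w - F z‖ₑ ≤ ∫⁻ t in Ioo (0:ℝ) 1, ‖fderiv ℝ F (z + t • (w - z))‖ₑ * ‖w - z‖ₑ := by
  have h := enorm_sub_le_lintegral_deriv_of_contDiffOn_Icc (f := fun t : ℝ => F (z + t • (w - z)))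
    (a := 0) (b := 1) (by fun_prop) zero_le_one
  simp only [one_smul, add_sub_cancel, zero_smul, add_zero] at h
  refine h.trans ?_
  rw [← restrict_Ioo_eq_restrict_Icc]
  refine lintegral_mono fun t => ?_
  have hd : HasDerivAt (fun t : ℝ => F (z + t • (w - z))) (fderiv ℝ F (z + t • (w - z)) (w - z)) t := by
    have h1 : HasFDerivAt F (fderiv ℝ F (z + t • (w - z))) (z + t • (w - z)) :=
      (hF.differentiable one_ne_zero _).hasFDerivAt
    have h2 : HasDerivAt (fun t : ℝ => z + t • (w - z)) (w - z) t := by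
      simpa using ((hasDerivAt_id t).smul_const (w - z)).const_add z
    exact h1.comp_hasDerivAt t h2
  rw [hd.deriv]
  exact ContinuousLinearMap.le_opENorm _ _

lemma osc_half {k : ℕ} {V : Type*} [NormedAddCommGroup V] [NormedSpace ℝ V]
    (F : (Fin k → ℝ) → V) (hF : ContDiff ℝ 1 F) (c z : Fin k → ℝ) (l : ℝ)
    (hz : z ∈ closedBall c l) (g : (Fin k → ℝ) → ℝ≥0∞) (hg : Measurable g)
    (hFg : ∀ w ∈ closedBall c l, ‖fderiv ℝ F w‖ₑ ≤ g w) :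
    ∫⁻ w in closedBall c l, ‖F w - F z‖ₑ ≤ ENNReal.ofReal (2 * l) * Pot l (closedBall c l) g z := by
  have h1 : ∫⁻ w in closedBall c l, ‖F w - F z‖ₑ ≤ ∫⁻ w in closedBall c l,
      ENNReal.ofReal (2 * l) * ∫⁻ t in Ioo (0:ℝ) 1, g (z + t • (w - z)) := by
    refine setLIntegral_mono' measurableSet_closedBall fun w hw => ?_
    refine (line_est F hF z w).trans ?_
    rw [← lintegral_const_mul' _ _ ENNReal.ofReal_ne_top]
    refine setLIntegral_mono' measurableSet_Ioo fun t ht => ?_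
    rw [mul_comm]
    gcongr
    · rw [← edist_eq_enorm_sub, edist_dist]
      apply ENNReal.ofReal_le_ofReal
      have := dist_triangle_right w z c
      rw [mem_closedBall] at hz hw
      linarith
    · exact hFg _ ((convex_closedBall c l).add_smul_sub_mem hz hw ⟨ht.1.le, ht.2.le⟩)
  refine h1.trans ?_
  rw [lintegral_const_mul' _ _ ENNReal.ofReal_ne_top]
  gcongr
  rw [lintegral_lintegral_swap]
  · unfold Pot
    refine setLIntegral_mono' measurableSet_Ioo fun t ht => ?_
    exact homothety_cv c z l t hz ht.1 ht.2.le g hg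
  · apply Measurable.aemeasurable
    exact hg.comp (by fun_prop)

lemma osc_le_pot {k : ℕ} {V : Type*} [NormedAddCommGroup V] [NormedSpace ℝ V]
    (F : (Fin k → ℝ) → V) (hF : ContDiff ℝ 1 F) (c z z' : Fin k → ℝ) (l : ℝ) (hl : 0 < l)
    (hz : z ∈ closedBall c l) (hz' : z' ∈ closedBall c l)
    (g : (Fin k → ℝ) → ℝ≥0∞) (hg : Measurable g)
    (hFg : ∀ w ∈ closedBall c l, ‖fderiv ℝ F w‖ₑ ≤ g w) :
    ENNReal.ofReal ((2 * l) ^ k) * ‖F z - F z'‖ₑ ≤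
      ENNReal.ofReal (2 * l) * (Pot l (closedBall c l) g z + Pot l (closedBall c l) g z') := by
  have hv : volume (closedBall c l) = ENNReal.ofReal ((2 * l) ^ k) := by
    rw [Real.volume_pi_closedBall _ hl.le]; simp
  have h : volume (closedBall c l) * ‖F z - F z'‖ₑ ≤
      ∫⁻ w in closedBall c l, (‖F w - F z‖ₑ + ‖F w - F z'‖ₑ) := by
    rw [mul_comm, ← setLIntegral_const]
    refine lintegral_mono fun w => ?_
    rw [← edist_eq_enorm_sub, ← edist_eq_enorm_sub, ← edist_eq_enorm_sub]
    exact edist_triangle_left _ _ _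
  rw [← hv]
  refine h.trans ?_
  have hme : Measurable (fun w => ‖F w - F z‖ₑ) :=
    (hF.continuous.sub continuous_const).enorm.measurable
  rw [lintegral_add_left hme, mul_add]
  gcongr
  · exact osc_half F hF c z l hz g hg hFg
  · exact osc_half F hF c z' l hz' g hg hFg

end

section

lemma vol_cb {k : ℕ} (c : Fin k → ℝ) {l : ℝ} (hl : 0 ≤ l) :
    volume (closedBall c l) = ENNReal.ofReal ((2 * l) ^ k) := by
  rw [Real.volume_pi_closedBall _ hl]; simp

lemma pot_meas {k : ℕ} (l : ℝ) (hl : 0 < l) (S : Set (Fin k → ℝ)) (g : (Fin k → ℝ) → ℝ≥0∞)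
    (z : Fin k → ℝ) : Measurable (fun t : ℝ => ENNReal.ofReal ((t ^ k)⁻¹) *
      ∫⁻ w in S ∩ closedBall z (2 * l * t), g w) := by
  apply Measurable.mul
  · fun_prop
  · apply Monotone.measurable
    intro s t hst
    apply lintegral_mono_set
    apply inter_subset_inter_right
    apply closedBall_subset_closedBall
    nlinarith

lemma pot_mono {k : ℕ} (l : ℝ) (S : Set (Fin k → ℝ)) (hS : MeasurableSet S)
    (g g' : (Fin k → ℝ) → ℝ≥0∞)
    (z : Fin k → ℝ) (h : ∀ w ∈ S, g w ≤ g' w) : Pot l S g z ≤ Pot l S g' z := by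
  unfold Pot
  refine lintegral_mono fun t => ?_
  dsimp only
  exact mul_le_mul_right (setLIntegral_mono' (hS.inter measurableSet_closedBall) fun w hw => h w hw.1) _

lemma pot_add {k : ℕ} (l : ℝ) (hl : 0 < l) (S : Set (Fin k → ℝ)) (g g' : (Fin k → ℝ) → ℝ≥0∞)
    (hg : Measurable g) (z : Fin k → ℝ) : Pot l S (fun w => g w + g' w) z = Pot l S g z + Pot l S g' z := by
  unfold Pot
  rw [← lintegral_add_left (pot_meas l hl S g z)]
  congr 1; ext t
  rw [lintegral_add_left hg, mul_add]

lemma pot_tsum {k : ℕ} (l : ℝ) (hl : 0 < l) (S : Set (Fin k → ℝ)) (g : ℕ → (Fin k → ℝ) → ℝ≥0∞)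
    (hg : ∀ i, Measurable (g i)) (z : Fin k → ℝ) :
    Pot l S (fun w => ∑' i, g i w) z = ∑' i, Pot l S (g i) z := by
  unfold Pot
  rw [← lintegral_tsum (fun i => (pot_meas l hl S (g i) z).aemeasurable)]
  congr 1; ext t
  rw [lintegral_tsum (fun i => (hg i).aemeasurable), ENNReal.tsum_mul_left]

lemma pot_const_mul {k : ℕ} (l : ℝ) (S : Set (Fin k → ℝ)) (g : (Fin k → ℝ) → ℝ≥0∞)
    (r : ℝ≥0∞) (hr : r ≠ ⊤) (z : Fin k → ℝ) :
    Pot l S (fun w => r * g w) z = r * Pot l S g z := by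
  unfold Pot
  rw [← lintegral_const_mul' _ _ hr]
  congr 1; ext t
  rw [lintegral_const_mul' _ _ hr]; ring

lemma lint_Ioi_pow {m : ℕ} (hm : 2 ≤ m) {s : ℝ} (hs : 0 < s) :
    ∫⁻ t in Ioi s, ENNReal.ofReal ((t ^ m)⁻¹) ≤ ENNReal.ofReal ((s ^ (m-1))⁻¹) := by
  have hm' : (2:ℝ) ≤ m := by exact_mod_cast hm
  have h1 : ∫ t in Ioi s, t ^ (-(m:ℝ)) = -s ^ (-(m:ℝ) + 1) / (-(m:ℝ) + 1) :=
    integral_Ioi_rpow_of_lt (by linarith) hs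
  have h2 : IntegrableOn (fun t : ℝ => t ^ (-(m:ℝ))) (Ioi s) :=
    integrableOn_Ioi_rpow_of_lt (by linarith) hs
  have h3 : ∫⁻ t in Ioi s, ENNReal.ofReal ((t ^ m)⁻¹) = ∫⁻ t in Ioi s, ENNReal.ofReal (t ^ (-(m:ℝ))) := by
    refine setLIntegral_congr_fun measurableSet_Ioi fun t ht => ?_
    have : (0:ℝ) < t := hs.trans ht
    rw [Real.rpow_neg this.le, Real.rpow_natCast]
  rw [h3, ← ofReal_integral_eq_lintegral_ofReal h2, h1]
  · apply ENNReal.ofReal_le_ofReal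
    have : s ^ (-(m:ℝ) + 1) = (s ^ (m-1))⁻¹ := by
      rw [show -(m:ℝ) + 1 = -((m-1 : ℕ):ℝ) by push_cast [Nat.cast_sub (by omega : 1 ≤ m)]; ring,
        Real.rpow_neg hs.le, Real.rpow_natCast]
    rw [this, div_eq_mul_inv, neg_mul, ← mul_neg, ← inv_neg]
    have h5 : (0:ℝ) ≤ (s ^ (m-1))⁻¹ := by positivity
    apply mul_le_of_le_one_right h5
    apply inv_le_one_of_one_le₀; linarith
  · filter_upwards [self_mem_ae_restrict measurableSet_Ioi] with t ht
    have : (0:ℝ) < t := hs.trans ht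
    positivity

lemma pot_ind {m : ℕ} (hm : 2 ≤ m) (l : ℝ) (hl : 0 < l) (S A : Set (Fin m → ℝ))
    (hA : MeasurableSet A) (z : Fin m → ℝ) :
    Pot l S (A.indicator 1) z ≤
      ENNReal.ofReal (2 * (4 * l) ^ (m-1)) * volume (A ∩ S) ^ (1 / (m:ℝ)) := by
  have hm0 : (0:ℝ) < m := by exact_mod_cast (by omega : 0 < m)
  unfold Pot
  have hin : ∀ t : ℝ, ∫⁻ w in S ∩ closedBall z (2 * l * t), A.indicator 1 w
      = volume (A ∩ (S ∩ closedBall z (2 * l * t))) := by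
    intro t
    rw [lintegral_indicator_one hA, Measure.restrict_apply hA]
  simp_rw [hin]
  set v := volume (A ∩ S) with hv
  rcases eq_or_ne v ⊤ with htop | hfin
  · rw [htop, ENNReal.top_rpow_of_pos (by positivity), ENNReal.mul_top]
    · exact le_top
    · simp only [ne_eq, ENNReal.ofReal_eq_zero, not_le]; positivity
  rcases eq_or_ne v 0 with h0 | hpos
  · have : ∀ t : ℝ, volume (A ∩ (S ∩ closedBall z (2 * l * t))) = 0 := fun t =>
      measure_mono_null (by intro x hx; exact ⟨hx.1, hx.2.1⟩) (hv ▸ h0)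
    simp [this]
  set b : ℝ := (v ^ (1 / (m:ℝ))).toReal with hb
  have hvb : v ^ (1 / (m:ℝ)) = ENNReal.ofReal b := by
    rw [hb, ENNReal.ofReal_toReal]; exact ENNReal.rpow_ne_top_of_nonneg (by positivity) hfin
  have hvv : v = ENNReal.ofReal (b ^ m) := by
    rw [ENNReal.ofReal_pow ENNReal.toReal_nonneg, ← hvb, ← ENNReal.rpow_natCast, ← ENNReal.rpow_mul]
    rw [one_div_mul_cancel hm0.ne', ENNReal.rpow_one]
  have hbpos : 0 < b := by
    by_contra hcon
    have : b = 0 := le_antisymm (not_lt.1 hcon) ENNReal.toReal_nonneg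
    rw [this, zero_pow (by omega)] at hvv
    simp at hvv; exact hpos hvv
  set s : ℝ := b / (4 * l) with hs
  have hspos : 0 < s := by positivity
  have hbs : b = 4 * l * s := by rw [hs]; field_simp
  have hsub : Ioo (0:ℝ) 1 ⊆ Ioc 0 s ∪ Ioi s := by
    intro t ht
    rcases le_or_gt t s with h | h
    · exact Or.inl ⟨ht.1, h⟩
    · exact Or.inr h
  refine (lintegral_mono_set hsub).trans ((lintegral_union_le _ _ _).trans ?_)
  have e1 : ∫⁻ t in Ioc 0 s, ENNReal.ofReal ((t ^ m)⁻¹) * volume (A ∩ (S ∩ closedBall z (2 * l * t)))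
      ≤ ENNReal.ofReal ((4 * l) ^ (m-1) * b) := by
    calc _ ≤ ∫⁻ t in Ioc 0 s, ENNReal.ofReal ((4 * l) ^ m) := by
          refine setLIntegral_mono' measurableSet_Ioc fun t ht => ?_
          calc _ ≤ ENNReal.ofReal ((t ^ m)⁻¹) * volume (closedBall z (2 * l * t)) := by
                gcongr
                intro x hx; exact hx.2.2
            _ = ENNReal.ofReal ((t ^ m)⁻¹) * ENNReal.ofReal ((2 * (2 * l * t)) ^ m) := by
                rw [vol_cb z (by have := ht.1; positivity)]
            _ = ENNReal.ofReal ((4 * l) ^ m) := by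
                have := ht.1
                rw [← ENNReal.ofReal_mul (by positivity)]
                congr 1
                rw [show 2 * (2 * l * t) = (4 * l) * t by ring, mul_pow]; field_simp
            _ ≤ _ := le_rfl
      _ = ENNReal.ofReal ((4 * l) ^ (m-1) * b) := by
          rw [setLIntegral_const, Real.volume_Ioc, sub_zero, ← ENNReal.ofReal_mul (by positivity)]
          congr 1
          rw [hbs]
          obtain ⟨j, rfl⟩ : ∃ j, m = j + 1 := ⟨m - 1, by omega⟩
          simp only [Nat.add_sub_cancel]; ring
  have e2 : ∫⁻ t in Ioi s, ENNReal.ofReal ((t ^ m)⁻¹) * volume (A ∩ (S ∩ closedBall z (2 * l * t)))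
      ≤ ENNReal.ofReal ((4 * l) ^ (m-1) * b) := by
    calc _ ≤ ∫⁻ t in Ioi s, ENNReal.ofReal ((t ^ m)⁻¹) * v := by
          refine lintegral_mono fun t => ?_
          dsimp only
          gcongr
          exact measure_mono fun x hx => ⟨hx.1, hx.2.1⟩
      _ = (∫⁻ t in Ioi s, ENNReal.ofReal ((t ^ m)⁻¹)) * v := by
          rw [lintegral_mul_const' _ _ hfin]
      _ ≤ ENNReal.ofReal ((s ^ (m-1))⁻¹) * v := by gcongr; exact lint_Ioi_pow hm hspos
      _ = _ := by
          rw [hvv, ← ENNReal.ofReal_mul (by positivity)]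
          congr 1
          rw [hbs]
          obtain ⟨j, rfl⟩ : ∃ j, m = j + 1 := ⟨m - 1, by omega⟩
          simp only [Nat.add_sub_cancel]; rw [pow_succ, mul_pow]; field_simp
  calc _ ≤ ENNReal.ofReal ((4 * l) ^ (m-1) * b) + ENNReal.ofReal ((4 * l) ^ (m-1) * b) := add_le_add e1 e2
    _ = _ := by
      rw [hvb, ← ENNReal.ofReal_add (by positivity) (by positivity), ← ENNReal.ofReal_mul (by positivity)]
      congr 1; ring

lemma pot_morrey {m : ℕ} {q : ℝ} (hm : 1 ≤ m) (hq : (m:ℝ) < q) (l : ℝ) (hl : 0 < l)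
    (S : Set (Fin m → ℝ)) (g : (Fin m → ℝ) → ℝ≥0∞) (hg : Measurable g) (z : Fin m → ℝ) :
    Pot l S g z ≤ ENNReal.ofReal ((4 * l) ^ ((m:ℝ) - m / q) / (1 - m / q)) *
      (∫⁻ w in S, g w ^ q) ^ (1 / q) := by
  have hm0 : (1:ℝ) ≤ m := by exact_mod_cast hm
  have hq1 : 1 < q := by linarith
  have hpq : q.HolderConjugate (Real.conjExponent q) := Real.HolderConjugate.conjExponent hq1
  have hdiv : (m:ℝ) / q < 1 := by rw [div_lt_one (by linarith)]; exact hq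
  set N := (∫⁻ w in S, g w ^ q) ^ (1 / q) with hN
  unfold Pot
  have key : ∀ t ∈ Ioo (0:ℝ) 1, ENNReal.ofReal ((t ^ m)⁻¹) * ∫⁻ w in S ∩ closedBall z (2 * l * t), g w
      ≤ (ENNReal.ofReal ((4 * l) ^ ((m:ℝ) - m / q)) * N) * ENNReal.ofReal (t ^ (-((m:ℝ) / q))) := by
    intro t ht
    have ht0 := ht.1
    have h1 : ∫⁻ w in S ∩ closedBall z (2 * l * t), g w ≤
        N * ENNReal.ofReal ((4 * l * t) ^ ((m:ℝ) - m / q)) := by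
      have := ENNReal.lintegral_mul_le_Lp_mul_Lq (volume.restrict (S ∩ closedBall z (2 * l * t))) hpq
        hg.aemeasurable (aemeasurable_const (b := (1:ℝ≥0∞)))
      simp only [Pi.mul_apply, mul_one, ENNReal.one_rpow, lintegral_const, one_mul,
        Measure.restrict_apply_univ] at this
      refine this.trans ?_
      gcongr
      · exact ENNReal.rpow_le_rpow (lintegral_mono_set inter_subset_left) (by positivity)
      · calc volume (S ∩ closedBall z (2 * l * t)) ^ (1 / Real.conjExponent q)
            ≤ volume (closedBall z (2 * l * t)) ^ (1 / Real.conjExponent q) := by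
              have := hpq.symm.pos
              gcongr
              exact inter_subset_right
          _ = _ := by
              rw [vol_cb z (by positivity), ENNReal.ofReal_rpow_of_nonneg (by positivity)
                (by have := hpq.symm.pos; positivity)]
              congr 1
              rw [show 2 * (2 * l * t) = 4 * l * t by ring, ← Real.rpow_natCast, ← Real.rpow_mul (by positivity)]
              congr 1
              have h7 := hpq.inv_add_inv_eq_one
              rw [one_div, show (Real.conjExponent q)⁻¹ = 1 - q⁻¹ by linarith]; ring
    calc _ ≤ ENNReal.ofReal ((t ^ m)⁻¹) * (N * ENNReal.ofReal ((4 * l * t) ^ ((m:ℝ) - m / q))) := by gcongr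
      _ = N * (ENNReal.ofReal ((t ^ m)⁻¹) * ENNReal.ofReal ((4 * l * t) ^ ((m:ℝ) - m / q))) := by ring
      _ = N * (ENNReal.ofReal ((4 * l) ^ ((m:ℝ) - m / q)) * ENNReal.ofReal (t ^ (-((m:ℝ) / q)))) := by
          congr 1
          rw [← ENNReal.ofReal_mul (by positivity), ← ENNReal.ofReal_mul (by positivity)]
          congr 1
          rw [Real.mul_rpow (by positivity) ht0.le, Real.rpow_sub ht0, Real.rpow_neg ht0.le, Real.rpow_natCast]
          field_simp
      _ = _ := by ring
  refine (setLIntegral_mono' measurableSet_Ioo key).trans ?_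
  rw [lintegral_const_mul _ (by fun_prop)]
  have hint : ∫⁻ t in Ioo (0:ℝ) 1, ENNReal.ofReal (t ^ (-((m:ℝ) / q))) = ENNReal.ofReal (1 / (1 - m / q)) := by
    rw [restrict_Ioo_eq_restrict_Ioc]
    have hii : IntervalIntegrable (fun t : ℝ => t ^ (-((m:ℝ) / q))) volume 0 1 :=
      intervalIntegral.intervalIntegrable_rpow' (by linarith)
    rw [← ofReal_integral_eq_lintegral_ofReal ((intervalIntegrable_iff_integrableOn_Ioc_of_le zero_le_one).1 hii)]
    · rw [← intervalIntegral.integral_of_le zero_le_one, integral_rpow (Or.inl (by linarith))]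
      congr 1
      rw [Real.one_rpow, Real.zero_rpow (by linarith)]
      ring
    · filter_upwards [self_mem_ae_restrict measurableSet_Ioc] with t ht
      have := ht.1
      positivity
  rw [hint]
  have : (0:ℝ) < 1 - m / q := by linarith
  rw [div_eq_mul_one_div ((4 * l) ^ ((m:ℝ) - m / q)), ENNReal.ofReal_mul (by positivity)]
  apply le_of_eq; ring

end

section

def Dl (m : ℕ) (φ : ℝ → ℝ) (T : ℝ) : ℝ≥0∞ :=
  ∑' k : ℕ, ENNReal.ofReal ((T * 2 ^ k) * ((T * 2 ^ k) / φ (T * 2 ^ k)) ^ (1 / ((m:ℝ) - 1)))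

lemma dl_bound {m : ℕ} (hm : 2 ≤ m) (φ : ℝ → ℝ) (hmono : Monotone φ) (hpos : ∀ t, 0 < t → 0 < φ t)
    (hcal : ∃ t₀ : ℝ, 0 < t₀ ∧
      IntegrableOn (fun t => (t / φ t) ^ (1 / ((m : ℝ) - 1))) (Ioi t₀) volume)
    (τ : ℝ) (hτ : 0 < τ) : ∃ M : ℝ≥0∞, M < ⊤ ∧ ∀ T, τ ≤ T → Dl m φ T ≤ M := by
  obtain ⟨t₀, ht₀, hint⟩ := hcal
  have hm2 : (2:ℝ) ≤ m := by exact_mod_cast hm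
  set e : ℝ := 1 / ((m:ℝ) - 1) with he
  have he0 : 0 < e := by rw [he]; apply div_pos one_pos; linarith
  have he1 : e ≤ 1 := by rw [he, div_le_one (by linarith)]; linarith
  set h : ℝ → ℝ≥0∞ := fun t => ENNReal.ofReal ((t / φ t) ^ e) with hh
  refine ⟨4 * ∫⁻ t in Ioi (τ / 2), h t, ?_, ?_⟩
  · apply ENNReal.mul_lt_top (by simp)
    have hsub : Ioi (τ / 2) ⊆ Ioc (τ / 2) t₀ ∪ Ioi t₀ := by
      intro t ht
      rcases le_or_gt t t₀ with h | h
      · exact Or.inl ⟨ht, h⟩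
      · exact Or.inr h
    refine (lintegral_mono_set hsub).trans_lt ((lintegral_union_le _ _ _).trans_lt ?_)
    refine ENNReal.add_lt_top.2 ⟨?_, ?_⟩
    · calc ∫⁻ t in Ioc (τ / 2) t₀, h t ≤ ∫⁻ t in Ioc (τ / 2) t₀, ENNReal.ofReal ((t₀ / φ (τ / 2)) ^ e) := by
            refine setLIntegral_mono' measurableSet_Ioc fun t ht => ?_
            apply ENNReal.ofReal_le_ofReal
            have h1 : 0 < t := by linarith [ht.1]
            have h2 := hpos t h1
            have h3 := hpos (τ / 2) (by linarith)
            have h4 := hmono ht.1.le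
            have h5 := ht.2
            gcongr
        _ < ⊤ := by
            rw [setLIntegral_const, Real.volume_Ioc]
            exact ENNReal.mul_lt_top ENNReal.ofReal_lt_top ENNReal.ofReal_lt_top
    · exact hint.lintegral_lt_top
  · intro T hT
    have hT0 : 0 < T := hτ.trans_le hT
    have hterm : ∀ k : ℕ, ENNReal.ofReal ((T * 2 ^ k) * ((T * 2 ^ k) / φ (T * 2 ^ k)) ^ e) ≤
        4 * ∫⁻ t in Ioc (T * 2 ^ k / 2) (T * 2 ^ k), h t := by
      intro k
      set s := T * 2 ^ k with hs
      have hs0 : 0 < s := by positivity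
      have hφ := hpos s hs0
      calc ENNReal.ofReal (s * (s / φ s) ^ e) ≤ 4 * (ENNReal.ofReal ((s / 2 / φ s) ^ e) * ENNReal.ofReal (s / 2)) := by
            rw [← ENNReal.ofReal_mul (by positivity), show (4:ℝ≥0∞) = ENNReal.ofReal 4 by simp,
              ← ENNReal.ofReal_mul (by norm_num)]
            apply ENNReal.ofReal_le_ofReal
            rw [show s / 2 / φ s = (1/2) * (s / φ s) by ring, Real.mul_rpow (by norm_num) (by positivity)]
            have : (1/2:ℝ) ≤ (1/2:ℝ) ^ e := by
              conv_lhs => rw [← Real.rpow_one (1/2:ℝ)]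
              exact Real.rpow_le_rpow_of_exponent_ge (by norm_num) (by norm_num) he1
            have h0 : 0 ≤ (s / φ s) ^ e * s := by positivity
            nlinarith
        _ = 4 * ∫⁻ t in Ioc (s / 2) s, ENNReal.ofReal ((s / 2 / φ s) ^ e) := by
            rw [setLIntegral_const, Real.volume_Ioc]; congr 3; ring
        _ ≤ _ := by
            gcongr 4 * ?_
            refine setLIntegral_mono' measurableSet_Ioc fun t ht => ?_
            apply ENNReal.ofReal_le_ofReal
            have h1 : 0 < t := by linarith [ht.1]
            have h2 := hpos t h1
            have h4 := hmono ht.2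
            have h5 := ht.1.le
            gcongr
    refine (ENNReal.tsum_le_tsum hterm).trans ?_
    rw [ENNReal.tsum_mul_left, ← lintegral_iUnion]
    · gcongr 4 * ?_
      apply lintegral_mono_set
      intro t ht
      obtain ⟨k, hk⟩ := mem_iUnion.1 ht
      have : (1:ℝ) ≤ 2 ^ k := one_le_pow₀ (by norm_num)
      have := hk.1
      simp only [mem_Ioi]
      nlinarith
    · intro k; exact measurableSet_Ioc
    · intro i j hij
      have key : ∀ i j : ℕ, i < j → Disjoint (Ioc (T * 2 ^ i / 2) (T * 2 ^ i)) (Ioc (T * 2 ^ j / 2) (T * 2 ^ j)) := by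
        intro i j hij
        rw [Set.disjoint_left]
        intro t h1 h2
        have : (2:ℝ) ^ (i+1) ≤ 2 ^ j := pow_le_pow_right₀ (by norm_num) hij
        rw [pow_succ] at this
        have h3 := h1.2
        have h4 := h2.1
        nlinarith
      rcases lt_or_gt_of_ne hij with h | h
      · exact key i j h
      · exact (key j i h).symm

lemma tsum_holder {p q : ℝ} (hpq : p.HolderConjugate q) (b c : ℕ → ℝ≥0∞) :
    ∑' k, b k * c k ≤ (∑' k, b k ^ p) ^ (1 / p) * (∑' k, c k ^ q) ^ (1 / q) := by
  have := ENNReal.lintegral_mul_le_Lp_mul_Lq (Measure.count : Measure ℕ) hpq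
    (f := b) (g := c) (Measurable.of_discrete.aemeasurable) (Measurable.of_discrete.aemeasurable)
  simpa [lintegral_count] using this

lemma pot_orlicz {m : ℕ} (hm : 2 ≤ m) (φ : ℝ → ℝ) (hmono : Monotone φ) (hpos : ∀ t, 0 < t → 0 < φ t)
    (l : ℝ) (hl : 0 < l) (c z : Fin m → ℝ) (a : (Fin m → ℝ) → ℝ) (ha : Measurable a)
    (T : ℝ) (hT : 0 < T) :
    Pot l (closedBall c l) (fun w => ENNReal.ofReal (a w)) z ≤
      ENNReal.ofReal ((4 * l) ^ (m-1) * 4) * (ENNReal.ofReal (l * T) +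
        Dl m φ T ^ (((m:ℝ) - 1) / m) *
        (∫⁻ w in closedBall c l, {w | T < a w}.indicator (fun w => ENNReal.ofReal (φ (a w))) w) ^ (1 / (m:ℝ))) := by
  have hm2 : (2:ℝ) ≤ m := by exact_mod_cast hm
  set S := closedBall c l with hS
  set Ak : ℕ → Set (Fin m → ℝ) := fun k => {w | T < a w ∧ T * 2 ^ k ≤ a w ∧ a w < T * 2 ^ (k+1)} with hAk
  have hAkm : ∀ k, MeasurableSet (Ak k) := fun k =>
    (measurableSet_lt measurable_const ha).inter
      ((measurableSet_le measurable_const ha).inter (measurableSet_lt ha measurable_const))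
  have hpt : ∀ w, ENNReal.ofReal (a w) ≤ ENNReal.ofReal T * (univ : Set (Fin m → ℝ)).indicator 1 w +
      ∑' k, ENNReal.ofReal (T * 2 ^ (k+1)) * (Ak k).indicator 1 w := by
    intro w
    rcases le_or_gt (a w) T with h | h
    · simp only [mem_univ, indicator_of_mem, Pi.one_apply, mul_one]
      exact le_add_right (ENNReal.ofReal_le_ofReal h)
    · have h1 : 1 < a w / T := (one_lt_div hT).2 h
      obtain ⟨k, hk1, hk2⟩ := exists_nat_pow_near h1.le (one_lt_two (α := ℝ))
      rw [le_div_iff₀ hT] at hk1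
      rw [div_lt_iff₀ hT] at hk2
      have hmem : w ∈ Ak k := ⟨h, by linarith, by linarith⟩
      refine le_add_left (le_trans ?_ (ENNReal.le_tsum k))
      simp only [hmem, indicator_of_mem, Pi.one_apply, mul_one]
      exact ENNReal.ofReal_le_ofReal (by linarith)
  have hholder : (m / ((m:ℝ) - 1)).HolderConjugate (m:ℝ) := by
    rw [Real.holderConjugate_iff]
    constructor
    · rw [lt_div_iff₀ (by linarith)]; linarith
    · field_simp; ring
  have hdisj : Pairwise (Function.onFun Disjoint fun k => S ∩ Ak k) := by
    have key : ∀ i j : ℕ, i < j → Disjoint (S ∩ Ak i) (S ∩ Ak j) := by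
      intro i j hij
      rw [Set.disjoint_left]
      intro t h1 h2
      have : (2:ℝ) ^ (i+1) ≤ 2 ^ j := pow_le_pow_right₀ (by norm_num) hij
      have h3 := h1.2.2.2
      have h4 := h2.2.2.1
      nlinarith
    intro i j hij
    rcases lt_or_gt_of_ne hij with h | h
    · exact key i j h
    · exact (key j i h).symm
  set I : ℕ → ℝ≥0∞ := fun k => ∫⁻ w in S ∩ Ak k, ENNReal.ofReal (φ (a w)) with hI
  have hsumI : ∑' k, I k ≤ ∫⁻ w in S, {w | T < a w}.indicator (fun w => ENNReal.ofReal (φ (a w))) w := by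
    rw [hI, ← lintegral_iUnion (fun k => measurableSet_closedBall.inter (hAkm k)) hdisj]
    rw [setLIntegral_indicator (measurableSet_lt measurable_const ha)]
    apply lintegral_mono_set
    intro w hw
    obtain ⟨k, hk⟩ := mem_iUnion.1 hw
    exact ⟨hk.2.1, hk.1⟩
  have hterm : ∀ k, ENNReal.ofReal (T * 2 ^ (k+1)) * volume (Ak k ∩ S) ^ (1 / (m:ℝ)) ≤
      2 * (ENNReal.ofReal ((T * 2 ^ k) * (φ (T * 2 ^ k))⁻¹ ^ (1 / (m:ℝ))) * I k ^ (1 / (m:ℝ))) := by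
    intro k
    set s := T * 2 ^ k with hs
    have hs0 : 0 < s := by positivity
    have hφ := hpos s hs0
    have h1 : volume (Ak k ∩ S) ≤ ENNReal.ofReal (φ s)⁻¹ * I k := by
      have : ENNReal.ofReal (φ s) * volume (Ak k ∩ S) ≤ I k := by
        rw [← setLIntegral_const, inter_comm]
        refine setLIntegral_mono' (measurableSet_closedBall.inter (hAkm k)) fun w hw => ?_
        exact ENNReal.ofReal_le_ofReal (hmono hw.2.2.1)
      calc _ = ENNReal.ofReal (φ s)⁻¹ * (ENNReal.ofReal (φ s) * volume (Ak k ∩ S)) := by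
            rw [← mul_assoc, ← ENNReal.ofReal_mul (by positivity), inv_mul_cancel₀ hφ.ne']; simp
        _ ≤ _ := by gcongr
    calc _ ≤ ENNReal.ofReal (T * 2 ^ (k+1)) * (ENNReal.ofReal (φ s)⁻¹ * I k) ^ (1 / (m:ℝ)) := by gcongr
      _ = _ := by
        rw [ENNReal.mul_rpow_of_nonneg _ _ (by positivity), ENNReal.ofReal_rpow_of_nonneg (by positivity) (by positivity),
          ← mul_assoc, ← ENNReal.ofReal_mul (by positivity), ← mul_assoc]
        congr 1
        rw [show (2:ℝ≥0∞) = ENNReal.ofReal 2 by simp, ← ENNReal.ofReal_mul (by norm_num)]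
        congr 1; rw [hs, pow_succ]; ring
  have hDl : ∑' k, (ENNReal.ofReal ((T * 2 ^ k) * (φ (T * 2 ^ k))⁻¹ ^ (1 / (m:ℝ)))) ^ (m / ((m:ℝ) - 1)) = Dl m φ T := by
    unfold Dl
    congr 1; ext k
    set s := T * 2 ^ k with hs
    have hs0 : 0 < s := by positivity
    have hφ := hpos s hs0
    have hm1 : (0:ℝ) < m - 1 := by linarith
    rw [ENNReal.ofReal_rpow_of_nonneg (by positivity) (by positivity)]
    congr 1
    rw [Real.mul_rpow (by positivity) (by positivity), ← Real.rpow_mul (by positivity),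
      Real.div_rpow (by positivity) (by positivity), Real.inv_rpow (by positivity)]
    rw [show 1 / (m:ℝ) * (m / ((m:ℝ) - 1)) = 1 / ((m:ℝ) - 1) by field_simp]
    rw [show (m:ℝ) / ((m:ℝ) - 1) = 1 + 1 / ((m:ℝ) - 1) by field_simp; ring, Real.rpow_add hs0, Real.rpow_one]
    ring
  have hmeas : ∀ k, Measurable fun w => ENNReal.ofReal (T * 2 ^ (k+1)) * (Ak k).indicator (1 : (Fin m → ℝ) → ℝ≥0∞) w :=
    fun k => (measurable_one.indicator (hAkm k)).const_mul _
  refine (pot_mono l S measurableSet_closedBall _ _ z (fun w _ => hpt w)).trans ?_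
  rw [pot_add l hl S _ _ (by simp), pot_const_mul _ _ _ _ ENNReal.ofReal_ne_top, pot_tsum l hl S _ hmeas]
  simp_rw [pot_const_mul _ _ _ _ ENNReal.ofReal_ne_top]
  have hv : volume S ^ (1 / (m:ℝ)) = ENNReal.ofReal (2 * l) := by
    rw [hS, vol_cb c hl.le, ENNReal.ofReal_rpow_of_nonneg (by positivity) (by positivity), one_div,
      Real.pow_rpow_inv_natCast (by positivity) (by omega)]
  set C := ENNReal.ofReal (2 * (4 * l) ^ (m-1)) with hC
  set J := ∫⁻ w in S, {w | T < a w}.indicator (fun w => ENNReal.ofReal (φ (a w))) w with hJ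
  have e1 : ENNReal.ofReal T * Pot l S (univ.indicator 1) z ≤ C * 2 * ENNReal.ofReal (l * T) := by
    calc _ ≤ ENNReal.ofReal T * (C * volume (univ ∩ S) ^ (1 / (m:ℝ))) := by
          gcongr; exact pot_ind hm l hl S _ MeasurableSet.univ z
      _ = _ := by
          rw [univ_inter, hv, ENNReal.ofReal_mul (by norm_num : (0:ℝ) ≤ 2), ENNReal.ofReal_mul hl.le]
          simp; ring
  have e2 : ∑' k, ENNReal.ofReal (T * 2 ^ (k+1)) * Pot l S ((Ak k).indicator 1) z ≤
      C * 2 * (Dl m φ T ^ (((m:ℝ) - 1) / m) * J ^ (1 / (m:ℝ))) := by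
    calc _ ≤ ∑' k, C * 2 * (ENNReal.ofReal ((T * 2 ^ k) * (φ (T * 2 ^ k))⁻¹ ^ (1 / (m:ℝ))) * I k ^ (1 / (m:ℝ))) := by
          refine ENNReal.tsum_le_tsum fun k => ?_
          calc _ ≤ ENNReal.ofReal (T * 2 ^ (k+1)) * (C * volume (Ak k ∩ S) ^ (1 / (m:ℝ))) := by
                gcongr; exact pot_ind hm l hl S _ (hAkm k) z
            _ = C * (ENNReal.ofReal (T * 2 ^ (k+1)) * volume (Ak k ∩ S) ^ (1 / (m:ℝ))) := by ring
            _ ≤ _ := by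
                rw [mul_assoc]; exact mul_le_mul_right (hterm k) _
      _ = C * 2 * ∑' k, (ENNReal.ofReal ((T * 2 ^ k) * (φ (T * 2 ^ k))⁻¹ ^ (1 / (m:ℝ))) * I k ^ (1 / (m:ℝ))) := by
          rw [ENNReal.tsum_mul_left]
      _ ≤ _ := by
          gcongr
          refine (tsum_holder hholder _ _).trans ?_
          rw [hDl, one_div_div]
          gcongr
          have : ∀ k, (I k ^ (1 / (m:ℝ))) ^ (m:ℝ) = I k := fun k => by
            rw [← ENNReal.rpow_mul, one_div_mul_cancel (by linarith), ENNReal.rpow_one]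
          simp_rw [this]; exact hsumI
  refine (add_le_add e1 e2).trans (le_of_eq ?_)
  rw [← mul_add, hC]
  congr 1
  rw [show (2:ℝ≥0∞) = ENNReal.ofReal 2 by simp, ← ENNReal.ofReal_mul (by positivity)]
  congr 1; ring

end

section

def bmp (n : ℕ) (ε : ℝ) (h : 0 < ε) : ContDiffBump (0 : Fin n → ℝ) :=
  ⟨ε / 2, ε, by linarith, by linarith⟩

def eta (n : ℕ) (ε : ℝ) : (Fin n → ℝ) → ℝ :=
  if h : 0 < ε then (bmp n ε h).normed volume else 0

lemma eta_eq {n : ℕ} {ε : ℝ} (h : 0 < ε) : eta n ε = (bmp n ε h).normed volume := by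
  simp [eta, h]

lemma eta_contDiff {n : ℕ} {ε : ℝ} (h : 0 < ε) : ContDiff ℝ (⊤ : ℕ∞) (eta n ε) := by
  rw [eta_eq h]; exact (bmp n ε h).contDiff_normed

lemma eta_cs {n : ℕ} {ε : ℝ} (h : 0 < ε) : HasCompactSupport (eta n ε) := by
  rw [eta_eq h]; exact (bmp n ε h).hasCompactSupport_normed

lemma eta_tsupport {n : ℕ} {ε : ℝ} (h : 0 < ε) : tsupport (eta n ε) = closedBall 0 ε := by
  rw [eta_eq h]; exact (bmp n ε h).tsupport_normed_eq

lemma eta_nonneg {n : ℕ} {ε : ℝ} (h : 0 < ε) (x : Fin n → ℝ) : 0 ≤ eta n ε x := by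
  rw [eta_eq h]; exact (bmp n ε h).nonneg_normed x

lemma eta_cont {n : ℕ} {ε : ℝ} (h : 0 < ε) : Continuous (eta n ε) := (eta_contDiff h).continuous

lemma eta_zero {n : ℕ} {ε : ℝ} (h : 0 < ε) (x : Fin n → ℝ) (hx : ε ≤ ‖x‖) : eta n ε x = 0 := by
  have h1 : Function.support (eta n ε) = ball 0 ε := by
    rw [eta_eq h]; exact (bmp n ε h).support_normed_eq
  by_contra hne
  have : x ∈ ball (0 : Fin n → ℝ) ε := h1 ▸ hne
  rw [mem_ball_zero_iff] at this; linarith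

lemma eta_neg {n : ℕ} {ε : ℝ} (h : 0 < ε) (x : Fin n → ℝ) : eta n ε (-x) = eta n ε x := by
  rw [eta_eq h]; exact (bmp n ε h).normed_neg x

lemma eta_integrable {n : ℕ} {ε : ℝ} (h : 0 < ε) : Integrable (eta n ε) := by
  rw [eta_eq h]; exact (bmp n ε h).integrable_normed

lemma eta_integral {n : ℕ} {ε : ℝ} (h : 0 < ε) : ∫ x, eta n ε x = 1 := by
  rw [eta_eq h]; exact (bmp n ε h).integral_normed

lemma eta_lintegral {n : ℕ} {ε : ℝ} (h : 0 < ε) : ∫⁻ x, ENNReal.ofReal (eta n ε x) = 1 := by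
  rw [← ofReal_integral_eq_lintegral_ofReal (eta_integrable h) (Eventually.of_forall (eta_nonneg h)),
    eta_integral h]; simp

lemma eta_lintegral_sub {n : ℕ} {ε : ℝ} (h : 0 < ε) (y : Fin n → ℝ) :
    ∫⁻ x, ENNReal.ofReal (eta n ε (y - x)) = 1 := by
  rw [lintegral_sub_left_eq_self (fun x => ENNReal.ofReal (eta n ε x)) y, eta_lintegral h]

lemma eta_le {n : ℕ} {ε : ℝ} (h : 0 < ε) (x : Fin n → ℝ) : eta n ε x ≤ (ε ^ n)⁻¹ := by
  rw [eta_eq h]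
  refine ((bmp n ε h).normed_le_div_measure_closedBall_rOut volume 2 (by simp [bmp]; linarith) x).trans ?_
  have : volume.real (closedBall (0 : Fin n → ℝ) (bmp n ε h).rOut) = (2 * ε) ^ n := by
    rw [Measure.real, vol_cb _ (by simp [bmp]; linarith), ENNReal.toReal_ofReal]
    · simp [bmp]
    · simp only [bmp]; positivity
  rw [this]; simp [mul_pow]; rw [div_mul_cancel_left₀ (by positivity)]

open scoped Convolution in
def moll {V : Type*} [NormedAddCommGroup V] [NormedSpace ℝ V] {n : ℕ} (ε : ℝ) (f : (Fin n → ℝ) → V) :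
    (Fin n → ℝ) → V := (eta n ε) ⋆[ContinuousLinearMap.lsmul ℝ ℝ, volume] f

lemma moll_eq {V : Type*} [NormedAddCommGroup V] [NormedSpace ℝ V] {n : ℕ} (ε : ℝ)
    (f : (Fin n → ℝ) → V) (x) : moll ε f x = ∫ z, eta n ε (x - z) • f z := by
  unfold moll; rw [convolution_lsmul_swap]

lemma moll_contDiff {V : Type*} [NormedAddCommGroup V] [NormedSpace ℝ V] {n : ℕ} {ε : ℝ} (h : 0 < ε)
    (f : (Fin n → ℝ) → V) (hf : LocallyIntegrable f) : ContDiff ℝ (⊤ : ℕ∞) (moll ε f) :=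
  (eta_cs h).contDiff_convolution_left _ (eta_contDiff h) hf

lemma moll_close {V : Type*} [NormedAddCommGroup V] [NormedSpace ℝ V] [CompleteSpace V] {n : ℕ} {ε : ℝ}
    (h : 0 < ε) (f : (Fin n → ℝ) → V) (hf : AEStronglyMeasurable f) (x : Fin n → ℝ) (δ : ℝ)
    (hd : ∀ y ∈ ball x ε, dist (f y) (f x) ≤ δ) : dist (moll ε f x) (f x) ≤ δ := by
  unfold moll; rw [eta_eq h]
  exact (bmp n ε h).dist_normed_convolution_le hf hd

lemma moll_fderiv {V : Type*} [NormedAddCommGroup V] [NormedSpace ℝ V] [CompleteSpace V] {n : ℕ} {ε : ℝ}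
    (h : 0 < ε)
    (f : (Fin n → ℝ) → V) (hf : LocallyIntegrable f) (x v : Fin n → ℝ) :
    fderiv ℝ (moll ε f) x v = ∫ z, fderiv ℝ (eta n ε) (x - z) v • f z := by
  have h1 := (eta_cs (n := n) h).hasFDerivAt_convolution_left (ContinuousLinearMap.lsmul ℝ ℝ : ℝ →L[ℝ] V →L[ℝ] V)
    ((eta_contDiff h).of_le (by exact_mod_cast le_top)) hf x
  unfold moll
  rw [h1.fderiv, convolution_eq_swap, ContinuousLinearMap.integral_apply]
  · rfl
  · have h2 := ((eta_cs (n := n) h).fderiv (𝕜 := ℝ)).convolutionExists_left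
      ((ContinuousLinearMap.lsmul ℝ ℝ : ℝ →L[ℝ] V →L[ℝ] V).precompL (Fin n → ℝ))
      ((eta_contDiff h).continuous_fderiv (by simp)) hf x
    exact convolutionExistsAt_iff_integrable_swap.1 h2

lemma eta_test {n : ℕ} {ε : ℝ} (h : 0 < ε) (x : Fin n → ℝ) :
    ContDiff ℝ (⊤ : ℕ∞) (fun z => eta n ε (x - z)) ∧ HasCompactSupport (fun z => eta n ε (x - z)) ∧
    tsupport (fun z => eta n ε (x - z)) ⊆ closedBall x ε ∧
    ∀ z v, fderiv ℝ (fun z => eta n ε (x - z)) z v = - fderiv ℝ (eta n ε) (x - z) v := by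
  have hts : tsupport (fun z => eta n ε (x - z)) ⊆ closedBall x ε := by
    apply closure_minimal _ isClosed_closedBall
    intro z hz
    by_contra hne
    apply hz
    apply eta_zero h
    rw [mem_closedBall, dist_comm, dist_eq_norm, not_le] at hne
    exact hne.le
  refine ⟨(eta_contDiff h).comp (by fun_prop), ?_, hts, ?_⟩
  · exact HasCompactSupport.of_support_subset_isCompact (isCompact_closedBall x ε)
      ((subset_tsupport _).trans hts)
  · intro z v
    have h1 : HasFDerivAt (eta n ε) (fderiv ℝ (eta n ε) (x - z)) (x - z) :=
      ((eta_contDiff h).differentiable (by simp) _).hasFDerivAt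
    have h2 : HasFDerivAt (fun z => x - z) (-ContinuousLinearMap.id ℝ (Fin n → ℝ)) z :=
      (hasFDerivAt_id z).const_sub x
    have h3 := h1.comp z h2
    have : (fun z => eta n ε (x - z)) = eta n ε ∘ fun z => x - z := rfl
    rw [this, h3.fderiv]
    simp

def WD {n : ℕ} {V : Type*} [NormedAddCommGroup V] [NormedSpace ℝ V] (U : Set (Fin n → ℝ))
    (f : (Fin n → ℝ) → V) (A : (Fin n → ℝ) → (Fin n → ℝ) →L[ℝ] V) : Prop :=
  ∀ ψ : (Fin n → ℝ) → ℝ, ContDiff ℝ (⊤ : ℕ∞) ψ → HasCompactSupport ψ → tsupport ψ ⊆ U →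
    ∀ v, ∫ x, ψ x • A x v = - ∫ x, fderiv ℝ ψ x v • f x

lemma moll_wd {n : ℕ} {V : Type*} [NormedAddCommGroup V] [NormedSpace ℝ V] [CompleteSpace V]
    {U : Set (Fin n → ℝ)}
    {f : (Fin n → ℝ) → V} {A : (Fin n → ℝ) → (Fin n → ℝ) →L[ℝ] V} (hw : WD U f A)
    (hf : LocallyIntegrable f) {ε : ℝ} (h : 0 < ε) (x : Fin n → ℝ) (hx : closedBall x ε ⊆ U) :
    ‖fderiv ℝ (moll ε f) x‖ₑ ≤ ∫⁻ z, ENNReal.ofReal (eta n ε (x - z)) * ‖A z‖ₑ := by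
  apply ContinuousLinearMap.opENorm_le_bound
  intro v
  obtain ⟨t1, t2, t3, t4⟩ := eta_test (n := n) h x
  have := hw _ t1 t2 (t3.trans hx) v
  simp_rw [t4, neg_smul, integral_neg, neg_neg] at this
  rw [moll_fderiv h f hf, ← this]
  refine (enorm_integral_le_lintegral_enorm _).trans ?_
  calc _ ≤ ∫⁻ z, (ENNReal.ofReal (eta n ε (x - z)) * ‖A z‖ₑ) * ‖v‖ₑ := by
        refine lintegral_mono fun z => ?_
        rw [enorm_smul, mul_assoc, ← ofReal_norm (eta n ε (x - z)), Real.norm_of_nonneg (eta_nonneg h _)]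
        gcongr
        exact ContinuousLinearMap.le_opENorm _ _
    _ = _ := lintegral_mul_const' _ _ enorm_ne_top

end

section

def geta {n : ℕ} (ε : ℝ) (g : (Fin n → ℝ) → ℝ≥0∞) (w : Fin n → ℝ) : ℝ≥0∞ :=
  ∫⁻ ζ, ENNReal.ofReal (eta n ε (w - ζ)) * g ζ

lemma geta_meas {n : ℕ} {ε : ℝ} (h : 0 < ε) (g : (Fin n → ℝ) → ℝ≥0∞) (hg : Measurable g) :
    Measurable (geta ε g) := by
  unfold geta
  apply Measurable.lintegral_prod_right'
    (f := fun p : (Fin n → ℝ) × (Fin n → ℝ) => ENNReal.ofReal (eta n ε (p.1 - p.2)) * g p.2)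
  have := (eta_cont (n := n) h).measurable
  fun_prop

lemma pot_max {n : ℕ} (l : ℝ) (hl : 0 < l) (S : Set (Fin n → ℝ))
    (g : (Fin n → ℝ) → ℝ≥0∞) (hg : Measurable g) (z : Fin n → ℝ) (M : ℝ≥0∞) (ε : ℝ) (hε : 0 < ε)
    (hεl : ε ≤ l)
    (hM : ∀ s, 0 < s → s ≤ 4 * l → ∫⁻ w in closedBall z s, g w ≤ M * ENNReal.ofReal (s ^ n)) :
    Pot l S (geta ε g) z ≤ M * ENNReal.ofReal ((8 * l) ^ n) := by
  have hηm : Measurable (eta n ε) := (eta_cont (n := n) hε).measurable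
  have key : ∀ t ∈ Ioo (0:ℝ) 1, ∫⁻ w in S ∩ closedBall z (2 * l * t), geta ε g w ≤
      M * ENNReal.ofReal ((8 * l * t) ^ n) := by
    intro t ht
    have ht0 := ht.1
    have ht1 := ht.2
    refine (lintegral_mono_set inter_subset_right).trans ?_
    rcases le_or_gt ε (2 * l * t) with h | h
    · unfold geta
      rw [lintegral_lintegral_swap]
      · calc _ ≤ ∫⁻ ζ, (closedBall z (4 * l * t)).indicator g ζ := by
              refine lintegral_mono fun ζ => ?_
              by_cases hζ : ζ ∈ closedBall z (4 * l * t)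
              · rw [indicator_of_mem hζ]
                rw [lintegral_mul_const _ (by fun_prop)]
                refine mul_le_of_le_one_left zero_le ?_
                refine (setLIntegral_le_lintegral _ _).trans ?_
                rw [lintegral_sub_right_eq_self (fun w => ENNReal.ofReal (eta n ε w)) ζ, eta_lintegral hε]
              · rw [indicator_of_notMem hζ]
                apply le_of_eq
                rw [setLIntegral_congr_fun (g := fun _ => 0) measurableSet_closedBall]
                · simp
                · intro w hw
                  have : eta n ε (w - ζ) = 0 := by
                    apply eta_zero hε
                    rw [← dist_eq_norm]
                    rw [mem_closedBall] at hw hζ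
                    have := dist_triangle_left ζ z w
                    linarith
                  simp [this]
          _ = ∫⁻ ζ in closedBall z (4 * l * t), g ζ := lintegral_indicator measurableSet_closedBall _
          _ ≤ M * ENNReal.ofReal ((4 * l * t) ^ n) := hM _ (by positivity) (by nlinarith)
          _ ≤ _ := by gcongr; norm_num
      · apply Measurable.aemeasurable
        fun_prop
    · have hp : ∀ w ∈ closedBall z (2 * l * t), geta ε g w ≤ M * ENNReal.ofReal (2 ^ n) := by
        intro w hw
        unfold geta
        calc _ ≤ ∫⁻ ζ, (closedBall z (2 * ε)).indicator (fun ζ => ENNReal.ofReal ((ε ^ n)⁻¹) * g ζ) ζ := by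
              refine lintegral_mono fun ζ => ?_
              by_cases hζ : ζ ∈ closedBall z (2 * ε)
              · rw [indicator_of_mem hζ]
                gcongr
                exact eta_le hε _
              · rw [indicator_of_notMem hζ]
                have : eta n ε (w - ζ) = 0 := by
                  apply eta_zero hε
                  rw [← dist_eq_norm]
                  rw [mem_closedBall] at hw hζ
                  have := dist_triangle_left ζ z w
                  linarith
                simp [this]
          _ = ENNReal.ofReal ((ε ^ n)⁻¹) * ∫⁻ ζ in closedBall z (2 * ε), g ζ := by
              rw [lintegral_indicator measurableSet_closedBall, lintegral_const_mul' _ _ ENNReal.ofReal_ne_top]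
          _ ≤ ENNReal.ofReal ((ε ^ n)⁻¹) * (M * ENNReal.ofReal ((2 * ε) ^ n)) := by
              gcongr; exact hM _ (by positivity) (by nlinarith)
          _ = M * (ENNReal.ofReal ((ε ^ n)⁻¹) * ENNReal.ofReal ((2 * ε) ^ n)) := by ring
          _ = _ := by
              rw [← ENNReal.ofReal_mul (by positivity), mul_pow]
              congr 2; field_simp
      calc _ ≤ ∫⁻ w in closedBall z (2 * l * t), M * ENNReal.ofReal (2 ^ n) :=
            setLIntegral_mono' measurableSet_closedBall hp
        _ = M * (ENNReal.ofReal (2 ^ n) * ENNReal.ofReal ((2 * (2 * l * t)) ^ n)) := by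
            rw [setLIntegral_const, vol_cb z (by positivity)]; ring
        _ = _ := by
            rw [← ENNReal.ofReal_mul (by positivity), ← mul_pow]
            congr 3; ring
  unfold Pot
  calc _ ≤ ∫⁻ t in Ioo (0:ℝ) 1, M * ENNReal.ofReal ((8 * l) ^ n) := by
        refine setLIntegral_mono' measurableSet_Ioo fun t ht => ?_
        have ht0 := ht.1
        calc _ ≤ ENNReal.ofReal ((t ^ n)⁻¹) * (M * ENNReal.ofReal ((8 * l * t) ^ n)) :=
              mul_le_mul_right (key t ht) _
          _ = M * (ENNReal.ofReal ((t ^ n)⁻¹) * ENNReal.ofReal ((8 * l * t) ^ n)) := by ring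
          _ = _ := by
              rw [← ENNReal.ofReal_mul (by positivity), mul_pow (8 * l)]
              congr 2; field_simp
    _ = _ := by rw [setLIntegral_const]; simp

lemma moll_tendsto {n : ℕ} {V : Type*} [NormedAddCommGroup V] [NormedSpace ℝ V] [CompleteSpace V]
    (f : (Fin n → ℝ) → V) (hf : Continuous f) (x : Fin n → ℝ) :
    Tendsto (fun ε => moll ε f x) (𝓝[>] 0) (𝓝 (f x)) := by
  rw [Metric.tendsto_nhds]
  intro δ hδ
  obtain ⟨r, hr, hr'⟩ := Metric.continuous_iff.1 hf x (δ / 2) (by positivity)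
  filter_upwards [Ioo_mem_nhdsGT hr] with ε hε
  refine (moll_close hε.1 f hf.aestronglyMeasurable x (δ / 2) fun y hy => ?_).trans_lt (by linarith)
  exact (hr' y ((mem_ball.1 hy).trans hε.2)).le

lemma wd_max {n : ℕ} {U : Set (Fin n → ℝ)}
    {f : (Fin n → ℝ) → (Fin n → ℝ)} {A : (Fin n → ℝ) → (Fin n → ℝ) →L[ℝ] (Fin n → ℝ)} (hw : WD U f A)
    (hf : Continuous f) (hA : Measurable (fun x => ‖A x‖ₑ)) (x y : Fin n → ℝ) (l : ℝ) (hl : 0 < l)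
    (hy : y ∈ closedBall x l) (hU : closedBall x (2 * l) ⊆ U) (M : ℝ≥0∞)
    (hMx : ∀ s, 0 < s → s ≤ 4 * l → ∫⁻ w in closedBall x s, ‖A w‖ₑ ≤ M * ENNReal.ofReal (s ^ n))
    (hMy : ∀ s, 0 < s → s ≤ 4 * l → ∫⁻ w in closedBall y s, ‖A w‖ₑ ≤ M * ENNReal.ofReal (s ^ n)) :
    ‖f x - f y‖ₑ ≤ M * ENNReal.ofReal (4 ^ (n+1) * l) := by
  have hev : ∀ᶠ ε in 𝓝[>] (0:ℝ), ‖moll ε f x - moll ε f y‖ₑ ≤ M * ENNReal.ofReal (4 ^ (n+1) * l) := by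
    filter_upwards [Ioo_mem_nhdsGT hl] with ε hε
    have h1 := osc_le_pot (moll ε f) ((moll_contDiff hε.1 f hf.locallyIntegrable).of_le (by exact_mod_cast le_top))
      x x y l hl (mem_closedBall_self hl.le) hy (geta ε (fun z => ‖A z‖ₑ)) (geta_meas hε.1 _ hA)
      (fun w hw' => moll_wd hw hf.locallyIntegrable hε.1 w ((closedBall_subset_closedBall' (by
        rw [mem_closedBall] at hw'; linarith [hε.2])).trans hU))
    have h2 := pot_max l hl (closedBall x l) _ hA x M ε hε.1 hε.2.le hMx
    have h3 := pot_max l hl (closedBall x l) _ hA y M ε hε.1 hε.2.le hMy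
    have h4 : ENNReal.ofReal ((2 * l) ^ n) * ‖moll ε f x - moll ε f y‖ₑ ≤
        ENNReal.ofReal ((2 * l) ^ n) * (M * ENNReal.ofReal (4 ^ (n+1) * l)) := by
      refine h1.trans ((mul_le_mul_right (add_le_add h2 h3) _).trans (le_of_eq ?_))
      rw [← mul_add, ← ENNReal.ofReal_add (by positivity) (by positivity), mul_left_comm, mul_left_comm _ M,
        ← ENNReal.ofReal_mul (by positivity), ← ENNReal.ofReal_mul (by positivity)]
      congr 2
      rw [mul_pow, mul_pow, show (8:ℝ) = 2 * 4 by norm_num, mul_pow]; ring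
    exact (ENNReal.mul_le_mul_iff_right (by simp; positivity) ENNReal.ofReal_ne_top).1 h4
  have ht : Tendsto (fun ε => ‖moll ε f x - moll ε f y‖ₑ) (𝓝[>] 0) (𝓝 ‖f x - f y‖ₑ) :=
    (continuous_enorm.tendsto _).comp ((moll_tendsto f hf x).sub (moll_tendsto f hf y))
  exact le_of_tendsto ht hev

lemma wd_sub_linear {n : ℕ} {U : Set (Fin n → ℝ)}
    {f : (Fin n → ℝ) → (Fin n → ℝ)} {A : (Fin n → ℝ) → (Fin n → ℝ) →L[ℝ] (Fin n → ℝ)} (hw : WD U f A)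
    (hf : Continuous f) (hA : LocallyIntegrable A) (B : (Fin n → ℝ) →L[ℝ] (Fin n → ℝ)) :
    WD U (fun x => f x - B x) (fun x => A x - B) := by
  intro ψ h1 h2 h3 v
  have hψ := h1.continuous
  have hψ' : Continuous fun x => fderiv ℝ ψ x v := (h1.continuous_fderiv (by simp)).clm_apply continuous_const
  have hcs' : HasCompactSupport fun x => fderiv ℝ ψ x v := h2.fderiv_apply (𝕜 := ℝ) v
  have i1 : Integrable fun x => ψ x • A x v := by
    have : LocallyIntegrable fun x => A x v := by
      intro x
      obtain ⟨s, hs, hi⟩ := hA x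
      exact ⟨s, hs, hi.apply_continuousLinearMap v⟩
    exact this.integrable_smul_left_of_hasCompactSupport hψ h2
  have i2 : Integrable fun x => ψ x • B v :=
    (hψ.smul continuous_const).integrable_of_hasCompactSupport (h2.smul_right)
  have i3 : Integrable fun x => fderiv ℝ ψ x v • f x :=
    (hψ'.smul hf).integrable_of_hasCompactSupport hcs'.smul_right
  have i4 : Integrable fun x => fderiv ℝ ψ x v • B x :=
    (hψ'.smul B.continuous).integrable_of_hasCompactSupport hcs'.smul_right
  have hB : ∫ x, ψ x • B v = - ∫ x, fderiv ℝ ψ x v • B x := by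
    have := integral_smul_fderiv_eq_neg_fderiv_smul_of_integrable (μ := volume) (f := ψ) (g := B) (v := v)
      i4 (by simpa using i2) ((hψ.smul B.continuous).integrable_of_hasCompactSupport h2.smul_right)
      (fun x _ => h1.differentiable (by simp) x) (fun x _ => B.differentiableAt)
    simpa using this
  simp only [ContinuousLinearMap.sub_apply, smul_sub]
  rw [integral_sub i1 i2, integral_sub i3 i4, hw ψ h1 h2 h3 v, hB]
  abel

end

section

def UL {n : ℕ} (A : (Fin n → ℝ) → (Fin n → ℝ) →L[ℝ] (Fin n → ℝ)) (S : Set (Fin n → ℝ)) : Prop :=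
  ∀ δ : ℝ, 0 < δ → ∃ s0 > 0, ∀ x ∈ S, ∀ s, 0 < s → s ≤ s0 →
    ∫⁻ w in closedBall x s, ‖A w - A x‖ₑ ≤ ENNReal.ofReal (δ * s ^ n)

lemma ul_deriv {n : ℕ} {U S : Set (Fin n → ℝ)} (hU : IsOpen U) (hSU : S ⊆ U)
    {f : (Fin n → ℝ) → (Fin n → ℝ)} {A : (Fin n → ℝ) → (Fin n → ℝ) →L[ℝ] (Fin n → ℝ)} (hw : WD U f A)
    (hf : Continuous f) (hA : Measurable A) (hA' : LocallyIntegrable A) (hS : UL A S) :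
    ∀ x ∈ S, HasFDerivWithinAt f (A x) S x := by
  intro x hx
  obtain ⟨r, hr, hrU⟩ := Metric.isOpen_iff.1 hU x (hSU hx)
  rw [hasFDerivWithinAt_iff_isLittleO, Asymptotics.isLittleO_iff]
  intro c hc
  set C : ℝ := (1 + 2 ^ (n+1)) * 4 ^ (n+1) with hC
  have hC0 : 0 < C := by positivity
  obtain ⟨s0, hs0, hs⟩ := hS (c / C) (by positivity)
  set δ := c / C with hδ
  have hδ0 : 0 < δ := by positivity
  have hmem : ball x (min (s0 / 8) (r / 2)) ∈ 𝓝 x := ball_mem_nhds _ (by positivity)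
  filter_upwards [nhdsWithin_le_nhds hmem, self_mem_nhdsWithin] with y hy hyS
  rcases eq_or_ne y x with rfl | hne
  · simp
  have hl : 0 < dist y x := dist_pos.2 hne
  set l := dist y x with hl'
  have hl1 : l < s0 / 8 := (mem_ball.1 hy).trans_le (min_le_left _ _)
  have hl2 : l < r / 2 := (mem_ball.1 hy).trans_le (min_le_right _ _)
  have mA : ∀ z : Fin n → ℝ, Measurable fun w => ‖A w - A z‖ₑ := fun z => by fun_prop
  have hAyx : ‖A y - A x‖ₑ ≤ ENNReal.ofReal (2 * δ) := by
    have h1 : ∫⁻ w in closedBall x l, ‖A y - A x‖ₑ ≤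
        ENNReal.ofReal (δ * l ^ n) + ENNReal.ofReal (δ * (2 * l) ^ n) := by
      calc _ ≤ ∫⁻ w in closedBall x l, (‖A w - A x‖ₑ + ‖A w - A y‖ₑ) := by
            apply lintegral_mono; intro w
            have : A y - A x = (A w - A x) - (A w - A y) := by abel
            simp only [this]; exact enorm_sub_le
        _ = (∫⁻ w in closedBall x l, ‖A w - A x‖ₑ) + ∫⁻ w in closedBall x l, ‖A w - A y‖ₑ :=
            lintegral_add_left (mA x) _
        _ ≤ _ := by
            refine add_le_add (hs x hx l hl (by linarith)) ?_
            refine (lintegral_mono_set ?_).trans (hs y hyS (2 * l) (by linarith) (by linarith))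
            apply closedBall_subset_closedBall'; rw [dist_comm]; linarith
    rw [setLIntegral_const, vol_cb _ hl.le, ← ENNReal.ofReal_add (by positivity) (by positivity)] at h1
    have h2 : ‖A y - A x‖ₑ * ENNReal.ofReal ((2*l)^n) ≤ ENNReal.ofReal (2 * δ) * ENNReal.ofReal ((2*l)^n) := by
      refine h1.trans ?_
      rw [← ENNReal.ofReal_mul (by positivity)]
      apply ENNReal.ofReal_le_ofReal
      have : l ^ n ≤ (2 * l) ^ n := by gcongr; linarith
      nlinarith
    have hp : 0 < (2 * l) ^ n := by positivity
    exact (ENNReal.mul_le_mul_iff_left (by simpa using hp) (by simp)).1 h2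
  have hwd := wd_max (wd_sub_linear hw hf hA' (A x)) (by fun_prop) (by exact mA x) x y l hl (by simp [hl'])
    ((closedBall_subset_ball (by linarith)).trans hrU) (ENNReal.ofReal (δ * (1 + 2 ^ (n+1))))
    (by
      intro s h0 h1
      refine (hs x hx s h0 (by linarith)).trans ?_
      rw [← ENNReal.ofReal_mul (by positivity)]
      apply ENNReal.ofReal_le_ofReal
      have : 0 < s ^ n := by positivity
      have : (0:ℝ) < 2 ^ (n+1) := by positivity
      have : 0 < δ * s ^ n := by positivity
      nlinarith [mul_pos (mul_pos hδ0 (by assumption : (0:ℝ) < s^n)) (by assumption : (0:ℝ) < 2^(n+1))])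
    (by
      intro s h0 h1
      calc _ ≤ ∫⁻ w in closedBall y s, (‖A w - A y‖ₑ + ENNReal.ofReal (2 * δ)) := by
            apply lintegral_mono; intro w
            have : A w - A x = (A w - A y) + (A y - A x) := by abel
            simp only []; rw [this]; exact (enorm_add_le (A w - A y) (A y - A x)).trans (add_le_add le_rfl hAyx)
        _ = (∫⁻ w in closedBall y s, ‖A w - A y‖ₑ) + ENNReal.ofReal (2 * δ) * ENNReal.ofReal ((2*s)^n) := by
            rw [lintegral_add_left (mA y), setLIntegral_const, vol_cb _ h0.le]
        _ ≤ ENNReal.ofReal (δ * s ^ n) + ENNReal.ofReal (2 * δ) * ENNReal.ofReal ((2*s)^n) :=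
            add_le_add (hs y hyS s h0 (by linarith)) le_rfl
        _ = _ := by
            rw [← ENNReal.ofReal_mul (by positivity), ← ENNReal.ofReal_mul (by positivity),
              ← ENNReal.ofReal_add (by positivity) (by positivity)]
            congr 1; rw [mul_pow]; ring)
  rw [← ENNReal.ofReal_mul (by positivity), ← ofReal_norm, ENNReal.ofReal_le_ofReal_iff (by positivity)] at hwd
  have e : f y - f x - (A x) (y - x) = -(f x - (A x) x - (f y - (A x) y)) := by
    rw [map_sub]; abel
  rw [e, norm_neg]
  refine hwd.trans (le_of_eq ?_)
  rw [← dist_eq_norm, ← hl', hδ, hC]; field_simp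


lemma ul_exists {n : ℕ} {s : Set (Fin n → ℝ)} (hsm : MeasurableSet s) (hs : volume s ≠ ⊤)
    {A : (Fin n → ℝ) → (Fin n → ℝ) →L[ℝ] (Fin n → ℝ)}
    (hA : Measurable A) (hA' : Integrable A) (η : ℝ) (hη : 0 < η) :
    ∃ t ⊆ s, MeasurableSet t ∧ volume t ≤ ENNReal.ofReal η ∧ UL A (s \ t) := by
  set r : ℕ → ℝ := fun k => (1/2)^k with hr
  have hr0 : ∀ k, 0 < r k := fun k => by positivity
  have hfin : ∀ k x, ∫⁻ w in closedBall x (r k), ‖A w - A x‖ₑ < ⊤ := by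
    intro k x
    have : IntegrableOn (fun w => A w - A x) (closedBall x (r k)) :=
      hA'.integrableOn.sub (integrableOn_const (by rw [vol_cb _ (hr0 k).le]; simp))
    exact this.2
  set F : ℕ → (Fin n → ℝ) → ℝ := fun k x =>
    ((∫⁻ w in closedBall x (r k), ‖A w - A x‖ₑ) / volume (closedBall x (r k))).toReal with hF
  have hFm : ∀ k, StronglyMeasurable (F k) := by
    intro k
    apply Measurable.stronglyMeasurable
    apply Measurable.ennreal_toReal
    have e : ∀ x : Fin n → ℝ, volume (closedBall x (r k)) = ENNReal.ofReal ((2 * r k)^n) :=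
      fun x => vol_cb _ (hr0 k).le
    simp only [e]
    apply Measurable.div_const
    have : (fun x => ∫⁻ w in closedBall x (r k), ‖A w - A x‖ₑ) =
        fun x => ∫⁻ w, {p : (Fin n → ℝ) × (Fin n → ℝ) | dist p.2 p.1 ≤ r k}.indicator
          (fun p => ‖A p.2 - A p.1‖ₑ) (x, w) := by
      ext x
      rw [← lintegral_indicator measurableSet_closedBall]
      rfl
    rw [this]
    apply Measurable.lintegral_prod_right'
      (f := {p : (Fin n → ℝ) × (Fin n → ℝ) | dist p.2 p.1 ≤ r k}.indicator
          (fun p => ‖A p.2 - A p.1‖ₑ))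
    apply Measurable.indicator
    · fun_prop
    · exact measurableSet_le (by fun_prop) (by fun_prop)
  have hlim : ∀ᵐ x ∂volume, x ∈ s → Tendsto (fun k => F k x) atTop (𝓝 ((fun _ => (0:ℝ)) x)) := by
    filter_upwards [(Besicovitch.vitaliFamily (volume : Measure (Fin n → ℝ))).ae_tendsto_lintegral_enorm_sub_div
      hA'.locallyIntegrable] with x hx _
    have h1 := hx.comp (Besicovitch.tendsto_filterAt volume x)
    have h2 : Tendsto r atTop (𝓝[>] 0) := by
      rw [tendsto_nhdsWithin_iff]
      exact ⟨tendsto_pow_atTop_nhds_zero_of_lt_one (by norm_num) (by norm_num),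
        Eventually.of_forall fun k => hr0 k⟩
    have h3 := (ENNReal.tendsto_toReal (by simp)).comp (h1.comp h2)
    rw [ENNReal.toReal_zero] at h3
    exact h3
  obtain ⟨t, hts, htm, htη, hu⟩ := tendstoUniformlyOn_of_ae_tendsto hFm stronglyMeasurable_const hsm hs hlim hη
  refine ⟨t, hts, htm, htη, ?_⟩
  intro δ hδ
  rw [Metric.tendstoUniformlyOn_iff] at hu
  obtain ⟨k0, hk0⟩ := eventually_atTop.1 (hu (δ / 4 ^ n) (by positivity))
  refine ⟨r k0, hr0 k0, fun x hx s' h0 h1 => ?_⟩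
  obtain ⟨k, hk1, hk2⟩ : ∃ k, r (k+1) < s' ∧ s' ≤ r k :=
    exists_nat_pow_near_of_lt_one h0 (h1.trans (pow_le_one₀ (by norm_num) (by norm_num))) (by norm_num) (by norm_num)
  have hkk : k0 ≤ k := by
    by_contra hlt
    push Not at hlt
    have : r k0 ≤ r (k+1) := pow_le_pow_of_le_one (by norm_num) (by norm_num) hlt
    linarith
  have h3 := hk0 k hkk x hx
  simp only [hF, dist_zero_left, Real.norm_eq_abs, abs_of_nonneg ENNReal.toReal_nonneg] at h3
  have hv : volume (closedBall x (r k)) = ENNReal.ofReal ((2 * r k)^n) := vol_cb _ (hr0 k).le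
  have hvp : 0 < (2 * r k)^n := by have := hr0 k; positivity
  have h4 : (∫⁻ w in closedBall x (r k), ‖A w - A x‖ₑ) / volume (closedBall x (r k)) ≤ ENNReal.ofReal (δ / 4 ^ n) := by
    rw [ENNReal.le_ofReal_iff_toReal_le _ (by positivity)]
    · exact h3.le
    · exact ENNReal.div_ne_top (hfin k x).ne (by rw [hv]; simpa using hvp)
  rw [hv, ENNReal.div_le_iff (by simpa using hvp) (by simp), ← ENNReal.ofReal_mul (by positivity)] at h4
  refine (lintegral_mono_set (closedBall_subset_closedBall hk2)).trans (h4.trans ?_)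
  apply ENNReal.ofReal_le_ofReal
  have e : r (k+1) = r k / 2 := by simp only [hr, pow_succ]; ring
  have h5 : r k ≤ 2 * s' := by linarith
  calc δ / 4 ^ n * (2 * r k) ^ n ≤ δ / 4 ^ n * (4 * s') ^ n := by
        have := (hr0 k).le
        gcongr δ / 4 ^ n * ?_ ^ n; linarith
    _ = δ * s' ^ n := by rw [mul_pow]; field_simp

lemma disjoint_image_image_of {α β : Type*} {f : α → β} {U s t : Set α} (h : InjOn f U) (hs : s ⊆ U) (ht : t ⊆ U)
    (hd : Disjoint s t) : Disjoint (f '' s) (f '' t) := by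
  rw [Set.disjoint_left]
  rintro _ ⟨a, ha, rfl⟩ ⟨b, hb, e⟩
  rw [h (ht hb) (hs ha) e] at hb
  exact Set.disjoint_left.1 hd ha hb

theorem area_ineq {n : ℕ} {U : Set (Fin n → ℝ)} (hU : IsOpen U) (hUf : volume U ≠ ⊤)
    {f : (Fin n → ℝ) → (Fin n → ℝ)} {A : (Fin n → ℝ) → (Fin n → ℝ) →L[ℝ] (Fin n → ℝ)} (hw : WD U f A)
    (hf : Continuous f) (hA : Measurable A) (hA' : Integrable A) (hinj : InjOn f U)
    (Ψ : (Fin n → ℝ) → ℝ≥0∞) :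
    ∫⁻ x in U, ENNReal.ofReal |(A x).det| * Ψ (f x) ≤ ∫⁻ y, Ψ y := by
  choose t hts htm htη hUL using fun k : ℕ => ul_exists hU.measurableSet hUf hA hA' (1 / ((k:ℝ)+1)) (by positivity)
  set S : ℕ → Set (Fin n → ℝ) := fun k => U \ t k with hS
  have hSm : ∀ k, MeasurableSet (S k) := fun k => hU.measurableSet.diff (htm k)
  set T := disjointed S
  have hTm : ∀ k, MeasurableSet (T k) := fun k => MeasurableSet.disjointed hSm k
  have hTS : ∀ k, T k ⊆ S k := fun k => disjointed_subset S k
  have hTU : ∀ k, T k ⊆ U := fun k => (hTS k).trans sdiff_subset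
  have hae : (⋃ k, T k) =ᵐ[volume] U := by
    rw [iUnion_disjointed]
    have hsub : (⋃ k, S k) ⊆ U := iUnion_subset fun k => sdiff_subset
    refine Filter.EventuallyLE.antisymm (HasSubset.Subset.eventuallyLE hsub) ?_
    rw [ae_le_set]
    have hb : ∀ k : ℕ, volume (U \ ⋃ k, S k) ≤ ENNReal.ofReal (1 / ((k:ℝ)+1)) := by
      intro k
      refine (measure_mono ?_).trans (htη k)
      intro x hx
      by_contra hxt
      exact hx.2 (mem_iUnion.2 ⟨k, hx.1, hxt⟩)
    have hlim : Tendsto (fun k : ℕ => ENNReal.ofReal (1 / ((k:ℝ)+1))) atTop (𝓝 0) := by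
      have := (ENNReal.continuous_ofReal.tendsto 0).comp (tendsto_one_div_add_atTop_nhds_zero_nat (𝕜 := ℝ))
      rw [ENNReal.ofReal_zero] at this; exact this
    exact le_antisymm (ge_of_tendsto' hlim hb) zero_le
  rw [← setLIntegral_congr hae, lintegral_iUnion hTm (disjoint_disjointed S)]
  have hstep : ∀ k, ∫⁻ x in T k, ENNReal.ofReal |(A x).det| * Ψ (f x) = ∫⁻ y in f '' T k, Ψ y := by
    intro k
    rw [lintegral_image_eq_lintegral_abs_det_fderiv_mul volume (hTm k) (f' := A)
      (fun x hx => (ul_deriv hU sdiff_subset hw hf hA hA'.locallyIntegrable (hUL k) x (hTS k hx)).mono (hTS k))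
      (hinj.mono (hTU k))]
  simp only [hstep]
  rw [← lintegral_iUnion]
  · exact lintegral_mono' Measure.restrict_le_self le_rfl
  · intro k
    exact (hTm k).image_of_continuousOn_injOn hf.continuousOn (hinj.mono (hTU k))
  · intro i j hij
    exact disjoint_image_image_of hinj (hTU i) (hTU j) (disjoint_disjointed S hij)

end

section

def ins {m : ℕ} (j : Fin (m+1)) (σ : ℝ) (w : Fin m → ℝ) : Fin (m+1) → ℝ := j.insertNth (α := fun _ => ℝ) σ w
def prj {m : ℕ} (j : Fin (m+1)) (x : Fin (m+1) → ℝ) : Fin m → ℝ := fun i => x (j.succAbove i)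

@[simp] lemma ins_same {m : ℕ} (j : Fin (m+1)) (σ : ℝ) (w : Fin m → ℝ) : ins j σ w j = σ := by simp [ins]
@[simp] lemma ins_succ {m : ℕ} (j : Fin (m+1)) (σ : ℝ) (w : Fin m → ℝ) (i) : ins j σ w (j.succAbove i) = w i := by
  simp [ins]
lemma ins_eta {m : ℕ} (j : Fin (m+1)) (x : Fin (m+1) → ℝ) : ins j (x j) (prj j x) = x := by
  ext i; rcases Fin.eq_self_or_eq_succAbove j i with rfl | ⟨i, rfl⟩ <;> simp [prj]
lemma ins_cont {m : ℕ} (j : Fin (m+1)) : Continuous fun p : ℝ × (Fin m → ℝ) => ins j p.1 p.2 := by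
  apply continuous_pi; intro i
  rcases Fin.eq_self_or_eq_succAbove j i with rfl | ⟨i, rfl⟩ <;> simp <;> fun_prop
lemma ins_sub {m : ℕ} (j : Fin (m+1)) (σ : ℝ) (w : Fin m → ℝ) (z : Fin (m+1) → ℝ) :
    ins j σ w - z = ins j (σ - z j) (w - prj j z) := by
  ext i; rcases Fin.eq_self_or_eq_succAbove j i with rfl | ⟨i, rfl⟩ <;> simp [prj]
lemma ins_cb {m : ℕ} (j : Fin (m+1)) (σ : ℝ) (w : Fin m → ℝ) (x : Fin (m+1) → ℝ) (l : ℝ) (hl : 0 ≤ l) :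
    ins j σ w ∈ closedBall x l ↔ σ ∈ closedBall (x j) l ∧ w ∈ closedBall (prj j x) l := by
  simp only [mem_closedBall, dist_pi_le_iff hl]
  constructor
  · intro h; refine ⟨by simpa using h j, fun i => by simpa [prj] using h (j.succAbove i)⟩
  · rintro ⟨h1, h2⟩ i
    rcases Fin.eq_self_or_eq_succAbove j i with rfl | ⟨i, rfl⟩
    · simpa using h1
    · simpa [prj] using h2 i

def insL {m : ℕ} (j : Fin (m+1)) : (Fin m → ℝ) →L[ℝ] (Fin (m+1) → ℝ) :=
  LinearMap.toContinuousLinearMap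
    { toFun := fun w => ins j 0 w
      map_add' := by
        intro a b; ext i
        rcases Fin.eq_self_or_eq_succAbove j i with rfl | ⟨i, rfl⟩ <;> simp
      map_smul' := by
        intro a b; ext i
        rcases Fin.eq_self_or_eq_succAbove j i with rfl | ⟨i, rfl⟩ <;> simp }

lemma ins_fderiv {m : ℕ} (j : Fin (m+1)) (σ : ℝ) (w : Fin m → ℝ) : HasFDerivAt (fun w => ins j σ w) (insL j) w := by
  have : (fun w => ins j σ w) = fun w => insL j w + ins j σ 0 := by
    ext w i
    show _ = ins j 0 w i + ins j σ 0 i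
    rcases Fin.eq_self_or_eq_succAbove j i with rfl | ⟨i, rfl⟩ <;> simp
  rw [this]
  exact (insL j).hasFDerivAt.add_const _

lemma insL_norm {m : ℕ} (j : Fin (m+1)) : ‖insL j‖ ≤ 1 := by
  apply ContinuousLinearMap.opNorm_le_bound _ zero_le_one
  intro w
  rw [one_mul, pi_norm_le_iff_of_nonneg (norm_nonneg _)]
  intro i
  show ‖ins j 0 w i‖ ≤ _
  rcases Fin.eq_self_or_eq_succAbove j i with rfl | ⟨i, rfl⟩
  · simp
  · simp only [ins_succ]; exact norm_le_pi_norm w i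

lemma ins_contDiff {m : ℕ} (j : Fin (m+1)) (σ : ℝ) : ContDiff ℝ 1 fun w => ins j σ w := by
  have : (fun w => ins j σ w) = fun w => insL j w + ins j σ 0 := by
    ext w i
    show _ = ins j 0 w i + ins j σ 0 i
    rcases Fin.eq_self_or_eq_succAbove j i with rfl | ⟨i, rfl⟩ <;> simp
  rw [this]; fun_prop

lemma fub {m : ℕ} (j : Fin (m+1)) (G : (Fin (m+1) → ℝ) → ℝ≥0∞) (hG : Measurable G) :
    ∫⁻ σ, ∫⁻ w, G (ins j σ w) = ∫⁻ W, G W := by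
  have h := (volume_preserving_piFinSuccAbove (fun _ : Fin (m+1) => ℝ) j).symm
  rw [← h.lintegral_comp hG, Measure.volume_eq_prod, lintegral_prod]
  · rfl
  · exact (hG.comp (MeasurableEquiv.measurable _)).aemeasurable

lemma fub_cb {m : ℕ} (j : Fin (m+1)) (G : (Fin (m+1) → ℝ) → ℝ≥0∞) (hG : Measurable G) (x : Fin (m+1) → ℝ)
    (l : ℝ) (hl : 0 ≤ l) :
    ∫⁻ σ in closedBall (x j) l, ∫⁻ w in closedBall (prj j x) l, G (ins j σ w) = ∫⁻ W in closedBall x l, G W := by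
  rw [← lintegral_indicator measurableSet_closedBall (f := G), ← fub j _ (hG.indicator measurableSet_closedBall),
    ← lintegral_indicator measurableSet_closedBall]
  congr 1; ext σ
  by_cases h : σ ∈ closedBall (x j) l
  · rw [indicator_of_mem h, ← lintegral_indicator measurableSet_closedBall]
    congr 1; ext w
    by_cases hw : w ∈ closedBall (prj j x) l
    · rw [indicator_of_mem hw, indicator_of_mem ((ins_cb j σ w x l hl).2 ⟨h, hw⟩)]
    · rw [indicator_of_notMem hw, indicator_of_notMem (fun h' => hw ((ins_cb j σ w x l hl).1 h').2)]
  · rw [indicator_of_notMem h]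
    symm
    rw [lintegral_eq_zero_iff' ]
    · filter_upwards with w
      rw [indicator_of_notMem (fun h' => h ((ins_cb j σ w x l hl).1 h').1)]; rfl
    · exact ((hG.indicator measurableSet_closedBall).comp ((ins_cont j).comp (by fun_prop : Continuous fun w => (σ, w))).measurable).aemeasurable

/-- Jensen for powers -/
lemma jensen_pow {α : Type*} [MeasurableSpace α] (μ : Measure α) (k g : α → ℝ≥0∞) (hk : Measurable k)
    (hg : Measurable g) (h1 : ∫⁻ z, k z ∂μ = 1) (q : ℝ) (hq : 1 < q) :
    (∫⁻ z, k z * g z ∂μ) ^ q ≤ ∫⁻ z, k z * g z ^ q ∂μ := by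
  have hpq : q.HolderConjugate (Real.conjExponent q) := Real.HolderConjugate.conjExponent hq
  have h := ENNReal.lintegral_mul_le_Lp_mul_Lq (μ.withDensity k) hpq (f := g) (g := fun _ => 1) hg.aemeasurable
    aemeasurable_const
  have e1 : ∀ F : α → ℝ≥0∞, Measurable F → ∫⁻ z, F z ∂(μ.withDensity k) = ∫⁻ z, k z * F z ∂μ := fun F hF => by
    rw [lintegral_withDensity_eq_lintegral_mul _ hk hF]; rfl
  simp only [Pi.mul_apply, mul_one, ENNReal.one_rpow] at h
  rw [e1 _ hg, e1 _ (hg.pow_const q), e1 _ measurable_const] at h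
  simp only [mul_one, h1, ENNReal.one_rpow] at h
  calc _ ≤ ((∫⁻ z, k z * g z ^ q ∂μ) ^ (1/q)) ^ q := ENNReal.rpow_le_rpow h (by linarith)
    _ = _ := by rw [← ENNReal.rpow_mul, one_div_mul_cancel (by linarith), ENNReal.rpow_one]


lemma pot_tonelli {m n : ℕ} (l : ℝ) (S : Set (Fin m → ℝ)) (hS : MeasurableSet S) (k : (Fin n → ℝ) → ℝ≥0∞)
    (hk : Measurable k) (hk' : ∀ x, k x ≠ ⊤)
    (g : (Fin m → ℝ) → (Fin n → ℝ) → ℝ≥0∞) (hg : Measurable (Function.uncurry g)) (z : Fin m → ℝ) :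
    Pot l S (fun w => ∫⁻ ζ, k ζ * g w ζ) z = ∫⁻ ζ, k ζ * Pot l S (fun w => g w ζ) z := by
  unfold Pot
  have h1 : ∀ t : ℝ, ∫⁻ w in S ∩ closedBall z (2 * l * t), ∫⁻ ζ, k ζ * g w ζ =
      ∫⁻ ζ, k ζ * ∫⁻ w in S ∩ closedBall z (2 * l * t), g w ζ := by
    intro t
    rw [lintegral_lintegral_swap]
    · congr 1; ext ζ
      rw [lintegral_const_mul' _ _ (hk' ζ)]
    · exact ((hk.comp measurable_snd).mul hg).aemeasurable
  simp only [h1]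
  have h2 : ∀ t : ℝ, ENNReal.ofReal ((t ^ m)⁻¹) * ∫⁻ ζ, k ζ * ∫⁻ w in S ∩ closedBall z (2 * l * t), g w ζ =
     ∫⁻ ζ, k ζ * (ENNReal.ofReal ((t ^ m)⁻¹) * ∫⁻ w in S ∩ closedBall z (2 * l * t), g w ζ) := by
    intro t
    rw [← lintegral_const_mul' _ _ (by simp)]
    congr 1; ext ζ; ring
  simp only [h2]
  rw [lintegral_lintegral_swap]
  · congr 1; ext ζ
    rw [lintegral_const_mul' _ _ (hk' ζ)]
  · apply Measurable.aemeasurable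
    apply (hk.comp measurable_snd).mul
    apply Measurable.mul (by fun_prop)
    have : (fun p : ℝ × (Fin n → ℝ) => ∫⁻ w in S ∩ closedBall z (2 * l * p.1), g w p.2) = fun p => ∫⁻ w,
        {q : (ℝ × (Fin n → ℝ)) × (Fin m → ℝ) | q.2 ∈ S ∧ dist q.2 z ≤ 2 * l * q.1.1}.indicator
          (fun q => g q.2 q.1.2) (p, w) := by
      ext p
      rw [← lintegral_indicator (hS.inter measurableSet_closedBall)]
      rfl
    rw [this]
    apply Measurable.lintegral_prod_right' (f := {q : (ℝ × (Fin n → ℝ)) × (Fin m → ℝ) | q.2 ∈ S ∧ dist q.2 z ≤ 2 * l * q.1.1}.indicator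
          (fun q => g q.2 q.1.2))
    apply Measurable.indicator
    · exact hg.comp (by fun_prop : Measurable fun q : (ℝ × (Fin n → ℝ)) × (Fin m → ℝ) => (q.2, q.1.2))
    · exact (hS.preimage measurable_snd).inter (measurableSet_le (f := fun q : (ℝ × (Fin n → ℝ)) × (Fin m → ℝ) => dist q.2 z)
        (g := fun q => 2 * l * q.1.1) (by fun_prop) (by fun_prop))

/-- truncated `φ(a)` -/
def ha (φ : ℝ → ℝ) {n : ℕ} (a : (Fin n → ℝ) → ℝ) (T : ℝ) (W : Fin n → ℝ) : ℝ≥0∞ :=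
  {w | T < a w}.indicator (fun w => ENNReal.ofReal (φ (a w))) W

lemma ha_meas {φ : ℝ → ℝ} (hφ : Monotone φ) {n : ℕ} {a : (Fin n → ℝ) → ℝ} (hm : Measurable a) (T : ℝ) :
    Measurable (ha φ a T) :=
  ((hφ.measurable.comp hm).ennreal_ofReal).indicator (measurableSet_lt measurable_const hm)

lemma slice_osc {m : ℕ} (hm : 2 ≤ m) {U : Set (Fin (m+1) → ℝ)}
    {f : (Fin (m+1) → ℝ) → (Fin (m+1) → ℝ)} {A : (Fin (m+1) → ℝ) → (Fin (m+1) → ℝ) →L[ℝ] (Fin (m+1) → ℝ)}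
    (hw : WD U f A) (hf : Continuous f) {a : (Fin (m+1) → ℝ) → ℝ} (ham : Measurable a)
    (hAa : ∀ x, ‖A x‖ ≤ (m+1) * a x) {φ : ℝ → ℝ} (hmono : Monotone φ) (hpos : ∀ t, 0 < t → 0 < φ t)
    (x : Fin (m+1) → ℝ) (l : ℝ) (hl : 0 < l) (hU : closedBall x (2*l) ⊆ U) (T : ℝ) (hT : 0 < T)
    (ε : ℝ) (hε : 0 < ε) (hεl : ε ≤ l) (j : Fin (m+1)) (σ : ℝ) (hσ : σ ∈ closedBall (x j) l)
    (z z' : Fin m → ℝ) (hz : z ∈ closedBall (prj j x) l) (hz' : z' ∈ closedBall (prj j x) l) :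
    ‖moll ε f (ins j σ z) - moll ε f (ins j σ z')‖ₑ ≤ ENNReal.ofReal ((m+1) * 4 * 2 ^ m) *
      ∫⁻ ζ, ENNReal.ofReal (eta (m+1) ε ζ) * (ENNReal.ofReal (l * T) + Dl m φ T ^ (((m:ℝ) - 1) / m) *
        (∫⁻ w in closedBall (prj j x) l, ha φ a T (ins j σ w - ζ)) ^ (1 / (m:ℝ))) := by
  set c := prj j x with hc
  set k : (Fin (m+1) → ℝ) → ℝ≥0∞ := fun ζ => ENNReal.ofReal (eta (m+1) ε ζ) with hk
  have hkm : Measurable k := (eta_cont (n := m+1) hε).measurable.ennreal_ofReal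
  set g : (Fin m → ℝ) → (Fin (m+1) → ℝ) → ℝ≥0∞ := fun w ζ => ENNReal.ofReal (a (ins j σ w - ζ)) with hg
  have hinsm : Measurable fun w : Fin m → ℝ => ins j σ w := (ins_contDiff j σ).continuous.measurable
  have hgm : Measurable (Function.uncurry g) := by
    apply Measurable.ennreal_ofReal
    apply ham.comp
    exact (hinsm.comp measurable_fst).sub measurable_snd
  have hmf := moll_contDiff hε f hf.locallyIntegrable
  have hmf1 : ContDiff ℝ 1 (moll ε f) := hmf.of_le (by exact_mod_cast le_top)
  set r : ℝ≥0∞ := ENNReal.ofReal (m+1) with hr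
  have hgr : ∀ w ∈ closedBall c l, ‖fderiv ℝ (fun w => moll ε f (ins j σ w)) w‖ₑ ≤ r * ∫⁻ ζ, k ζ * g w ζ := by
    intro w hw'
    have hW : ins j σ w ∈ closedBall x l := (ins_cb j σ w x l hl.le).2 ⟨hσ, hw'⟩
    have e1 : HasFDerivAt (fun w => moll ε f (ins j σ w)) ((fderiv ℝ (moll ε f) (ins j σ w)).comp (insL j)) w :=
      ((hmf1.differentiable (by simp)) _).hasFDerivAt.comp w (ins_fderiv j σ w)
    rw [e1.fderiv]
    have e2 : ‖(fderiv ℝ (moll ε f) (ins j σ w)).comp (insL j)‖ₑ ≤ ‖fderiv ℝ (moll ε f) (ins j σ w)‖ₑ := by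
      rw [enorm_le_iff_norm_le]
      refine (ContinuousLinearMap.opNorm_comp_le _ _).trans ?_
      exact mul_le_of_le_one_right (norm_nonneg _) (insL_norm j)
    refine e2.trans ((moll_wd hw hf.locallyIntegrable hε _ ?_).trans ?_)
    · refine (closedBall_subset_closedBall' ?_).trans hU
      have := mem_closedBall.1 hW; linarith
    · rw [← lintegral_const_mul' _ _ (by simp [hr])]
      rw [← lintegral_sub_left_eq_self (fun ζ => r * (k ζ * g w ζ)) (ins j σ w)]
      refine lintegral_mono fun ζ => ?_
      simp only [hk, hg, hr]
      rw [mul_left_comm]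
      refine mul_le_mul_right ?_ _
      rw [← ofReal_norm, ← ENNReal.ofReal_mul (by positivity)]
      apply ENNReal.ofReal_le_ofReal
      simpa using hAa ζ
  have hJm : Measurable fun w => ∫⁻ ζ, k ζ * g w ζ :=
    Measurable.lintegral_prod_right' (f := fun p : (Fin m → ℝ) × (Fin (m+1) → ℝ) => k p.2 * g p.1 p.2)
      ((hkm.comp measurable_snd).mul hgm)
  have h1 := osc_le_pot (fun w => moll ε f (ins j σ w)) (hmf1.comp (ins_contDiff j σ)) c z z' l hl hz hz'
    (fun w => r * ∫⁻ ζ, k ζ * g w ζ) (hJm.const_mul _) hgr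
  set B : ℝ≥0∞ := ∫⁻ ζ, k ζ * (ENNReal.ofReal (l * T) + Dl m φ T ^ (((m:ℝ) - 1) / m) *
        (∫⁻ w in closedBall c l, ha φ a T (ins j σ w - ζ)) ^ (1 / (m:ℝ))) with hB
  have hpot : ∀ z, Pot l (closedBall c l) (fun w => r * ∫⁻ ζ, k ζ * g w ζ) z ≤
      r * (ENNReal.ofReal ((4 * l) ^ (m-1) * 4) * B) := by
    intro z
    rw [pot_const_mul _ _ _ _ (by simp [hr]), pot_tonelli _ _ measurableSet_closedBall k hkm (by simp [hk]) g hgm]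
    refine mul_le_mul_right ?_ _
    rw [← lintegral_const_mul' _ _ (by simp)]
    refine lintegral_mono fun ζ => ?_
    simp only []
    rw [mul_left_comm]
    refine mul_le_mul_right ?_ _
    exact pot_orlicz hm φ hmono hpos l hl c z (fun w => a (ins j σ w - ζ))
      (ham.comp (hinsm.sub_const ζ)) T hT
  have h2 : ENNReal.ofReal ((2 * l) ^ m) * ‖moll ε f (ins j σ z) - moll ε f (ins j σ z')‖ₑ ≤
     ENNReal.ofReal ((2 * l) ^ m) * (ENNReal.ofReal ((m+1) * 4 * 2 ^ m) * B) := by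
    refine h1.trans ((mul_le_mul_right (add_le_add (hpot z) (hpot z')) _).trans (le_of_eq ?_))
    rw [← two_mul, hr, show (2:ℝ≥0∞) = ENNReal.ofReal 2 by simp]
    simp only [← mul_assoc]
    rw [← ENNReal.ofReal_mul (by positivity), ← ENNReal.ofReal_mul (by positivity),
       ← ENNReal.ofReal_mul (by positivity), ← ENNReal.ofReal_mul (by positivity)]
    congr 2
    obtain ⟨m', rfl⟩ : ∃ m', m = m' + 1 := ⟨m - 1, by omega⟩
    simp only [Nat.add_sub_cancel]
    have : (4:ℝ) = 2 * 2 := by norm_num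
    rw [this]; simp only [mul_pow, pow_succ]; ring
  have hp : 0 < (2 * l) ^ m := by positivity
  exact (ENNReal.mul_le_mul_iff_right (by simpa using hp) (by simp)).1 h2

end

section

lemma add_pow_le2 (a b : ℝ≥0∞) (m : ℕ) : (a + b) ^ m ≤ 2 ^ m * (a ^ m + b ^ m) := by
  rcases le_total a b with h | h
  · calc (a+b)^m ≤ (2 * b)^m := by gcongr; rw [two_mul]; gcongr
      _ = 2^m * b^m := mul_pow _ _ _
      _ ≤ _ := by gcongr; exact le_add_self
  · calc (a+b)^m ≤ (2 * a)^m := by gcongr; rw [two_mul]; gcongr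
      _ = 2^m * a^m := mul_pow _ _ _
      _ ≤ _ := by gcongr; exact le_self_add

def K1 (m : ℕ) : ℝ≥0∞ := ENNReal.ofReal ((m+1) * 4 * 2 ^ m)
def C5 (m : ℕ) : ℝ≥0∞ := 2 ^ m * (K1 m ^ m * (2 ^ m * 2))

def Osc {n : ℕ} (f : (Fin n → ℝ) → (Fin n → ℝ)) (x : Fin n → ℝ) (l : ℝ) (j : Fin n) (σ : ℝ) : ℝ≥0∞ :=
  ediam (f '' (closedBall x l ∩ {z | z j = σ}))

lemma slice_int {m : ℕ} (hm : 2 ≤ m) {U : Set (Fin (m+1) → ℝ)}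
    {f : (Fin (m+1) → ℝ) → (Fin (m+1) → ℝ)} {A : (Fin (m+1) → ℝ) → (Fin (m+1) → ℝ) →L[ℝ] (Fin (m+1) → ℝ)}
    (hw : WD U f A) (hf : UniformContinuous f) {a : (Fin (m+1) → ℝ) → ℝ} (ham : Measurable a)
    (hAa : ∀ x, ‖A x‖ ≤ (m+1) * a x) {φ : ℝ → ℝ} (hmono : Monotone φ) (hpos : ∀ t, 0 < t → 0 < φ t)
    (x : Fin (m+1) → ℝ) (l : ℝ) (hl : 0 < l) (hU : closedBall x (2*l) ⊆ U) (T : ℝ) (hT : 0 < T)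
    (j : Fin (m+1)) :
    ∫⁻ σ, Osc f x l j σ ^ m ≤ C5 m * (ENNReal.ofReal (l ^ (m+1) * T ^ m) +
      Dl m φ T ^ (m-1) * ∫⁻ W in closedBall x (2*l), ha φ a T W) := by
  set X := C5 m * (ENNReal.ofReal (l ^ (m+1) * T ^ m) +
      Dl m φ T ^ (m-1) * ∫⁻ W in closedBall x (2*l), ha φ a T W) with hX
  have hm0 : (0:ℝ) < m := by exact_mod_cast (by omega : 0 < m)
  have hm1 : (1:ℝ) < m := by exact_mod_cast (by omega : 1 < m)
  have key : ∀ δ > 0, ∫⁻ σ, Osc f x l j σ ^ m ≤ X + 2 ^ m * ENNReal.ofReal (2 * δ) ^ m * ENNReal.ofReal (2 * l) := by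
    intro δ hδ
    obtain ⟨ε0, hε0, hε0'⟩ := Metric.uniformContinuous_iff.1 hf δ hδ
    set ε := min ε0 l with hεd
    have hε : 0 < ε := lt_min hε0 hl
    have hεl : ε ≤ l := min_le_right _ _
    have hcl : ∀ y, dist (moll ε f y) (f y) ≤ δ := fun y =>
      moll_close hε f hf.continuous.aestronglyMeasurable y δ fun z hz =>
        (hε0' ((mem_ball.1 hz).trans_le (min_le_left _ _))).le
    set k : (Fin (m+1) → ℝ) → ℝ≥0∞ := fun ζ => ENNReal.ofReal (eta (m+1) ε ζ) with hk
    have hkm : Measurable k := (eta_cont (n := m+1) hε).measurable.ennreal_ofReal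
    have hk1 : ∫⁻ ζ, k ζ = 1 := eta_lintegral hε
    set H : ℝ → (Fin (m+1) → ℝ) → ℝ≥0∞ := fun σ ζ => ∫⁻ w in closedBall (prj j x) l, ha φ a T (ins j σ w - ζ) with hH
    have hham := ha_meas (φ := φ) hmono ham T
    have hHm : Measurable (Function.uncurry H) := by
      refine Measurable.lintegral_prod_right' (f := fun p : (ℝ × (Fin (m+1) → ℝ)) × (Fin m → ℝ) =>
        ha φ a T (ins j p.1.1 p.2 - p.1.2)) ?_
      apply hham.comp
      refine Measurable.sub ?_ (by fun_prop)
      exact (ins_cont j).measurable.comp (by fun_prop : Measurable fun p : (ℝ × (Fin (m+1) → ℝ)) × (Fin m → ℝ) => (p.1.1, p.2))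
    set J : ℝ → ℝ≥0∞ := fun σ => ∫⁻ ζ, k ζ * (ENNReal.ofReal (l*T) ^ m + Dl m φ T ^ (m-1) * H σ ζ) with hJ
    have hJm : Measurable J := by
      refine Measurable.lintegral_prod_right' (f := fun p : ℝ × (Fin (m+1) → ℝ) => k p.2 * (ENNReal.ofReal (l*T) ^ m + Dl m φ T ^ (m-1) * H p.1 p.2)) ?_
      exact (hkm.comp measurable_snd).mul ((hHm.const_mul _).const_add _)
    have hpt : ∀ σ, Osc f x l j σ ^ m ≤ (closedBall (x j) l).indicator (fun σ => 2 ^ m * (K1 m ^ m * (2 ^ m * J σ) +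
        ENNReal.ofReal (2 * δ) ^ m)) σ := by
      intro σ
      by_cases hσ : σ ∈ closedBall (x j) l
      swap
      · have : closedBall x l ∩ {z | z j = σ} = ∅ := by
          ext z
          simp only [mem_inter_iff, mem_ofPred_eq, mem_empty_iff_false, iff_false, not_and]
          rintro hz rfl
          apply hσ
          rw [← ins_eta j z, ins_cb _ _ _ _ _ hl.le] at hz
          exact hz.1
        rw [Osc, this, image_empty, Metric.ediam_empty, zero_pow (by omega)]; exact zero_le
      rw [indicator_of_mem hσ]
      set B : ℝ≥0∞ := ∫⁻ ζ, k ζ * (ENNReal.ofReal (l * T) + Dl m φ T ^ (((m:ℝ) - 1) / m) *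
        (H σ ζ) ^ (1 / (m:ℝ))) with hB
      have ho : Osc f x l j σ ≤ K1 m * B + ENNReal.ofReal (2 * δ) := by
        apply Metric.ediam_le
        rintro _ ⟨z, ⟨hz1, hz2⟩, rfl⟩ _ ⟨z', ⟨hz1', hz2'⟩, rfl⟩
        simp only [mem_ofPred_eq] at hz2 hz2'
        have e1 : z = ins j σ (prj j z) := by rw [← hz2, ins_eta]
        have e2 : z' = ins j σ (prj j z') := by rw [← hz2', ins_eta]
        rw [e1, ins_cb _ _ _ _ _ hl.le] at hz1
        rw [e2, ins_cb _ _ _ _ _ hl.le] at hz1'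
        have h3 := slice_osc hm hw hf.continuous ham hAa hmono hpos x l hl hU T hT ε hε hεl j σ hσ _ _ hz1.2 hz1'.2
        rw [← e1, ← e2, ← edist_eq_enorm_sub] at h3
        have h4 : ∀ y, edist (moll ε f y) (f y) ≤ ENNReal.ofReal δ := fun y => by
          rw [edist_dist]; exact ENNReal.ofReal_le_ofReal (hcl y)
        calc edist (f z) (f z') ≤ edist (f z) (moll ε f z) + edist (moll ε f z) (moll ε f z') + edist (moll ε f z') (f z') :=
              edist_triangle4 _ _ _ _
          _ ≤ ENNReal.ofReal δ + K1 m * B + ENNReal.ofReal δ := by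
              refine add_le_add (add_le_add ?_ h3) (h4 _)
              rw [edist_comm]; exact h4 z
          _ = _ := by
            rw [two_mul, ENNReal.ofReal_add hδ.le hδ.le]; ring
      calc Osc f x l j σ ^ m ≤ (K1 m * B + ENNReal.ofReal (2 * δ)) ^ m := pow_le_pow_left' ho m
        _ ≤ 2 ^ m * ((K1 m * B) ^ m + ENNReal.ofReal (2 * δ) ^ m) := add_pow_le2 _ _ _
        _ ≤ _ := by
          refine mul_le_mul_right (add_le_add ?_ le_rfl) _
          rw [mul_pow]
          refine mul_le_mul_right ?_ _
          have hj := jensen_pow volume k (fun ζ => ENNReal.ofReal (l * T) + Dl m φ T ^ (((m:ℝ) - 1) / m) *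
            (H σ ζ) ^ (1 / (m:ℝ))) hkm (by
              have : Measurable (H σ) := hHm.comp measurable_prodMk_left
              fun_prop) hk1 m hm1
          simp only [ENNReal.rpow_natCast] at hj
          refine hj.trans ?_
          rw [hJ, ← lintegral_const_mul' _ _ (by simp)]
          refine lintegral_mono fun ζ => ?_
          simp only []
          rw [mul_left_comm]
          refine mul_le_mul_right ((add_pow_le2 _ _ _).trans (le_of_eq ?_)) _
          congr 2
          rw [mul_pow, ← ENNReal.rpow_natCast, ← ENNReal.rpow_natCast (H σ ζ ^ _), ← ENNReal.rpow_mul, ← ENNReal.rpow_mul,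
            one_div_mul_cancel hm0.ne', ENNReal.rpow_one, div_mul_cancel₀ _ hm0.ne', ← ENNReal.rpow_natCast,
            Nat.cast_sub (by omega)]
          simp
    have hJint : ∫⁻ σ in closedBall (x j) l, J σ ≤ 2 * (ENNReal.ofReal (l ^ (m+1) * T ^ m) +
        Dl m φ T ^ (m-1) * ∫⁻ W in closedBall x (2*l), ha φ a T W) := by
      rw [hJ, lintegral_lintegral_swap]
      swap
      · exact ((hkm.comp measurable_snd).mul ((hHm.const_mul _).const_add _)).aemeasurable
      rw [← mul_one (2 * _), ← hk1, ← lintegral_const_mul _ hkm]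
      refine lintegral_mono fun ζ => ?_
      simp only []
      have hHζ : Measurable fun σ => H σ ζ := hHm.comp (measurable_prodMk_right (y := ζ))
      rw [lintegral_const_mul' _ _ (by simp [hk]), mul_comm]
      by_cases hζ : ε ≤ ‖ζ‖
      · simp [hk, eta_zero hε ζ hζ]
      push Not at hζ
      refine mul_le_mul_left ?_ _
      rw [lintegral_add_left measurable_const, setLIntegral_const, lintegral_const_mul _ hHζ, mul_add]
      refine add_le_add (le_of_eq ?_) ?_
      · rw [Real.volume_closedBall, ← ENNReal.ofReal_pow (by positivity), ← ENNReal.ofReal_mul (by positivity),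
          show (2:ℝ≥0∞) = ENNReal.ofReal 2 by simp, ← ENNReal.ofReal_mul (by positivity)]
        congr 1; rw [mul_pow, pow_succ]; ring
      · rw [mul_left_comm]
        refine mul_le_mul_right ?_ _
        refine le_trans ?_ (le_mul_of_one_le_left zero_le one_le_two)
        rw [hH, fub_cb j (fun W => ha φ a T (W - ζ)) (hham.comp (measurable_id.sub_const ζ)) x l hl.le]
        rw [← lintegral_indicator measurableSet_closedBall, ← lintegral_indicator measurableSet_closedBall,
          ← lintegral_sub_right_eq_self (fun W => (closedBall x (2*l)).indicator (ha φ a T) W) ζ]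
        refine lintegral_mono fun W => ?_
        by_cases hW : W ∈ closedBall x l
        · rw [indicator_of_mem hW, indicator_of_mem]
          rw [mem_closedBall_iff_norm] at hW ⊢
          calc ‖W - ζ - x‖ = ‖(W - x) - ζ‖ := by congr 1; abel
            _ ≤ _ := (norm_sub_le _ _).trans (by linarith)
        · rw [indicator_of_notMem hW]; exact zero_le
    calc ∫⁻ σ, Osc f x l j σ ^ m ≤ ∫⁻ σ in closedBall (x j) l, 2 ^ m * (K1 m ^ m * (2 ^ m * J σ) +
        ENNReal.ofReal (2 * δ) ^ m) := by
          rw [← lintegral_indicator measurableSet_closedBall]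
          exact lintegral_mono hpt
      _ = 2 ^ m * (K1 m ^ m * (2 ^ m * ∫⁻ σ in closedBall (x j) l, J σ) + ENNReal.ofReal (2 * δ) ^ m * ENNReal.ofReal (2 * l)) := by
          rw [lintegral_const_mul' _ _ (by simp), lintegral_add_right _ measurable_const,
            lintegral_const_mul' _ _ (by simp [K1]), lintegral_const_mul' _ _ (by simp), setLIntegral_const, Real.volume_closedBall]
      _ ≤ _ := by
          rw [mul_add, ← mul_assoc (2 ^ m : ℝ≥0∞) (ENNReal.ofReal (2*δ) ^ m)]
          refine add_le_add ?_ le_rfl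
          rw [hX, C5]
          simp only [mul_assoc]
          exact mul_le_mul_right (mul_le_mul_right (mul_le_mul_right hJint _) _) _
  have hlim : Tendsto (fun δ : ℝ => X + 2 ^ m * ENNReal.ofReal (2 * δ) ^ m * ENNReal.ofReal (2 * l)) (𝓝[>] 0)
      (𝓝 (X + 2 ^ m * ENNReal.ofReal (2 * 0) ^ m * ENNReal.ofReal (2 * l))) := by
    apply tendsto_nhdsWithin_of_tendsto_nhds
    apply Tendsto.const_add
    apply ENNReal.Tendsto.mul_const _ (Or.inr ENNReal.ofReal_ne_top)
    apply ENNReal.Tendsto.const_mul _ (Or.inr (by simp))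
    apply ENNReal.Tendsto.pow
    exact (ENNReal.continuous_ofReal.comp (by fun_prop : Continuous fun δ : ℝ => 2 * δ)).tendsto 0
  rw [mul_zero, ENNReal.ofReal_zero, zero_pow (by omega), mul_zero, zero_mul, add_zero] at hlim
  exact ge_of_tendsto hlim (eventually_mem_nhdsWithin.mono key)

end

section

def Zs {n : ℕ} (f : (Fin n → ℝ) → (Fin n → ℝ)) (x0 : Fin n → ℝ) (r τ : ℝ) (e : Fin n → ℝ) (j : Fin n)
    (y : Fin n → ℝ) : Set ℝ :=
  {σ | ∃ z ∈ closedBall x0 (2*r), z j = σ ∧ ∃ s ∈ Icc (0:ℝ) 1, f z = y - (s * τ) • e}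

structure UF {n : ℕ} (f : (Fin n → ℝ) → (Fin n → ℝ)) (x0 : Fin n → ℝ) (r : ℝ) (u : (Fin n → ℝ) → ℝ) : Prop where
  cont : Continuous u
  nonneg : ∀ y, 0 ≤ u y
  le_one : ∀ y, u y ≤ 1
  level : ∀ y, 0 < u y → u y < 1 → ∃ z ∈ closedBall x0 (2*r), f z = y ∧ ‖z - x0‖ = r * (2 - u y)

lemma u_diff {m : ℕ} {f : (Fin (m+1) → ℝ) → (Fin (m+1) → ℝ)} {x0 : Fin (m+1) → ℝ} {r : ℝ} (hr : 0 < r)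
    {u : (Fin (m+1) → ℝ) → ℝ} (hu : UF f x0 r u) (τ : ℝ) (e y : Fin (m+1) → ℝ) :
    ENNReal.ofReal |u (y - τ • e) - u y| ≤ ∑ j, ENNReal.ofReal (1/r) * volume (Zs f x0 r τ e j y) := by
  set h : ℝ → ℝ := fun s => u (y - (s * τ) • e) with hh
  have hhc : Continuous h := hu.cont.comp (by fun_prop)
  have h0 : h 0 = u y := by simp [hh]
  have h1 : h 1 = u (y - τ • e) := by simp [hh]
  rw [← h0, ← h1]
  have hivt := intermediate_value_uIcc (a := 0) (b := 1) hhc.continuousOn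
  set V := Ioo (min (h 0) (h 1)) (max (h 0) (h 1)) with hV
  have hvol : volume V = ENNReal.ofReal |h 1 - h 0| := by
    rw [hV, Real.volume_Ioo, max_sub_min_eq_abs]
  have hsub : V ⊆ ⋃ j, (fun σ : ℝ => 2 - |σ - x0 j| / r) '' (Zs f x0 r τ e j y) := by
    intro v hv
    obtain ⟨s, hs, hsv⟩ := hivt (Ioo_subset_Icc_self hv)
    rw [uIcc_of_le zero_le_one] at hs
    have hv0 : 0 < v := lt_of_le_of_lt (le_min (hu.nonneg _) (hu.nonneg _)) hv.1
    have hv1 : v < 1 := lt_of_lt_of_le hv.2 (max_le (hu.le_one _) (hu.le_one _))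
    rw [← hsv] at hv0 hv1
    obtain ⟨z, hz, hfz, hn⟩ := hu.level _ hv0 hv1
    obtain ⟨j, -, hj⟩ := Finset.exists_max_image (Finset.univ : Finset (Fin (m+1))) (fun j => ‖(z - x0) j‖) ⟨0, Finset.mem_univ _⟩
    have hjn : ‖z - x0‖ = |z j - x0 j| := by
      apply le_antisymm
      · rw [pi_norm_le_iff_of_nonneg (abs_nonneg _)]
        intro i; exact hj i (Finset.mem_univ _)
      · exact norm_le_pi_norm (z - x0) j
    refine mem_iUnion.2 ⟨j, z j, ⟨z, hz, rfl, s, hs, hfz⟩, ?_⟩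
    simp only [← hjn, hn]
    rw [← hsv]; simp only [hh]; field_simp; ring
  rw [← hvol]
  refine (measure_mono hsub).trans ((measure_iUnion_le _).trans ?_)
  rw [tsum_fintype]
  refine Finset.sum_le_sum fun j _ => ?_
  have hlip : LipschitzWith (Real.toNNReal (1/r)) (fun σ : ℝ => 2 - |σ - x0 j| / r) := by
    apply LipschitzWith.of_dist_le_mul
    intro s t
    rw [Real.coe_toNNReal _ (by positivity), Real.dist_eq, Real.dist_eq]
    have : (2 - |s - x0 j| / r - (2 - |t - x0 j| / r)) = (1/r) * (|t - x0 j| - |s - x0 j|) := by ring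
    rw [this, abs_mul, abs_of_pos (by positivity : 0 < 1/r)]
    refine mul_le_mul_of_nonneg_left ?_ (by positivity)
    have h2 := abs_abs_sub_abs_le (t - x0 j) (s - x0 j)
    have h3 : t - x0 j - (s - x0 j) = -(s - t) := by ring
    rwa [h3, abs_neg] at h2
  have := hlip.lipschitzOnWith.hausdorffMeasure_image_le (s := Zs f x0 r τ e j y) (d := 1) zero_le_one
  rw [hausdorffMeasure_real] at this
  simpa [ENNReal.ofReal] using this


def Ys {m : ℕ} (f : (Fin (m+1) → ℝ) → (Fin (m+1) → ℝ)) (x : Fin (m+1) → ℝ) (l τ : ℝ) (i j : Fin (m+1)) (σ : ℝ) :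
    Set (Fin (m+1) → ℝ) :=
  {y | ∃ z ∈ closedBall x l ∩ {z | z j = σ}, ∃ s ∈ Icc (0:ℝ) 1, f z = y - (s * τ) • (Pi.single i 1 : Fin (m+1) → ℝ)}

lemma sec_vol {m : ℕ} (f : (Fin (m+1) → ℝ) → (Fin (m+1) → ℝ)) (x : Fin (m+1) → ℝ) (l τ : ℝ) (hτ : 0 < τ)
    (i j : Fin (m+1)) (σ : ℝ) (hO : Osc f x l j σ ≤ ENNReal.ofReal τ) :
    volume (Ys f x l τ i j σ) ≤ ENNReal.ofReal (3 * 2 ^ m * τ) * Osc f x l j σ ^ m := by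
  set S := closedBall x l ∩ {z | z j = σ} with hS
  rcases S.eq_empty_or_nonempty with he | ⟨z0, hz0⟩
  · have : Ys f x l τ i j σ = ∅ := by
      ext y; simp only [Ys, ← hS, he]; simp
    rw [this]; simp
  have hfin : Osc f x l j σ ≠ ⊤ := (hO.trans_lt ENNReal.ofReal_lt_top).ne
  set O := (Osc f x l j σ).toReal with hOd
  have hOr : Osc f x l j σ = ENNReal.ofReal O := (ENNReal.ofReal_toReal hfin).symm
  have hO0 : 0 ≤ O := ENNReal.toReal_nonneg
  have hOτ : O ≤ τ := by rw [hOr, ENNReal.ofReal_le_ofReal_iff hτ.le] at hO; exact hO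
  have hsub : Ys f x l τ i j σ ⊆ Icc (fun k => f z0 k - O) (fun k => f z0 k + O + (if k = i then τ else 0)) := by
    rintro y ⟨z, hz, s, hs, hy⟩
    have hd : dist (f z) (f z0) ≤ O := by
      have : edist (f z) (f z0) ≤ Osc f x l j σ := Metric.edist_le_ediam_of_mem (mem_image_of_mem f hz) (mem_image_of_mem f hz0)
      rw [hOr, edist_dist, ENNReal.ofReal_le_ofReal_iff hO0] at this
      exact this
    have hk : ∀ k, |f z k - f z0 k| ≤ O := fun k => (dist_le_pi_dist (f z) (f z0) k).trans hd
    have hyk : ∀ k, y k = f z k + (if k = i then s * τ else 0) := by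
      intro k; rw [hy]; simp [Pi.single_apply]
    have hsτ : s * τ ≤ τ := mul_le_of_le_one_left hτ.le hs.2
    have hsτ0 : 0 ≤ s * τ := mul_nonneg hs.1 hτ.le
    constructor
    · intro k
      have := abs_le.1 (hk k)
      simp only []; rw [hyk k]; split_ifs <;> linarith
    · intro k
      have := abs_le.1 (hk k)
      simp only []; rw [hyk k]; split_ifs <;> linarith
  refine (measure_mono hsub).trans ?_
  rw [Real.volume_Icc_pi, Fin.prod_univ_succAbove _ i, hOr, ← ENNReal.ofReal_pow hO0, ← ENNReal.ofReal_mul (by positivity)]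
  simp only [if_true, Fin.succAbove_ne, if_false]
  have e0 : ∀ k : Fin m, f z0 (i.succAbove k) + O + 0 - (f z0 (i.succAbove k) - O) = 2 * O := fun k => by ring
  simp only [e0]
  rw [Finset.prod_const, Finset.card_univ, Fintype.card_fin]
  rw [← ENNReal.ofReal_pow (by linarith), ← ENNReal.ofReal_mul (by linarith)]
  apply ENNReal.ofReal_le_ofReal
  have e1 : f z0 i + O + τ - (f z0 i - O) ≤ 3 * τ := by linarith
  calc (f z0 i + O + τ - (f z0 i - O)) * (2 * O) ^ m ≤ (3 * τ) * (2 * O) ^ m :=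
        mul_le_mul_of_nonneg_right e1 (by positivity)
    _ = _ := by rw [mul_pow]; ring

end

section

lemma closed_proj {X Y : Type*} [TopologicalSpace X] [TopologicalSpace Y] {K : Set X} (hK : IsCompact K)
    {C : Set (X × Y)} (hC : IsClosed C) : IsClosed {q : Y | ∃ p ∈ K, (p, q) ∈ C} := by
  have : CompactSpace K := isCompact_iff_compactSpace.1 hK
  have h1 : IsClosed ((fun pq : K × Y => ((pq.1 : X), pq.2)) ⁻¹' C) := hC.preimage (by fun_prop)
  have h2 := isClosedMap_snd_of_compactSpace _ h1
  convert h2 using 1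
  ext q; constructor
  · rintro ⟨p, hp, hpq⟩; exact ⟨(⟨p, hp⟩, q), hpq, rfl⟩
  · rintro ⟨⟨p, q'⟩, hpq, rfl⟩; exact ⟨p, p.2, hpq⟩

def PP {m : ℕ} (f : (Fin (m+1) → ℝ) → (Fin (m+1) → ℝ)) (x0 : Fin (m+1) → ℝ) (r l τ : ℝ) (i j : Fin (m+1)) :
    Set ((Fin (m+1) → ℝ) × (ℝ × (Fin (m+1) → ℝ))) :=
  {q | ∃ p ∈ closedBall x0 (2*r) ×ˢ Icc (0:ℝ) 1, p.1 j = q.2.1 ∧ dist p.1 q.2.2 ≤ l ∧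
    f p.1 = q.1 - (p.2 * τ) • (Pi.single i 1 : Fin (m+1) → ℝ)}

lemma PP_meas {m : ℕ} {f : (Fin (m+1) → ℝ) → (Fin (m+1) → ℝ)} (hf : Continuous f) (x0 : Fin (m+1) → ℝ)
    (r l τ : ℝ) (i j : Fin (m+1)) : MeasurableSet (PP f x0 r l τ i j) := by
  apply IsClosed.measurableSet
  refine closed_proj (K := closedBall x0 (2*r) ×ˢ Icc (0:ℝ) 1)
    (C := {w : ((Fin (m+1) → ℝ) × ℝ) × ((Fin (m+1) → ℝ) × (ℝ × (Fin (m+1) → ℝ))) |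
      w.1.1 j = w.2.2.1 ∧ dist w.1.1 w.2.2.2 ≤ l ∧ f w.1.1 = w.2.1 - (w.1.2 * τ) • (Pi.single i 1 : Fin (m+1) → ℝ)})
    ((isCompact_closedBall _ _).prod isCompact_Icc) ?_
  have h1 : IsClosed {w : ((Fin (m+1) → ℝ) × ℝ) × ((Fin (m+1) → ℝ) × (ℝ × (Fin (m+1) → ℝ))) | w.1.1 j = w.2.2.1} :=
    isClosed_eq (f := fun w : ((Fin (m+1) → ℝ) × ℝ) × ((Fin (m+1) → ℝ) × (ℝ × (Fin (m+1) → ℝ))) => w.1.1 j) (g := fun w => w.2.2.1) (by fun_prop) (by fun_prop)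
  have h2 : IsClosed {w : ((Fin (m+1) → ℝ) × ℝ) × ((Fin (m+1) → ℝ) × (ℝ × (Fin (m+1) → ℝ))) | dist w.1.1 w.2.2.2 ≤ l} :=
    isClosed_le (f := fun w : ((Fin (m+1) → ℝ) × ℝ) × ((Fin (m+1) → ℝ) × (ℝ × (Fin (m+1) → ℝ))) => dist w.1.1 w.2.2.2) (g := fun w => l) (by fun_prop) (by fun_prop)
  have h3 : IsClosed {w : ((Fin (m+1) → ℝ) × ℝ) × ((Fin (m+1) → ℝ) × (ℝ × (Fin (m+1) → ℝ))) | f w.1.1 = w.2.1 - (w.1.2 * τ) • (Pi.single i 1 : Fin (m+1) → ℝ)} :=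
    isClosed_eq (f := fun w : ((Fin (m+1) → ℝ) × ℝ) × ((Fin (m+1) → ℝ) × (ℝ × (Fin (m+1) → ℝ))) => f w.1.1)
      (g := fun w => w.2.1 - (w.1.2 * τ) • (Pi.single i 1 : Fin (m+1) → ℝ)) (by fun_prop) (by fun_prop)
  exact h1.inter (h2.inter h3)

lemma avg {m : ℕ} {f : (Fin (m+1) → ℝ) → (Fin (m+1) → ℝ)} (hf : Continuous f) (x0 : Fin (m+1) → ℝ)
    (r l τ : ℝ) (hl : 0 < l) (hlr : l ≤ r) (hτ : 0 < τ) (i j : Fin (m+1)) (k kb : (Fin (m+1) → ℝ) → ℝ≥0∞)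
    (hk : Measurable k) (hkf : ∀ x, k x ≠ ⊤) (hkb : ∀ x, kb x ≠ ⊤)
    (hO : ∀ x σ, Osc f x l j σ ≤ ENNReal.ofReal τ)
    (hkk : ∀ x σ, ∀ y ∈ Ys f x l τ i j σ, k y ≤ kb x) :
    ENNReal.ofReal ((2*l)^(m+1)) * ∫⁻ y, k y * volume (Zs f x0 r τ (Pi.single i 1) j y) ≤
      ∫⁻ x in closedBall x0 (3*r), kb x * (ENNReal.ofReal (3 * 2 ^ m * τ) * ∫⁻ σ, Osc f x l j σ ^ m) := by
  have hPm := PP_meas hf x0 r l τ i j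
  set I : (Fin (m+1) → ℝ) × (ℝ × (Fin (m+1) → ℝ)) → ℝ≥0∞ := (PP f x0 r l τ i j).indicator 1 with hI
  have hIm : Measurable I := measurable_one.indicator hPm
  have h1 : ∀ y, ENNReal.ofReal ((2*l)^(m+1)) * volume (Zs f x0 r τ (Pi.single i 1) j y) ≤
      ∫⁻ σ, ∫⁻ x in closedBall x0 (3*r), I (y, (σ, x)) := by
    intro y
    have hm1 : Measurable fun σ => ∫⁻ x in closedBall x0 (3*r), I (y, (σ, x)) :=
      Measurable.lintegral_prod_right' (f := fun p : ℝ × (Fin (m+1) → ℝ) => I (y, p))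
        (hIm.comp measurable_prodMk_left)
    refine le_trans (mul_le_mul_right (measure_mono ?_) _) (mul_meas_ge_le_lintegral hm1 (ENNReal.ofReal ((2*l)^(m+1))))
    rintro σ ⟨z, hz, hzj, s, hs, hfz⟩
    simp only [mem_ofPred_eq]
    have hsub : closedBall z l ⊆ closedBall x0 (3*r) := by
      apply closedBall_subset_closedBall'
      have := mem_closedBall.1 hz; linarith
    calc ENNReal.ofReal ((2*l)^(m+1)) = ∫⁻ x in closedBall z l, 1 := by
          rw [setLIntegral_one, vol_cb _ hl.le]
      _ ≤ ∫⁻ x in closedBall z l, I (y, (σ, x)) := by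
          refine setLIntegral_mono' measurableSet_closedBall fun x hx => ?_
          rw [hI, indicator_of_mem]; · rfl
          exact ⟨(z, s), ⟨hz, hs⟩, hzj, by rw [dist_comm]; exact hx, hfz⟩
      _ ≤ _ := lintegral_mono_set hsub
  calc ENNReal.ofReal ((2*l)^(m+1)) * ∫⁻ y, k y * volume (Zs f x0 r τ (Pi.single i 1) j y)
      ≤ ∫⁻ y, k y * ∫⁻ σ, ∫⁻ x in closedBall x0 (3*r), I (y, (σ, x)) := by
        rw [← lintegral_const_mul' _ _ ENNReal.ofReal_ne_top]
        refine lintegral_mono fun y => ?_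
        simp only []
        rw [mul_left_comm]
        exact mul_le_mul_right (h1 y) _
    _ = ∫⁻ y, ∫⁻ σ, ∫⁻ x in closedBall x0 (3*r), k y * I (y, (σ, x)) := by
        congr 1; ext y
        rw [← lintegral_const_mul' _ _ (hkf y)]
        congr 1; ext σ
        rw [← lintegral_const_mul' _ _ (hkf y)]
    _ = ∫⁻ y, ∫⁻ x in closedBall x0 (3*r), ∫⁻ σ, k y * I (y, (σ, x)) := by
        congr 1; ext y
        rw [lintegral_lintegral_swap]
        apply Measurable.aemeasurable
        exact (hIm.comp measurable_prodMk_left).const_mul (k y)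
    _ = ∫⁻ x in closedBall x0 (3*r), ∫⁻ y, ∫⁻ σ, k y * I (y, (σ, x)) := by
        rw [lintegral_lintegral_swap]
        apply Measurable.aemeasurable
        refine Measurable.lintegral_prod_right' (f := fun p : ((Fin (m+1) → ℝ) × (Fin (m+1) → ℝ)) × ℝ =>
          k p.1.1 * I (p.1.1, (p.2, p.1.2))) ?_
        exact (hk.comp (by fun_prop)).mul (hIm.comp (by fun_prop))
    _ ≤ _ := by
        refine lintegral_mono fun x => ?_
        simp only []
        rw [lintegral_lintegral_swap, ← lintegral_const_mul' _ _ ENNReal.ofReal_ne_top, ← lintegral_const_mul' _ _ (hkb x)]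
        · refine lintegral_mono fun σ => ?_
          simp only []
          calc ∫⁻ y, k y * I (y, (σ, x)) ≤ ∫⁻ y, (Ys f x l τ i j σ).indicator (fun _ => kb x) y := by
                refine lintegral_mono fun y => ?_
                by_cases hy : (y, (σ, x)) ∈ PP f x0 r l τ i j
                · have hy' : y ∈ Ys f x l τ i j σ := by
                    obtain ⟨p, hp, h1, h2, h3⟩ := hy
                    exact ⟨p.1, ⟨h2, h1⟩, p.2, hp.2, h3⟩
                  rw [hI, indicator_of_mem hy, indicator_of_mem hy']
                  simpa using hkk x σ y hy'
                · rw [hI, indicator_of_notMem hy, mul_zero]; exact zero_le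
            _ ≤ kb x * volume (Ys f x l τ i j σ) := lintegral_indicator_const_le _ _
            _ ≤ _ := mul_le_mul_right (sec_vol f x l τ hτ i j σ (hO x σ)) _
        · apply Measurable.aemeasurable
          exact (hk.comp measurable_fst).mul (hIm.comp (by fun_prop :
            Measurable fun p : (Fin (m+1) → ℝ) × ℝ => (p.1, (p.2, x))))

end

section

def Sset {n : ℕ} (a : (Fin n → ℝ) → ℝ) (τ0 l : ℝ) : Set ((Fin n → ℝ) × (Fin n → ℝ)) :=
  {p | dist p.2 p.1 ≤ 2 * l ∧ a p.1 + τ0 < a p.2}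

lemma Sset_meas {n : ℕ} {a : (Fin n → ℝ) → ℝ} (ham : Measurable a) (τ0 l : ℝ) : MeasurableSet (Sset a τ0 l) := by
  apply MeasurableSet.inter
  · exact (isClosed_le (f := fun p : (Fin n → ℝ) × (Fin n → ℝ) => dist p.2 p.1) (g := fun _ => 2 * l)
      (by fun_prop) (by fun_prop)).measurableSet
  · exact measurableSet_lt (f := fun p : (Fin n → ℝ) × (Fin n → ℝ) => a p.1 + τ0) (g := fun p => a p.2)
      (by fun_prop) (by fun_prop)

lemma err_tendsto {n : ℕ} {φ : ℝ → ℝ} (hφ : Monotone φ) {a : (Fin n → ℝ) → ℝ} (ham : Measurable a)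
    (hai : Integrable a) (hφa : ∫⁻ w, ENNReal.ofReal (φ (a w)) ≠ ⊤) (τ0 : ℝ) (hτ0 : 0 < τ0) :
    Tendsto (fun l : ℝ => ∫⁻ x, (∫⁻ w in closedBall x (2*l), ha φ a (a x + τ0) w) / ENNReal.ofReal ((4*l)^n))
      (𝓝[>] 0) (𝓝 0) := by
  have hψm : Measurable fun w => ENNReal.ofReal (φ (a w)) := (hφ.measurable.comp ham).ennreal_ofReal
  set ψ : (Fin n → ℝ) → ℝ≥0∞ := fun w => ENNReal.ofReal (φ (a w)) with hψ
  have hin : ∀ l x w, (closedBall x (2*l)).indicator (ha φ a (a x + τ0)) w =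
      ψ w * (Sset a τ0 l).indicator 1 (x, w) := by
    intro l x w
    by_cases h1 : dist w x ≤ 2 * l
    · rw [indicator_of_mem (mem_closedBall.2 h1)]
      by_cases h2 : a x + τ0 < a w
      · have h2' : w ∈ {w | a x + τ0 < a w} := h2
        have h3 : (x, w) ∈ Sset a τ0 l := ⟨h1, h2⟩
        rw [ha, indicator_of_mem h2', indicator_of_mem h3]; simp [hψ]
      · have h2' : w ∉ {w | a x + τ0 < a w} := h2
        have h3 : (x, w) ∉ Sset a τ0 l := fun h => h2 h.2
        rw [ha, indicator_of_notMem h2', indicator_of_notMem h3, mul_zero]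
    · have h3 : (x, w) ∉ Sset a τ0 l := fun h => h1 h.1
      rw [indicator_of_notMem (fun h => h1 (mem_closedBall.1 h)), indicator_of_notMem h3, mul_zero]
  have hswap : ∀ l : ℝ, 0 < l → ∫⁻ x, (∫⁻ w in closedBall x (2*l), ha φ a (a x + τ0) w) / ENNReal.ofReal ((4*l)^n)
      = ∫⁻ w, ψ w * ((∫⁻ x, (Sset a τ0 l).indicator 1 (x, w)) / ENNReal.ofReal ((4*l)^n)) := by
    intro l hl
    have hpos : ENNReal.ofReal ((4*l)^n) ≠ 0 := by
      rw [Ne, ENNReal.ofReal_eq_zero, not_le]; positivity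
    have hm : Measurable fun p : (Fin n → ℝ) × (Fin n → ℝ) => ψ p.2 * (Sset a τ0 l).indicator 1 p :=
      (hψm.comp measurable_snd).mul (measurable_one.indicator (Sset_meas ham τ0 l))
    simp only [div_eq_mul_inv]
    rw [lintegral_mul_const' _ _ (ENNReal.inv_ne_top.2 hpos)]
    simp only [← mul_assoc]
    rw [lintegral_mul_const' _ _ (ENNReal.inv_ne_top.2 hpos)]
    congr 1
    calc ∫⁻ x, ∫⁻ w in closedBall x (2*l), ha φ a (a x + τ0) w
        = ∫⁻ x, ∫⁻ w, ψ w * (Sset a τ0 l).indicator 1 (x, w) := by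
          congr 1; ext x
          rw [← lintegral_indicator measurableSet_closedBall]
          congr 1; ext w; exact hin l x w
      _ = ∫⁻ w, ∫⁻ x, ψ w * (Sset a τ0 l).indicator 1 (x, w) := lintegral_lintegral_swap hm.aemeasurable
      _ = _ := by
          congr 1; ext w
          rw [lintegral_const_mul' _ _ ENNReal.ofReal_ne_top]
  have hθ1 : ∀ l : ℝ, 0 < l → ∀ w, (∫⁻ x, (Sset a τ0 l).indicator 1 (x, w)) / ENNReal.ofReal ((4*l)^n) ≤ 1 := by
    intro l hl w
    have h4 : volume (closedBall w (2*l)) = ENNReal.ofReal ((4*l)^n) := by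
      rw [vol_cb _ (by positivity)]; congr 2; ring
    rw [← h4]
    refine ENNReal.div_le_of_le_mul ?_
    rw [one_mul, ← setLIntegral_one, ← lintegral_indicator measurableSet_closedBall]
    refine lintegral_mono fun x => ?_
    by_cases h : (x, w) ∈ Sset a τ0 l
    · have : x ∈ closedBall w (2*l) := by rw [mem_closedBall, dist_comm]; exact h.1
      simp [indicator_of_mem h, indicator_of_mem this]
    · simp [indicator_of_notMem h]
  have hθ2 : ∀ l : ℝ, 0 < l → ∀ w, (∫⁻ x, (Sset a τ0 l).indicator 1 (x, w)) / ENNReal.ofReal ((4*l)^n) ≤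
      (ENNReal.ofReal τ0)⁻¹ * ((∫⁻ x in closedBall w (2*l), ‖a x - a w‖ₑ) / volume (closedBall w (2*l))) := by
    intro l hl w
    have h4 : volume (closedBall w (2*l)) = ENNReal.ofReal ((4*l)^n) := by
      rw [vol_cb _ (by positivity)]; congr 2; ring
    rw [h4, ← mul_div_assoc]
    refine ENNReal.div_le_div_right ?_ _
    rw [← lintegral_const_mul' _ _ (by simpa using hτ0), ← lintegral_indicator measurableSet_closedBall]
    refine lintegral_mono fun x => ?_
    by_cases h : (x, w) ∈ Sset a τ0 l
    · have : x ∈ closedBall w (2*l) := by rw [mem_closedBall, dist_comm]; exact h.1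
      rw [indicator_of_mem h, indicator_of_mem this]
      rw [mul_comm, ← div_eq_mul_inv, ENNReal.le_div_iff_mul_le (Or.inl (by simpa using hτ0)) (Or.inl ENNReal.ofReal_ne_top)]
      have h5 : a x + τ0 < a w := h.2
      simp only [Pi.one_apply, one_mul]
      rw [← ofReal_norm, Real.norm_eq_abs]
      apply ENNReal.ofReal_le_ofReal
      rw [abs_sub_comm]
      exact le_trans (by linarith) (le_abs_self _)
    · simp [indicator_of_notMem h]
  have hev : ∀ᶠ l : ℝ in 𝓝[>] 0, 0 < l := eventually_mem_nhdsWithin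
  have hmain : Tendsto (fun l : ℝ => ∫⁻ w, ψ w * ((∫⁻ x, (Sset a τ0 l).indicator 1 (x, w)) / ENNReal.ofReal ((4*l)^n)))
      (𝓝[>] 0) (𝓝 (∫⁻ w : Fin n → ℝ, (0:ℝ≥0∞))) := by
    refine tendsto_lintegral_filter_of_dominated_convergence ψ ?_ ?_ hφa ?_
    · refine Eventually.of_forall fun l => ?_
      refine hψm.mul (Measurable.div_const ?_ _)
      exact Measurable.lintegral_prod_left' (f := (Sset a τ0 l).indicator 1)
        (measurable_one.indicator (Sset_meas ham τ0 l))
    · filter_upwards [hev] with l hl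
      refine Eventually.of_forall fun w => ?_
      exact (mul_le_mul_right (hθ1 l hl w) _).trans (by rw [mul_one])
    · filter_upwards [(Besicovitch.vitaliFamily (volume : Measure (Fin n → ℝ))).ae_tendsto_lintegral_enorm_sub_div
        hai.locallyIntegrable] with w hw
      have h1 := hw.comp (Besicovitch.tendsto_filterAt volume w)
      have h2 : Tendsto (fun l : ℝ => 2 * l) (𝓝[>] 0) (𝓝[>] 0) := by
        rw [tendsto_nhdsWithin_iff]
        constructor
        · have : Tendsto (fun l : ℝ => 2 * l) (𝓝 0) (𝓝 (2 * 0)) := by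
            exact (continuous_const.mul continuous_id).tendsto 0
          rw [mul_zero] at this
          exact this.mono_left nhdsWithin_le_nhds
        · filter_upwards [hev] with l hl
          show 0 < 2 * l
          positivity
      have h3 := h1.comp h2
      have h4 : Tendsto (fun l : ℝ => ψ w * ((ENNReal.ofReal τ0)⁻¹ * ((∫⁻ x in closedBall w (2*l), ‖a x - a w‖ₑ) /
          volume (closedBall w (2*l))))) (𝓝[>] 0) (𝓝 (ψ w * ((ENNReal.ofReal τ0)⁻¹ * 0))) :=
        ENNReal.Tendsto.const_mul (ENNReal.Tendsto.const_mul h3 (Or.inr (by simpa using hτ0)))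
          (Or.inr ENNReal.ofReal_ne_top)
      rw [mul_zero, mul_zero] at h4
      refine tendsto_of_tendsto_of_tendsto_of_le_of_le' tendsto_const_nhds h4 (Eventually.of_forall fun _ => zero_le) ?_
      filter_upwards [hev] with l hl
      exact mul_le_mul_right (hθ2 l hl w) _
  rw [lintegral_zero] at hmain
  refine hmain.congr' ?_
  filter_upwards [hev] with l hl
  exact (hswap l hl).symm

end

section

structure Core (m : ℕ) (U : Set (Fin (m+1) → ℝ)) (f : (Fin (m+1) → ℝ) → (Fin (m+1) → ℝ))
    (A : (Fin (m+1) → ℝ) → (Fin (m+1) → ℝ) →L[ℝ] (Fin (m+1) → ℝ)) (a : (Fin (m+1) → ℝ) → ℝ) (φ : ℝ → ℝ) : Prop where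
  hm : 2 ≤ m
  uc : UniformContinuous f
  wd : WD U f A
  Am : Measurable A
  Ai : Integrable A
  am : Measurable a
  ai : Integrable a
  a0 : ∀ x, 0 ≤ a x
  Aa : ∀ x, ‖A x‖ ≤ (m+1) * a x
  mono : Monotone φ
  pos : ∀ t, 0 < t → 0 < φ t
  fin : ∫⁻ w, ENNReal.ofReal (φ (a w)) ≠ ⊤
  cal : ∃ t₀ : ℝ, 0 < t₀ ∧ IntegrableOn (fun t => (t / φ t) ^ (1 / ((m : ℝ) - 1))) (Ioi t₀) volume

variable {m : ℕ} {U : Set (Fin (m+1) → ℝ)} {f : (Fin (m+1) → ℝ) → (Fin (m+1) → ℝ)}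
    {A : (Fin (m+1) → ℝ) → (Fin (m+1) → ℝ) →L[ℝ] (Fin (m+1) → ℝ)} {a : (Fin (m+1) → ℝ) → ℝ} {φ : ℝ → ℝ}

lemma Core.am_fin (h : Core m U f A a φ) (x0 : Fin (m+1) → ℝ) (R : ℝ) :
    ∫⁻ x in closedBall x0 R, ENNReal.ofReal (a x) ^ m ≠ ⊤ := by
  obtain ⟨M, hM, hD⟩ := dl_bound h.hm φ h.mono h.pos h.cal 1 one_pos
  have hm1 : (0:ℝ) < (m:ℝ) - 1 := by
    have : (2:ℝ) ≤ m := by exact_mod_cast h.hm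
    linarith
  have key : ∀ t : ℝ, 0 ≤ t → ENNReal.ofReal t ^ m ≤ 1 + M ^ (m-1) * ENNReal.ofReal (φ t) := by
    intro t ht
    by_cases h1 : t ≤ 1
    · refine le_trans ?_ le_self_add
      exact pow_le_one' (by simpa using h1) m
    · push Not at h1
      refine le_trans ?_ le_add_self
      have h2 := (ENNReal.le_tsum 0).trans (hD t h1.le)
      have h0 : 0 < t := by linarith
      have hp := h.pos t h0
      simp only [pow_zero, mul_one] at h2
      have h3 := pow_le_pow_left₀ zero_le h2 (m-1)
      rw [← ENNReal.ofReal_pow (by positivity)] at h3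
      have h4 : (t * (t / φ t) ^ (1 / ((m:ℝ) - 1))) ^ (m-1) = t ^ m / φ t := by
        rw [mul_pow, ← Real.rpow_natCast ((t / φ t) ^ _), ← Real.rpow_mul (by positivity)]
        rw [Nat.cast_sub (by have := h.hm; omega), Nat.cast_one, one_div_mul_cancel hm1.ne', Real.rpow_one]
        have : t ^ m = t ^ (m-1) * t := by rw [← pow_succ]; congr 1; have := h.hm; omega
        rw [this]; ring
      rw [h4] at h3
      calc ENNReal.ofReal t ^ m = ENNReal.ofReal (t ^ m / φ t) * ENNReal.ofReal (φ t) := by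
            rw [← ENNReal.ofReal_mul (by positivity), ← ENNReal.ofReal_pow h0.le]; congr 1; field_simp
        _ ≤ _ := mul_le_mul_left h3 _
  refine ne_of_lt (lt_of_le_of_lt (lintegral_mono fun x => key (a x) (h.a0 x)) ?_)
  rw [lintegral_add_left measurable_const, lintegral_const_mul' _ _ (by finiteness), setLIntegral_one]
  have h5 : ∫⁻ x in closedBall x0 R, ENNReal.ofReal (φ (a x)) ≠ ⊤ :=
    ne_of_lt (lt_of_le_of_lt (setLIntegral_le_lintegral _ _) h.fin.lt_top)
  have h6 : volume (closedBall x0 R) ≠ ⊤ := measure_closedBall_lt_top.ne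
  finiteness

def C6 (m : ℕ) : ℝ≥0∞ := 2 ^ (m+1) * (ENNReal.ofReal (3 * 2 ^ m) * (C5 m * 2 ^ m))

lemma star1 (h : Core m U f A a φ) (x0 : Fin (m+1) → ℝ) (r : ℝ) (hr : 0 < r) (hU : closedBall x0 (4*r) ⊆ U)
    (Φ : (Fin (m+1) → ℝ) → ℝ) (hΦ0 : ∀ y, 0 ≤ Φ y) (L B : ℝ) (hL0 : 0 ≤ L) (hL : ∀ y y', Φ y ≤ Φ y' + L * dist y y')
    (hΦc : Continuous Φ)
    (hB : ∀ y, Φ y ≤ B) (τ : ℝ) (hτ : 0 < τ) (i j : Fin (m+1)) (τ0 : ℝ) (hτ0 : 0 < τ0) :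
    ∫⁻ y, ENNReal.ofReal (Φ y) * volume (Zs f x0 r τ (Pi.single i 1) j y) ≤
      2 ^ (m+1) * (ENNReal.ofReal (3 * 2 ^ m * τ) * (C5 m *
        ∫⁻ x in closedBall x0 (3*r), ENNReal.ofReal (Φ (f x) + 2 * L * τ) * ENNReal.ofReal ((a x + τ0) ^ m))) := by
  obtain ⟨M, hM, hD⟩ := dl_bound h.hm φ h.mono h.pos h.cal τ0 hτ0
  obtain ⟨δ, hδ, hfδ⟩ := Metric.uniformContinuous_iff.1 h.uc (τ/2) (by positivity)
  have hfc := h.uc.continuous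
  set b : ℝ≥0∞ := ENNReal.ofReal (B + 2 * L * τ) with hb
  set J := ∫⁻ x in closedBall x0 (3*r), ENNReal.ofReal (Φ (f x) + 2 * L * τ) * ENNReal.ofReal ((a x + τ0) ^ m)
  set Er : ℝ → ℝ≥0∞ := fun l : ℝ => ∫⁻ x, (∫⁻ w in closedBall x (2*l), ha φ a (a x + τ0) w) / ENNReal.ofReal ((4*l)^(m+1)) with hEr
  have hlim : Tendsto (fun l => 2 ^ (m+1) * (ENNReal.ofReal (3 * 2 ^ m * τ) * (C5 m * (J + M ^ (m-1) * b * Er l)))) (𝓝[>] 0)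
      (𝓝 (2 ^ (m+1) * (ENNReal.ofReal (3 * 2 ^ m * τ) * (C5 m * (J + M ^ (m-1) * b * 0))))) := by
    have hC5 : C5 m ≠ ⊤ := by unfold C5 K1; finiteness
    refine ENNReal.Tendsto.const_mul (ENNReal.Tendsto.const_mul (ENNReal.Tendsto.const_mul ?_ (Or.inr hC5)) (Or.inr ENNReal.ofReal_ne_top)) (Or.inr (by finiteness))
    refine tendsto_const_nhds.add ?_
    exact ENNReal.Tendsto.const_mul (err_tendsto h.mono h.am h.ai h.fin τ0 hτ0) (Or.inr (by finiteness))
  rw [mul_zero, add_zero] at hlim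
  refine ge_of_tendsto hlim ?_
  have hev : ∀ᶠ l : ℝ in 𝓝[>] 0, l ∈ Ioo 0 (min (r/2) (δ/2)) := Ioo_mem_nhdsGT (by positivity)
  filter_upwards [hev] with l hl
  have hl0 := hl.1
  have hlr : l < r/2 := hl.2.trans_le (min_le_left _ _)
  have hlδ : l < δ/2 := hl.2.trans_le (min_le_right _ _)
  have havg := avg hfc x0 r l τ hl0 (by linarith) hτ i j (fun y => ENNReal.ofReal (Φ y))
    (fun x => ENNReal.ofReal (Φ (f x) + 2 * L * τ)) hΦc.measurable.ennreal_ofReal (fun _ => ENNReal.ofReal_ne_top)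
    (fun _ => ENNReal.ofReal_ne_top) ?_ ?_
  · set v : ℝ≥0∞ := ENNReal.ofReal ((4*l)^(m+1)) with hv
    have hv0 : v ≠ 0 := by rw [hv, Ne, ENNReal.ofReal_eq_zero, not_le]; positivity
    have hvt : v ≠ ⊤ := ENNReal.ofReal_ne_top
    have hv2 : v = 2 ^ (m+1) * ENNReal.ofReal ((2*l)^(m+1)) := by
      rw [hv, show (4*l) = 2 * (2*l) by ring, mul_pow, ENNReal.ofReal_mul (by positivity), ENNReal.ofReal_pow (by norm_num)]
      norm_num
    rw [← ENNReal.mul_le_mul_iff_right hv0 hvt]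
    nth_rewrite 1 [hv2]
    rw [mul_assoc]
    refine (mul_le_mul_right havg _).trans ?_
    rw [mul_left_comm v]
    refine mul_le_mul_right ?_ _
    set H : (Fin (m+1) → ℝ) → ℝ≥0∞ := fun x => ∫⁻ w in closedBall x (2*l), ha φ a (a x + τ0) w with hH
    have h1 : ∀ x ∈ closedBall x0 (3*r), ENNReal.ofReal (Φ (f x) + 2 * L * τ) *
        (ENNReal.ofReal (3 * 2 ^ m * τ) * ∫⁻ σ, Osc f x l j σ ^ m) ≤
        (v * (ENNReal.ofReal (3 * 2 ^ m * τ) * C5 m)) * (ENNReal.ofReal (Φ (f x) + 2 * L * τ) * ENNReal.ofReal ((a x + τ0) ^ m)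
          + M ^ (m-1) * b * (H x / v)) := by
      intro x hx
      have hT : 0 < a x + τ0 := by have := h.a0 x; linarith
      have h2 := slice_int h.hm h.wd h.uc h.am h.Aa h.mono h.pos x l hl0 ((closedBall_subset_closedBall' (by
        have := mem_closedBall.1 hx; linarith)).trans hU) (a x + τ0) hT j
      have h3 : ENNReal.ofReal (l ^ (m+1) * (a x + τ0) ^ m) ≤ v * ENNReal.ofReal ((a x + τ0) ^ m) := by
        rw [hv, ← ENNReal.ofReal_mul (by positivity)]
        apply ENNReal.ofReal_le_ofReal
        refine mul_le_mul_of_nonneg_right (pow_le_pow_left₀ hl0.le (by linarith) _) (by positivity)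
      have h4 : Dl m φ (a x + τ0) ^ (m-1) ≤ M ^ (m-1) :=
        pow_le_pow_left₀ zero_le (hD _ (by have := h.a0 x; linarith)) _
      have h5 : v * (H x / v) = H x := ENNReal.mul_div_cancel hv0 hvt
      have h6 : ENNReal.ofReal (Φ (f x) + 2 * L * τ) ≤ b := ENNReal.ofReal_le_ofReal (by have := hB (f x); linarith)
      calc ENNReal.ofReal (Φ (f x) + 2 * L * τ) * (ENNReal.ofReal (3 * 2 ^ m * τ) * ∫⁻ σ, Osc f x l j σ ^ m)
          ≤ ENNReal.ofReal (Φ (f x) + 2 * L * τ) * (ENNReal.ofReal (3 * 2 ^ m * τ) *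
            (C5 m * (v * ENNReal.ofReal ((a x + τ0) ^ m) + M ^ (m-1) * (v * (H x / v))))) := by
            refine mul_le_mul_right (mul_le_mul_right (h2.trans (mul_le_mul_right ?_ _)) _) _
            rw [h5]
            exact add_le_add h3 (mul_le_mul_left h4 _)
        _ = (v * (ENNReal.ofReal (3 * 2 ^ m * τ) * C5 m)) * (ENNReal.ofReal (Φ (f x) + 2 * L * τ) * ENNReal.ofReal ((a x + τ0) ^ m)
          + M ^ (m-1) * ENNReal.ofReal (Φ (f x) + 2 * L * τ) * (H x / v)) := by ring
        _ ≤ _ := by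
            refine mul_le_mul_right (add_le_add le_rfl (mul_le_mul_left (mul_le_mul_right h6 _) _)) _
    refine (setLIntegral_mono' measurableSet_closedBall h1).trans ?_
    have hC5 : C5 m ≠ ⊤ := by unfold C5 K1; finiteness
    rw [lintegral_const_mul' _ _ (by finiteness), lintegral_add_left, lintegral_const_mul' _ _ (by finiteness)]
    · rw [mul_assoc v, mul_assoc]
      refine mul_le_mul_right (mul_le_mul_right (mul_le_mul_right (add_le_add le_rfl (mul_le_mul_right ?_ _)) _) _) _
      exact setLIntegral_le_lintegral _ _
    · have := h.am
      have h7 : Measurable fun x => Φ (f x) := hΦc.measurable.comp hfc.measurable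
      fun_prop
  · intro x σ
    refine ediam_le ?_
    rintro _ ⟨z, hz, rfl⟩ _ ⟨z', hz', rfl⟩
    rw [edist_dist]
    apply ENNReal.ofReal_le_ofReal
    refine (hfδ ?_).le.trans (by linarith)
    calc dist z z' ≤ dist z x + dist z' x := dist_triangle_right _ _ _
      _ ≤ l + l := add_le_add hz.1 hz'.1
      _ < δ := by linarith
  · rintro x σ y ⟨z, hz, s, hs, hfz⟩
    apply ENNReal.ofReal_le_ofReal
    refine (hL y (f x)).trans ?_
    have h1 : dist (f z) (f x) < τ/2 := hfδ (lt_of_le_of_lt hz.1 (by linarith))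
    have h2 : dist y (f z) ≤ τ := by
      rw [hfz, dist_eq_norm, sub_sub_cancel, norm_smul, Real.norm_eq_abs, abs_of_nonneg (mul_nonneg hs.1 hτ.le)]
      have : ‖(Pi.single i 1 : Fin (m+1) → ℝ)‖ = 1 := by rw [Pi.norm_single]; simp
      rw [this, mul_one]
      nlinarith [hs.2]
    have h3 := dist_triangle y (f z) (f x)
    have : L * dist y (f x) ≤ L * (2 * τ) := mul_le_mul_of_nonneg_left (by linarith) hL0
    linarith

lemma star2 (h : Core m U f A a φ) (x0 : Fin (m+1) → ℝ) (r : ℝ) (hr : 0 < r) (hU : closedBall x0 (4*r) ⊆ U)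
    (Φ : (Fin (m+1) → ℝ) → ℝ) (hΦ0 : ∀ y, 0 ≤ Φ y) (L B : ℝ) (hL0 : 0 ≤ L) (hL : ∀ y y', Φ y ≤ Φ y' + L * dist y y')
    (hΦc : Continuous Φ)
    (hB : ∀ y, Φ y ≤ B) (τ : ℝ) (hτ : 0 < τ) (i j : Fin (m+1)) :
    ∫⁻ y, ENNReal.ofReal (Φ y) * volume (Zs f x0 r τ (Pi.single i 1) j y) ≤
      ENNReal.ofReal τ * (C6 m *
        ∫⁻ x in closedBall x0 (3*r), ENNReal.ofReal (Φ (f x) + 2 * L * τ) * ENNReal.ofReal (a x) ^ m) := by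
  set b : ℝ≥0∞ := ENNReal.ofReal (B + 2 * L * τ) with hb
  set J := ∫⁻ x in closedBall x0 (3*r), ENNReal.ofReal (Φ (f x) + 2 * L * τ) * ENNReal.ofReal (a x) ^ m
  have hC5 : C5 m ≠ ⊤ := by unfold C5 K1; finiteness
  have hC6 : C6 m ≠ ⊤ := by unfold C6; finiteness
  have hfc := h.uc.continuous
  have hv : volume (closedBall x0 (3*r)) ≠ ⊤ := measure_closedBall_lt_top.ne
  have hm0 : m ≠ 0 := by have := h.hm; omega
  have hlim : Tendsto (fun t : ℝ => ENNReal.ofReal τ * (C6 m * (J + b * volume (closedBall x0 (3*r)) * ENNReal.ofReal t ^ m))) (𝓝[>] 0)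
      (𝓝 (ENNReal.ofReal τ * (C6 m * (J + b * volume (closedBall x0 (3*r)) * 0)))) := by
    refine ENNReal.Tendsto.const_mul (ENNReal.Tendsto.const_mul ?_ (Or.inr hC6)) (Or.inr ENNReal.ofReal_ne_top)
    refine tendsto_const_nhds.add (ENNReal.Tendsto.const_mul ?_ (Or.inr (by finiteness)))
    have : Tendsto (fun t : ℝ => ENNReal.ofReal t ^ m) (𝓝 0) (𝓝 (ENNReal.ofReal 0 ^ m)) :=
      ((ENNReal.continuous_pow m).comp ENNReal.continuous_ofReal).tendsto 0
    rw [ENNReal.ofReal_zero, zero_pow hm0] at this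
    exact this.mono_left nhdsWithin_le_nhds
  rw [mul_zero, add_zero] at hlim
  refine ge_of_tendsto hlim ?_
  have hev : ∀ᶠ l : ℝ in 𝓝[>] 0, 0 < l := eventually_mem_nhdsWithin
  filter_upwards [hev] with t ht
  refine (star1 h x0 r hr hU Φ hΦ0 L B hL0 hL hΦc hB τ hτ i j t ht).trans ?_
  have h1 : ∫⁻ x in closedBall x0 (3*r), ENNReal.ofReal (Φ (f x) + 2 * L * τ) * ENNReal.ofReal ((a x + t) ^ m) ≤
      ∫⁻ x in closedBall x0 (3*r), 2 ^ m * (ENNReal.ofReal (Φ (f x) + 2 * L * τ) * ENNReal.ofReal (a x) ^ m + b * ENNReal.ofReal t ^ m) := by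
    refine lintegral_mono fun x => ?_
    simp only []
    have h6 : ENNReal.ofReal (Φ (f x) + 2 * L * τ) ≤ b := ENNReal.ofReal_le_ofReal (by have := hB (f x); linarith)
    rw [ENNReal.ofReal_pow (by have := h.a0 x; linarith), ENNReal.ofReal_add (h.a0 x) ht.le]
    calc ENNReal.ofReal (Φ (f x) + 2 * L * τ) * (ENNReal.ofReal (a x) + ENNReal.ofReal t) ^ m
        ≤ ENNReal.ofReal (Φ (f x) + 2 * L * τ) * (2 ^ m * (ENNReal.ofReal (a x) ^ m + ENNReal.ofReal t ^ m)) :=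
          mul_le_mul_right (add_pow_le2 _ _ _) _
      _ = 2 ^ m * (ENNReal.ofReal (Φ (f x) + 2 * L * τ) * ENNReal.ofReal (a x) ^ m + ENNReal.ofReal (Φ (f x) + 2 * L * τ) * ENNReal.ofReal t ^ m) := by ring
      _ ≤ _ := mul_le_mul_right (add_le_add le_rfl (mul_le_mul_left h6 _)) _
  rw [lintegral_const_mul' _ _ (by finiteness), lintegral_add_right _ measurable_const, setLIntegral_const] at h1
  refine (mul_le_mul_right (mul_le_mul_right (mul_le_mul_right h1 _) _) _).trans (le_of_eq ?_)
  rw [C6, ENNReal.ofReal_mul (by positivity)]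
  ring

end

section

variable {m : ℕ} {U : Set (Fin (m+1) → ℝ)} {f : (Fin (m+1) → ℝ) → (Fin (m+1) → ℝ)}
    {A : (Fin (m+1) → ℝ) → (Fin (m+1) → ℝ) →L[ℝ] (Fin (m+1) → ℝ)} {a : (Fin (m+1) → ℝ) → ℝ} {φ : ℝ → ℝ}

lemma Zs_meas (hf : Continuous f) (x0 : Fin (m+1) → ℝ) (r τ : ℝ) (e : Fin (m+1) → ℝ) (j : Fin (m+1)) :
    Measurable fun y => volume (Zs f x0 r τ e j y) := by
  have h0 : IsClosed {q : (Fin (m+1) → ℝ) × ℝ | ∃ p ∈ closedBall x0 (2*r) ×ˢ Icc (0:ℝ) 1, (p, q) ∈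
      {w : ((Fin (m+1) → ℝ) × ℝ) × ((Fin (m+1) → ℝ) × ℝ) | w.1.1 j = w.2.2 ∧ f w.1.1 = w.2.1 - (w.1.2 * τ) • e}} := by
    apply closed_proj ((isCompact_closedBall _ _).prod isCompact_Icc)
    have h1 : IsClosed {w : ((Fin (m+1) → ℝ) × ℝ) × ((Fin (m+1) → ℝ) × ℝ) | w.1.1 j = w.2.2} :=
      isClosed_eq (f := fun w : ((Fin (m+1) → ℝ) × ℝ) × ((Fin (m+1) → ℝ) × ℝ) => w.1.1 j) (g := fun w => w.2.2)
        (by fun_prop) (by fun_prop)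
    have h2 : IsClosed {w : ((Fin (m+1) → ℝ) × ℝ) × ((Fin (m+1) → ℝ) × ℝ) | f w.1.1 = w.2.1 - (w.1.2 * τ) • e} :=
      isClosed_eq (f := fun w : ((Fin (m+1) → ℝ) × ℝ) × ((Fin (m+1) → ℝ) × ℝ) => f w.1.1)
        (g := fun w => w.2.1 - (w.1.2 * τ) • e) (by fun_prop) (by fun_prop)
    exact h1.inter h2
  have h1 := measurable_measure_prodMk_left (ν := (volume : Measure ℝ)) h0.measurableSet
  convert h1 using 3 with y
  ext σ
  constructor
  · rintro ⟨z, hz, hj, s, hs, hf⟩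
    exact ⟨(z, s), ⟨hz, hs⟩, hj, hf⟩
  · rintro ⟨⟨z, s⟩, ⟨hz, hs⟩, hj, hf⟩
    exact ⟨z, hz, hj, s, hs, hf⟩

lemma fderiv_norm_le {n : ℕ} (D : (Fin n → ℝ) →L[ℝ] ℝ) : ‖D‖ₑ ≤ ∑ i, ENNReal.ofReal |D (Pi.single i 1)| := by
  rw [← ENNReal.ofReal_sum_of_nonneg (fun i _ => abs_nonneg _), ← ofReal_norm]
  apply ENNReal.ofReal_le_ofReal
  refine D.opNorm_le_bound (Finset.sum_nonneg fun i _ => abs_nonneg _) fun v => ?_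
  have hv : v = ∑ i, v i • (Pi.single i 1 : Fin n → ℝ) := by
    ext k
    simp [Finset.sum_apply, Pi.single_apply]
  conv_lhs => rw [hv, map_sum]
  refine (norm_sum_le _ _).trans ?_
  rw [Finset.sum_mul]
  refine Finset.sum_le_sum fun i _ => ?_
  rw [map_smul, norm_smul, mul_comm, Real.norm_eq_abs (D _)]
  exact mul_le_mul_of_nonneg_left (norm_le_pi_norm v i) (abs_nonneg _)

lemma moll_diff {u : (Fin (m+1) → ℝ) → ℝ} (hu : Continuous u) {ρ : ℝ} (hρ : 0 < ρ) (y0 e : Fin (m+1) → ℝ) (τ : ℝ) :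
    ENNReal.ofReal |moll ρ u (y0 - τ • e) - moll ρ u y0| ≤
      ∫⁻ z, ENNReal.ofReal (eta (m+1) ρ (y0 - z)) * ENNReal.ofReal |u (z - τ • e) - u z| := by
  have hcs := (eta_test (n := m+1) hρ y0).2.1
  have hec : Continuous (fun z => eta (m+1) ρ (y0 - z)) := (eta_test (n := m+1) hρ y0).1.continuous
  have h1 : moll ρ u (y0 - τ • e) = ∫ z, eta (m+1) ρ (y0 - z) * u (z - τ • e) := by
    rw [moll_eq, ← integral_sub_right_eq_self _ (τ • e)]
    congr 1; ext z
    rw [smul_eq_mul]; congr 2; abel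
  have i1 : Integrable fun z => eta (m+1) ρ (y0 - z) * u (z - τ • e) :=
    Continuous.integrable_of_hasCompactSupport (hec.mul (hu.comp (by fun_prop))) hcs.mul_right
  have i2 : Integrable fun z => eta (m+1) ρ (y0 - z) * u z :=
    Continuous.integrable_of_hasCompactSupport (hec.mul hu) hcs.mul_right
  rw [h1, moll_eq]
  simp only [smul_eq_mul]
  rw [← integral_sub i1 i2, ← Real.norm_eq_abs, ofReal_norm]
  refine (enorm_integral_le_lintegral_enorm _).trans (lintegral_mono fun z => ?_)
  simp only []
  rw [← mul_sub, enorm_mul, ← ofReal_norm, ← ofReal_norm, Real.norm_eq_abs, Real.norm_eq_abs, abs_of_nonneg (eta_nonneg hρ _)]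

def C7 (m : ℕ) : ℝ≥0∞ := (m+1) * ((m+1) * C6 m)

lemma grad_bound (h : Core m U f A a φ) (x0 : Fin (m+1) → ℝ) (r : ℝ) (hr : 0 < r) (hU : closedBall x0 (4*r) ⊆ U)
    {u : (Fin (m+1) → ℝ) → ℝ} (hu : UF f x0 r u) {ρ : ℝ} (hρ : 0 < ρ) (y0 : Fin (m+1) → ℝ) :
    ‖fderiv ℝ (moll ρ u) y0‖ₑ ≤ C7 m * (ENNReal.ofReal (1/r) *
      ∫⁻ x in closedBall x0 (3*r), ENNReal.ofReal (eta (m+1) ρ (y0 - f x)) * ENNReal.ofReal (a x) ^ m) := by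
  have hfc := h.uc.continuous
  have hec : Continuous (fun z => eta (m+1) ρ (y0 - z)) := (eta_test (n := m+1) hρ y0).1.continuous
  obtain ⟨L, hL⟩ := ContDiff.lipschitzWith_of_hasCompactSupport (eta_test (n := m+1) hρ y0).2.1
    (eta_test (n := m+1) hρ y0).1 (by simp)
  have hL' : ∀ y y', eta (m+1) ρ (y0 - y) ≤ eta (m+1) ρ (y0 - y') + L * dist y y' := by
    intro y y'
    have h1 := hL.dist_le_mul y y'
    have := (le_abs_self _).trans h1
    linarith
  set J := ∫⁻ x in closedBall x0 (3*r), ENNReal.ofReal (eta (m+1) ρ (y0 - f x)) * ENNReal.ofReal (a x) ^ m with hJ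
  set N := ∫⁻ x in closedBall x0 (3*r), ENNReal.ofReal (a x) ^ m with hN
  have hNf : N ≠ ⊤ := h.am_fin x0 (3*r)
  have hC5 : C5 m ≠ ⊤ := by unfold C5 K1; finiteness
  have hC6 : C6 m ≠ ⊤ := by unfold C6; finiteness
  have hmd := moll_contDiff hρ u hu.cont.locallyIntegrable
  have hpart : ∀ i, ENNReal.ofReal |fderiv ℝ (moll ρ u) y0 (Pi.single i 1)| ≤ (m+1) * (ENNReal.ofReal (1/r) * (C6 m * J)) := by
    intro i
    have hlim : Tendsto (fun τ : ℝ => (m+1) * (ENNReal.ofReal (1/r) * (C6 m * (J + ENNReal.ofReal (2 * L * τ) * N)))) (𝓝[>] 0)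
        (𝓝 ((m+1) * (ENNReal.ofReal (1/r) * (C6 m * (J + 0 * N))))) := by
      refine ENNReal.Tendsto.const_mul (ENNReal.Tendsto.const_mul (ENNReal.Tendsto.const_mul ?_ (Or.inr hC6)) (Or.inr ENNReal.ofReal_ne_top)) (Or.inr (by finiteness))
      refine tendsto_const_nhds.add (ENNReal.Tendsto.mul_const ?_ (Or.inr hNf))
      have : Tendsto (fun t : ℝ => ENNReal.ofReal (2 * L * t)) (𝓝 0) (𝓝 (ENNReal.ofReal (2 * L * 0))) :=
        (ENNReal.continuous_ofReal.comp (by fun_prop : Continuous fun t : ℝ => 2 * L * t)).tendsto 0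
      rw [mul_zero, ENNReal.ofReal_zero] at this
      exact this.mono_left nhdsWithin_le_nhds
    rw [zero_mul, add_zero] at hlim
    have hder : HasDerivAt (fun τ : ℝ => moll ρ u (y0 - τ • (Pi.single i 1 : Fin (m+1) → ℝ)))
        (-fderiv ℝ (moll ρ u) y0 (Pi.single i 1)) 0 := by
      have h1 : HasFDerivAt (moll ρ u) (fderiv ℝ (moll ρ u) y0) (y0 - (0:ℝ) • (Pi.single i 1 : Fin (m+1) → ℝ)) := by
        rw [zero_smul, sub_zero]
        exact (hmd.differentiable (by simp) _).hasFDerivAt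
      have h2 : HasDerivAt (fun τ : ℝ => y0 - τ • (Pi.single i 1 : Fin (m+1) → ℝ)) (-(Pi.single i 1 : Fin (m+1) → ℝ)) 0 := by
        have := ((hasDerivAt_id (0:ℝ)).smul_const (Pi.single i 1 : Fin (m+1) → ℝ)).const_sub y0
        rwa [one_smul] at this
      have h3 := h1.comp_hasDerivAt 0 h2
      rwa [map_neg] at h3
    have hs := hder.tendsto_slope_zero_right
    have hs2 : Tendsto (fun τ : ℝ => ENNReal.ofReal |τ⁻¹ • (moll ρ u (y0 - (0 + τ) • (Pi.single i 1 : Fin (m+1) → ℝ)) - moll ρ u (y0 - (0:ℝ) • (Pi.single i 1 : Fin (m+1) → ℝ)))|)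
        (𝓝[>] 0) (𝓝 (ENNReal.ofReal |-fderiv ℝ (moll ρ u) y0 (Pi.single i 1)|)) :=
      (ENNReal.continuous_ofReal.tendsto _).comp ((continuous_abs.tendsto _).comp hs)
    rw [abs_neg] at hs2
    refine le_of_tendsto_of_tendsto hs2 hlim ?_
    have hev : ∀ᶠ l : ℝ in 𝓝[>] 0, 0 < l := eventually_mem_nhdsWithin
    filter_upwards [hev] with τ hτ
    rw [zero_add, zero_smul, sub_zero, smul_eq_mul, abs_mul, abs_of_pos (inv_pos.2 hτ), ENNReal.ofReal_mul (by positivity)]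
    have hτ1 : ENNReal.ofReal τ⁻¹ * ENNReal.ofReal τ = 1 := by
      rw [← ENNReal.ofReal_mul (by positivity), inv_mul_cancel₀ hτ.ne']; simp
    have hsplit : ∫⁻ x in closedBall x0 (3*r), ENNReal.ofReal (eta (m+1) ρ (y0 - f x) + 2 * L * τ) * ENNReal.ofReal (a x) ^ m
        ≤ J + ENNReal.ofReal (2 * L * τ) * N := by
      rw [hJ, hN, ← lintegral_const_mul' _ _ ENNReal.ofReal_ne_top, ← lintegral_add_left]
      · refine lintegral_mono fun x => ?_
        simp only []
        rw [ENNReal.ofReal_add (eta_nonneg hρ _) (by positivity), add_mul]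
      · have := h.am
        have h7 : Measurable fun x => eta (m+1) ρ (y0 - f x) := hec.measurable.comp hfc.measurable
        fun_prop
    calc ENNReal.ofReal τ⁻¹ * ENNReal.ofReal |moll ρ u (y0 - τ • (Pi.single i 1 : Fin (m+1) → ℝ)) - moll ρ u y0|
        ≤ ENNReal.ofReal τ⁻¹ * ∫⁻ z, ENNReal.ofReal (eta (m+1) ρ (y0 - z)) * ENNReal.ofReal |u (z - τ • (Pi.single i 1 : Fin (m+1) → ℝ)) - u z| :=
          mul_le_mul_right (moll_diff hu.cont hρ y0 _ τ) _
      _ ≤ ENNReal.ofReal τ⁻¹ * ∫⁻ z, ∑ j, ENNReal.ofReal (1/r) * (ENNReal.ofReal (eta (m+1) ρ (y0 - z)) * volume (Zs f x0 r τ (Pi.single i 1) j z)) := by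
          refine mul_le_mul_right (lintegral_mono fun z => ?_) _
          simp only []
          refine (mul_le_mul_right (u_diff hr hu τ _ z) _).trans (le_of_eq ?_)
          rw [Finset.mul_sum]
          refine Finset.sum_congr rfl fun j _ => ?_
          rw [mul_left_comm]
      _ = ENNReal.ofReal τ⁻¹ * ∑ j, ENNReal.ofReal (1/r) * ∫⁻ z, (ENNReal.ofReal (eta (m+1) ρ (y0 - z)) * volume (Zs f x0 r τ (Pi.single i 1) j z)) := by
          congr 1
          rw [lintegral_finsetSum]
          · refine Finset.sum_congr rfl fun j _ => ?_
            rw [lintegral_const_mul' _ _ ENNReal.ofReal_ne_top]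
          · intro j _
            exact (hec.measurable.ennreal_ofReal.mul (Zs_meas hfc x0 r τ _ j)).const_mul _
      _ ≤ ENNReal.ofReal τ⁻¹ * ∑ j : Fin (m+1), ENNReal.ofReal (1/r) * (ENNReal.ofReal τ * (C6 m * (J + ENNReal.ofReal (2 * L * τ) * N))) := by
          refine mul_le_mul_right (Finset.sum_le_sum fun j _ => mul_le_mul_right ?_ _) _
          refine (star2 h x0 r hr hU (fun z => eta (m+1) ρ (y0 - z)) (fun z => eta_nonneg hρ _) L _ L.2 hL' hec
            (fun z => eta_le hρ _) τ hτ i j).trans ?_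
          exact mul_le_mul_right (mul_le_mul_right hsplit _) _
      _ = (ENNReal.ofReal τ⁻¹ * ENNReal.ofReal τ) * ((m+1) * (ENNReal.ofReal (1/r) * (C6 m * (J + ENNReal.ofReal (2 * L * τ) * N)))) := by
          rw [Finset.sum_const, Finset.card_univ, Fintype.card_fin, nsmul_eq_mul]
          push_cast
          ring
      _ = _ := by rw [hτ1, one_mul]
  refine (fderiv_norm_le _).trans ((Finset.sum_le_sum fun i _ => hpart i).trans (le_of_eq ?_))
  rw [Finset.sum_const, Finset.card_univ, Fintype.card_fin, nsmul_eq_mul, C7]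
  push_cast
  ring

end

section

variable {m : ℕ} {U : Set (Fin (m+1) → ℝ)} {f : (Fin (m+1) → ℝ) → (Fin (m+1) → ℝ)}
    {A : (Fin (m+1) → ℝ) → (Fin (m+1) → ℝ) →L[ℝ] (Fin (m+1) → ℝ)} {a : (Fin (m+1) → ℝ) → ℝ} {φ : ℝ → ℝ}

lemma holder_eta {X : Type*} [MeasurableSpace X] (μ : Measure X) (p : ℝ) (hm : 0 < m) (hp : (m:ℝ) < p)
    (e b K J : X → ℝ≥0∞) (he : Measurable e) (hK : Measurable K) (hJ : Measurable J)
    (hb : ∀ᵐ x ∂μ, b x ^ p ≤ K x * J x) (h1 : ∫⁻ x, e x * J x ∂μ ≤ 1) :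
    (∫⁻ x, e x * b x ^ m ∂μ) ^ (p / (p - m)) ≤ ∫⁻ x, e x * K x ^ ((m:ℝ) / (p - m)) ∂μ := by
  have hm' : (0:ℝ) < m := by exact_mod_cast hm
  have hp0 : 0 < p := hm'.trans hp
  have hpm : 0 < p - m := by linarith
  set q := p / (p - m) with hq
  set q' := p / m with hq'
  have hq0 : 0 < q := by positivity
  have hq'0 : 0 < q' := by positivity
  have hconj : q.HolderConjugate q' := by
    refine Real.holderConjugate_iff.2 ⟨by rw [hq, lt_div_iff₀ hpm]; linarith, ?_⟩
    rw [hq, hq']; field_simp; ring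
  have hle : ∫⁻ x, e x * b x ^ m ∂μ ≤
      ∫⁻ x, ((fun x => (e x * K x ^ ((m:ℝ) / (p - m))) ^ (1/q)) * (fun x => (e x * J x) ^ (1/q'))) x ∂μ := by
    refine lintegral_mono_ae ?_
    filter_upwards [hb] with x hx
    simp only [Pi.mul_apply]
    have h2 : b x ^ m ≤ K x ^ ((m:ℝ)/p) * J x ^ ((m:ℝ)/p) := by
      rw [← ENNReal.mul_rpow_of_nonneg _ _ (by positivity)]
      calc b x ^ m = (b x ^ p) ^ ((m:ℝ)/p) := by
            rw [← ENNReal.rpow_mul, mul_div_cancel₀ _ hp0.ne', ENNReal.rpow_natCast]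
        _ ≤ _ := ENNReal.rpow_le_rpow hx (by positivity)
    rw [ENNReal.mul_rpow_of_nonneg _ _ (by positivity), ENNReal.mul_rpow_of_nonneg _ _ (by positivity), ← ENNReal.rpow_mul]
    have h3 : (m:ℝ) / (p - m) * (1 / q) = m / p := by rw [hq]; field_simp
    have h4 : 1 / q' = (m:ℝ)/p := by rw [hq']; field_simp
    rw [h3, mul_mul_mul_comm, ← ENNReal.rpow_add_of_nonneg _ _ (by positivity) (by positivity), h4]
    have h5 : 1 / q + (m:ℝ)/p = 1 := by rw [hq]; field_simp; ring
    rw [h5, ENNReal.rpow_one]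
    exact mul_le_mul_right h2 _
  have hho := ENNReal.lintegral_mul_le_Lp_mul_Lq μ hconj
    (f := fun x => (e x * K x ^ ((m:ℝ) / (p - m))) ^ (1/q)) (g := fun x => (e x * J x) ^ (1/q'))
    ((he.mul (hK.pow_const _)).pow_const _).aemeasurable ((he.mul hJ).pow_const _).aemeasurable
  have h6 := hle.trans hho
  simp only [← ENNReal.rpow_mul] at h6
  rw [one_div_mul_cancel hq0.ne', one_div_mul_cancel hq'0.ne'] at h6
  simp only [ENNReal.rpow_one] at h6
  have h7 : (∫⁻ x, e x * J x ∂μ) ^ (1/q') ≤ 1 := ENNReal.rpow_le_one h1 (by positivity)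
  have h8 := h6.trans ((mul_le_mul_right h7 _).trans (by rw [mul_one]))
  calc _ ≤ ((∫⁻ x, e x * K x ^ ((m:ℝ) / (p - m)) ∂μ) ^ (1/q)) ^ q := ENNReal.rpow_le_rpow h8 hq0.le
    _ = _ := by rw [← ENNReal.rpow_mul, one_div_mul_cancel hq0.ne', ENNReal.rpow_one]

lemma energy (h : Core m U f A a φ) (x0 : Fin (m+1) → ℝ) (r : ℝ) (hr : 0 < r) (hU : closedBall x0 (4*r) ⊆ U)
    (hinj : InjOn f (ball x0 (4*r)))
    {u : (Fin (m+1) → ℝ) → ℝ} (hu : UF f x0 r u) {ρ : ℝ} (hρ : 0 < ρ) (p : ℝ) (hp : (m:ℝ) < p)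
    (K : (Fin (m+1) → ℝ) → ℝ≥0∞) (hK : Measurable K)
    (hb : ∀ᵐ x ∂volume.restrict (closedBall x0 (3*r)), ENNReal.ofReal (a x) ^ p ≤ K x * ENNReal.ofReal |(A x).det|) :
    ∫⁻ y, ‖fderiv ℝ (moll ρ u) y‖ₑ ^ (p / (p - m)) ≤
      (C7 m * ENNReal.ofReal (1/r)) ^ (p / (p - m)) * ∫⁻ x in closedBall x0 (3*r), K x ^ ((m:ℝ) / (p - m)) := by
  have hfc := h.uc.continuous
  have hm' : (0:ℝ) < m := by have := h.hm; exact_mod_cast (by omega : 0 < m)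
  have hpm : 0 < p - m := by linarith
  have hp0 : 0 < p := by linarith
  have hq0 : 0 < p / (p - m) := by positivity
  have hdet : Measurable fun x => ENNReal.ofReal |(A x).det| :=
    ((ContinuousLinearMap.continuous_det.measurable.comp h.Am).abs).ennreal_ofReal
  have hem : Measurable fun w : (Fin (m+1) → ℝ) × (Fin (m+1) → ℝ) => ENNReal.ofReal (eta (m+1) ρ (w.1 - f w.2)) := by
    apply Measurable.ennreal_ofReal
    apply Continuous.measurable
    exact (eta_cont hρ).comp (by fun_prop)
  have hpt : ∀ y, ‖fderiv ℝ (moll ρ u) y‖ₑ ^ (p / (p - m)) ≤ (C7 m * ENNReal.ofReal (1/r)) ^ (p / (p - m)) *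
      ∫⁻ x in closedBall x0 (3*r), ENNReal.ofReal (eta (m+1) ρ (y - f x)) * K x ^ ((m:ℝ) / (p - m)) := by
    intro y
    have h1 := grad_bound h x0 r hr hU hu hρ y
    rw [← mul_assoc] at h1
    refine (ENNReal.rpow_le_rpow h1 hq0.le).trans ?_
    rw [ENNReal.mul_rpow_of_nonneg _ _ hq0.le]
    refine mul_le_mul_right ?_ _
    refine holder_eta _ p (by exact_mod_cast hm') hp (fun x => ENNReal.ofReal (eta (m+1) ρ (y - f x))) (fun x => ENNReal.ofReal (a x)) K
      (fun x => ENNReal.ofReal |(A x).det|) (hem.comp measurable_prodMk_left) hK hdet hb ?_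
    have h2 : WD (ball x0 (4*r)) f A := fun ψ h1 h2 h3 => h.wd ψ h1 h2 (h3.trans (ball_subset_closedBall.trans hU))
    have h3 := area_ineq isOpen_ball measure_ball_lt_top.ne h2 hfc h.Am h.Ai hinj (fun z => ENNReal.ofReal (eta (m+1) ρ (y - z)))
    rw [eta_lintegral_sub hρ y] at h3
    refine le_trans ?_ h3
    simp only [mul_comm (ENNReal.ofReal (eta _ _ _))]
    exact lintegral_mono_set (closedBall_subset_ball (by linarith))
  refine (lintegral_mono hpt).trans ?_
  have hC5 : C5 m ≠ ⊤ := by unfold C5 K1; finiteness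
  have hC6 : C6 m ≠ ⊤ := by unfold C6; finiteness
  have hC7 : C7 m ≠ ⊤ := by unfold C7; finiteness
  rw [lintegral_const_mul']
  swap
  · apply ENNReal.rpow_ne_top_of_nonneg hq0.le; finiteness
  refine mul_le_mul_right ?_ _
  rw [lintegral_lintegral_swap]
  · refine lintegral_mono fun x => ?_
    simp only []
    have h3 : Measurable fun y => ENNReal.ofReal (eta (m+1) ρ (y - f x)) := hem.comp measurable_prodMk_right
    rw [lintegral_mul_const _ h3]
    have h4 : ∫⁻ y, ENNReal.ofReal (eta (m+1) ρ (y - f x)) = 1 := by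
      rw [lintegral_sub_right_eq_self (fun y => ENNReal.ofReal (eta (m+1) ρ y)), eta_lintegral hρ]
    rw [h4, one_mul]
  · exact (hem.mul ((hK.comp measurable_snd).pow_const _)).aemeasurable

end

section

def chi {n : ℕ} (x0 : Fin n → ℝ) (r : ℝ) (z : Fin n → ℝ) : ℝ := max 0 (min 1 (2 - ‖z - x0‖ / r))

lemma chi_cont {n : ℕ} (x0 : Fin n → ℝ) (r : ℝ) : Continuous (chi x0 r) := by
  unfold chi
  exact continuous_const.max (continuous_const.min (by fun_prop))

def uu {n : ℕ} (f : (Fin n → ℝ) → (Fin n → ℝ)) (x0 : Fin n → ℝ) (r : ℝ) (y : Fin n → ℝ) : ℝ :=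
  if h : ∃ z ∈ closedBall x0 (3*r), f z = y then chi x0 r h.choose else 0

lemma uu_f {n : ℕ} {f : (Fin n → ℝ) → (Fin n → ℝ)} {x0 : Fin n → ℝ} {r : ℝ} (hinj : InjOn f (closedBall x0 (3*r)))
    (z : Fin n → ℝ) (hz : z ∈ closedBall x0 (3*r)) : uu f x0 r (f z) = chi x0 r z := by
  have h : ∃ z' ∈ closedBall x0 (3*r), f z' = f z := ⟨z, hz, rfl⟩
  rw [uu, dif_pos h]
  congr 1
  exact hinj h.choose_spec.1 hz h.choose_spec.2

lemma uu_cases {n : ℕ} {f : (Fin n → ℝ) → (Fin n → ℝ)} {x0 : Fin n → ℝ} {r : ℝ} (y : Fin n → ℝ) (hy : uu f x0 r y ≠ 0) :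
    ∃ z ∈ closedBall x0 (3*r), f z = y ∧ uu f x0 r y = chi x0 r z := by
  by_cases h : ∃ z ∈ closedBall x0 (3*r), f z = y
  · exact ⟨h.choose, h.choose_spec.1, h.choose_spec.2, by rw [uu, dif_pos h]⟩
  · rw [uu, dif_neg h] at hy; exact absurd rfl hy

lemma chi_pos {n : ℕ} {x0 : Fin n → ℝ} {r : ℝ} (hr : 0 < r) {z : Fin n → ℝ} (h : 0 < chi x0 r z) : z ∈ ball x0 (2*r) := by
  unfold chi at h
  rcases lt_max_iff.1 h with h | h
  · exact absurd h (lt_irrefl _)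
  · have := (lt_min_iff.1 h).2
    rw [mem_ball, dist_eq_norm]
    rw [sub_pos, div_lt_iff₀ hr] at this
    exact this

lemma uu_nonneg {n : ℕ} {f : (Fin n → ℝ) → (Fin n → ℝ)} {x0 : Fin n → ℝ} {r : ℝ} (y : Fin n → ℝ) : 0 ≤ uu f x0 r y := by
  unfold uu; split_ifs
  · exact le_max_left _ _
  · exact le_rfl

lemma uu_uf {n : ℕ} {f : (Fin n → ℝ) → (Fin n → ℝ)} {x0 : Fin n → ℝ} {r : ℝ} (hr : 0 < r) (hf : Continuous f)
    (hinj : InjOn f (closedBall x0 (3*r))) (hop : ∀ V ⊆ ball x0 (3*r), IsOpen V → IsOpen (f '' V)) :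
    UF f x0 r (uu f x0 r) := by
  refine ⟨?_, uu_nonneg, ?_, ?_⟩
  · rw [continuous_iff_lower_upperSemicontinuous]
    constructor
    · rw [lowerSemicontinuous_iff_isOpen_preimage]
      intro c
      by_cases hc : c < 0
      · convert isOpen_univ
        ext y; simpa using hc.trans_le (uu_nonneg y)
      · push Not at hc
        have : uu f x0 r ⁻¹' Ioi c = f '' (ball x0 (3*r) ∩ {z | c < chi x0 r z}) := by
          ext y; constructor
          · intro hy
            have hy : c < uu f x0 r y := hy
            obtain ⟨z, hz, rfl, h2⟩ := uu_cases y (by linarith)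
            rw [h2] at hy
            exact ⟨z, ⟨ball_subset_ball (by linarith) (chi_pos hr (by linarith)), hy⟩, rfl⟩
          · rintro ⟨z, ⟨hz, hc⟩, rfl⟩
            show c < uu f x0 r (f z)
            rw [uu_f hinj z (ball_subset_closedBall hz)]; exact hc
        rw [this]
        exact hop _ inter_subset_left (isOpen_ball.inter (isOpen_lt continuous_const (chi_cont x0 r)))
    · rw [upperSemicontinuous_iff_isClosed_preimage]
      intro c
      by_cases hc : c ≤ 0
      · convert isClosed_univ
        ext y; simpa using hc.trans (uu_nonneg y)
      · push Not at hc
        have : uu f x0 r ⁻¹' Ici c = f '' (closedBall x0 (3*r) ∩ {z | c ≤ chi x0 r z}) := by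
          ext y; constructor
          · intro hy
            have hy : c ≤ uu f x0 r y := hy
            obtain ⟨z, hz, rfl, h2⟩ := uu_cases y (by linarith)
            rw [h2] at hy
            exact ⟨z, ⟨hz, hy⟩, rfl⟩
          · rintro ⟨z, ⟨hz, hc⟩, rfl⟩
            show c ≤ uu f x0 r (f z)
            rw [uu_f hinj z hz]; exact hc
        rw [this]
        exact (((isCompact_closedBall x0 (3*r)).inter_right (isClosed_le continuous_const (chi_cont x0 r))).image hf).isClosed
  · intro y
    by_cases hy : uu f x0 r y = 0
    · rw [hy]; exact zero_le_one
    · obtain ⟨z, hz, rfl, h2⟩ := uu_cases y hy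
      rw [h2, chi]; exact max_le zero_le_one (min_le_left _ _)
  · intro y h0 h1
    obtain ⟨z, hz, hfz, h2⟩ := uu_cases y h0.ne'
    rw [h2] at h0 h1
    refine ⟨z, ball_subset_closedBall (chi_pos hr h0), hfz, ?_⟩
    rw [h2]
    have : chi x0 r z = 2 - ‖z - x0‖ / r := by
      unfold chi at h0 h1 ⊢
      rcases le_total 1 (2 - ‖z - x0‖ / r) with h | h
      · rw [min_eq_left h] at h1; simp at h1
      · rw [min_eq_right h] at h0 h1 ⊢
        rcases lt_max_iff.1 h0 with h' | h'
        · exact absurd h' (lt_irrefl _)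
        · exact max_eq_right h'.le
    rw [this]; field_simp; ring

lemma uu_one {n : ℕ} {f : (Fin n → ℝ) → (Fin n → ℝ)} {x0 : Fin n → ℝ} {r : ℝ} (hr : 0 < r)
    (hinj : InjOn f (closedBall x0 (3*r))) (z : Fin n → ℝ) (hz : z ∈ closedBall x0 r) : uu f x0 r (f z) = 1 := by
  rw [uu_f hinj z (closedBall_subset_closedBall (by linarith) hz), chi]
  have : ‖z - x0‖ / r ≤ 1 := by
    rw [div_le_one hr, ← dist_eq_norm]; exact hz
  rw [min_eq_left (by linarith)]; simp

lemma uu_zero {n : ℕ} {f : (Fin n → ℝ) → (Fin n → ℝ)} {x0 : Fin n → ℝ} {r : ℝ} (hr : 0 < r)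
    (y : Fin n → ℝ) (hy : y ∉ f '' closedBall x0 (2*r)) : uu f x0 r y = 0 := by
  by_contra h
  obtain ⟨z, hz, hfz, h2⟩ := uu_cases y h
  have := (uu_nonneg (f := f) (x0 := x0) (r := r) y).lt_of_ne' h
  rw [h2] at this
  exact hy ⟨z, ball_subset_closedBall (chi_pos hr this), hfz⟩

end

section

variable {m : ℕ} {U : Set (Fin (m+1) → ℝ)} {f : (Fin (m+1) → ℝ) → (Fin (m+1) → ℝ)}
    {A : (Fin (m+1) → ℝ) → (Fin (m+1) → ℝ) →L[ℝ] (Fin (m+1) → ℝ)} {a : (Fin (m+1) → ℝ) → ℝ} {φ : ℝ → ℝ}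

def kk (m : ℕ) (q : ℝ) : ℝ := 12 * (12:ℝ) ^ ((m:ℝ) - m / q) / (1 - m / q) / 6 ^ m

lemma slice_cap (hm : 1 ≤ m) {q : ℝ} (hq : (m:ℝ) < q) {g : (Fin (m+1) → ℝ) → ℝ} (hg : ContDiff ℝ 1 g)
    (y0 : Fin (m+1) → ℝ) (W : ℝ) (hW : 0 < W) (i : Fin (m+1)) (t : ℝ) (w1 w2 : Fin m → ℝ)
    (h1 : w1 ∈ closedBall (prj i y0) (3*W)) (h2 : w2 ∈ closedBall (prj i y0) (3*W))
    (hg1 : g (ins i t w1) = 1) (hg2 : g (ins i t w2) = 0) :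
    1 ≤ ENNReal.ofReal (kk m q ^ q * W ^ (q - m)) *
      ∫⁻ w in closedBall (prj i y0) (3*W), ‖fderiv ℝ g (ins i t w)‖ₑ ^ q := by
  have hm0 : (1:ℝ) ≤ m := by exact_mod_cast hm
  have hq0 : 0 < q := by linarith
  have hmq : 0 < 1 - m / q := by rw [sub_pos, div_lt_one hq0]; exact hq
  have hmeas : Measurable fun w => ‖fderiv ℝ g (ins i t w)‖ₑ := by
    have h3 : Continuous fun w => fderiv ℝ g (ins i t w) :=
      (hg.continuous_fderiv (by simp)).comp ((ins_cont i).comp (by fun_prop : Continuous fun w : Fin m → ℝ => (t, w)))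
    exact h3.enorm.measurable
  have hosc := osc_le_pot (fun w => g (ins i t w)) (hg.comp (ins_contDiff i t)) (prj i y0) w1 w2 (3*W) (by positivity) h1 h2
    (fun w => ‖fderiv ℝ g (ins i t w)‖ₑ) hmeas (by
      intro w _
      have h4 : HasFDerivAt g (fderiv ℝ g (ins i t w)) (ins i t w) := (hg.differentiable (by simp) _).hasFDerivAt
      have h5 := (h4.comp w (ins_fderiv i t w)).fderiv
      have h6 : (fun w => g (ins i t w)) = g ∘ fun w => ins i t w := rfl
      rw [h6, h5, enorm_le_iff_norm_le]
      refine (ContinuousLinearMap.opNorm_comp_le _ _).trans ?_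
      exact mul_le_of_le_one_right (norm_nonneg _) (insL_norm i))
  set G := ∫⁻ w in closedBall (prj i y0) (3*W), ‖fderiv ℝ g (ins i t w)‖ₑ ^ q with hG
  have hp := fun z => pot_morrey hm hq (3*W) (by positivity) (closedBall (prj i y0) (3*W)) _ hmeas z
  rw [hg1, hg2, sub_zero, enorm_one, mul_one] at hosc
  have h7 := hosc.trans (mul_le_mul_right (add_le_add (hp w1) (hp w2)) _)
  set P := (4 * (3*W)) ^ ((m:ℝ) - m / q) / (1 - m / q) with hP
  have hP0 : 0 < P := by positivity
  have h8 : ENNReal.ofReal ((2 * (3*W)) ^ m) ≤ ENNReal.ofReal ((2 * (3*W)) ^ m) * (ENNReal.ofReal (kk m q * W ^ (1 - m/q)) * G ^ (1/q)) := by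
    refine h7.trans (le_of_eq ?_)
    rw [← mul_assoc (ENNReal.ofReal ((2 * (3*W)) ^ m)), ← ENNReal.ofReal_mul (by positivity)]
    have h9 : (2 * (3*W)) ^ m * (kk m q * W ^ (1 - m/q)) = 2 * (2 * (3 * W)) * P := by
      rw [hP, kk]
      have e1 : 4 * (3 * W) = 12 * W := by ring
      rw [e1, Real.mul_rpow (by norm_num) hW.le]
      have e2 : W ^ ((m:ℝ) - m / q) * W = W ^ m * W ^ (1 - m / q) := by
        rw [← Real.rpow_natCast W m, ← Real.rpow_add hW, ← Real.rpow_add_one hW.ne']; congr 1; ring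
      have e3 : (2 * (3 * W)) ^ m = 6 ^ m * W ^ m := by rw [← mul_pow]; congr 1; ring
      rw [e3]
      have : 2 * (2 * (3 * W)) * (12 ^ ((m:ℝ) - m / q) * W ^ ((m:ℝ) - m / q) / (1 - m / q)) =
        12 * 12 ^ ((m:ℝ) - m / q) / (1 - m / q) * (W ^ ((m:ℝ) - m / q) * W) := by ring
      rw [this, e2]
      field_simp
    have h10 : ENNReal.ofReal (2 * (2 * (3 * W)) * P) = 2 * (ENNReal.ofReal (2 * (3*W)) * ENNReal.ofReal P) := by
      rw [ENNReal.ofReal_mul (by positivity), ENNReal.ofReal_mul (by norm_num), ENNReal.ofReal_ofNat, mul_assoc]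
    rw [h9, h10, ← hG]
    generalize ENNReal.ofReal (2 * (3*W)) = X
    ring
  have hv0 : ENNReal.ofReal ((2 * (3*W)) ^ m) ≠ 0 := by rw [Ne, ENNReal.ofReal_eq_zero, not_le]; positivity
  nth_rewrite 1 [← mul_one (ENNReal.ofReal ((2 * (3*W)) ^ m))] at h8
  rw [ENNReal.mul_le_mul_iff_right hv0 ENNReal.ofReal_ne_top] at h8
  have h10 := ENNReal.rpow_le_rpow h8 hq0.le
  rw [ENNReal.one_rpow, ENNReal.mul_rpow_of_nonneg _ _ hq0.le, ← ENNReal.rpow_mul, one_div_mul_cancel hq0.ne', ENNReal.rpow_one] at h10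
  have hk0 : 0 < kk m q := by unfold kk; positivity
  rw [ENNReal.ofReal_rpow_of_nonneg (by positivity) hq0.le, Real.mul_rpow hk0.le (by positivity), ← Real.rpow_mul hW.le] at h10
  have h11 : (1 - m / q) * q = q - m := by field_simp
  rwa [h11] at h10

def C8 (m : ℕ) (q : ℝ) : ℝ≥0∞ := ENNReal.ofReal (kk m q ^ q) * C7 m ^ q

lemma cap (h : Core m U f A a φ) (x0 : Fin (m+1) → ℝ) (r : ℝ) (hr : 0 < r) (hU : closedBall x0 (4*r) ⊆ U)
    (hinj : InjOn f (ball x0 (4*r))) (hop : ∀ V ⊆ ball x0 (4*r), IsOpen V → IsOpen (f '' V))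
    (p : ℝ) (hp : (m:ℝ) < p) (hq : (m:ℝ) < p / (p - m))
    (K : (Fin (m+1) → ℝ) → ℝ≥0∞) (hK : Measurable K)
    (hb : ∀ᵐ x ∂volume.restrict (closedBall x0 (3*r)), ENNReal.ofReal (a x) ^ p ≤ K x * ENNReal.ofReal |(A x).det|)
    (W : ℝ) (hW0 : 0 < W) (hW : ∀ z ∈ closedBall x0 (2*r), ‖f z - f x0‖ ≤ W)
    (z1 : Fin (m+1) → ℝ) (hz1 : z1 ∈ closedBall x0 (r/2)) :
    ENNReal.ofReal ‖f z1 - f x0‖ ≤ C8 m (p/(p-m)) * (ENNReal.ofReal (W ^ (p/(p-m) - m)) * (ENNReal.ofReal (1/r) ^ (p/(p-m)) *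
      ∫⁻ x in closedBall x0 (3*r), K x ^ ((m:ℝ) / (p - m)))) := by
  have hfc := h.uc.continuous
  have hm := h.hm
  set q := p/(p-m) with hqd
  have hm0 : (2:ℝ) ≤ m := by exact_mod_cast hm
  have hq0 : 0 < q := by linarith
  have hinj3 : InjOn f (closedBall x0 (3*r)) := hinj.mono (closedBall_subset_ball (by linarith))
  have hu := uu_uf hr hfc hinj3 (fun V hV => hop V (hV.trans (ball_subset_ball (by linarith))))
  set u := uu f x0 r with hud
  -- rho
  obtain ⟨δ, hδ, hδ'⟩ := ((isCompact_closedBall x0 (r/2)).image hfc).exists_thickening_subset_open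
    (hop (ball x0 r) (ball_subset_ball (by linarith)) isOpen_ball)
    (image_mono (closedBall_subset_ball (by linarith)))
  set ρ := min δ W with hρd
  have hρ : 0 < ρ := lt_min hδ hW0
  have hen := energy h x0 r hr hU hinj hu hρ p hp K hK hb
  have hcd : ContDiff ℝ 1 (moll ρ u) := (moll_contDiff hρ u hu.cont.locallyIntegrable).of_le (by exact_mod_cast le_top)
  have hg1 : ∀ z ∈ closedBall x0 (r/2), moll ρ u (f z) = 1 := by
    intro z hz
    have h1 : u (f z) = 1 := uu_one hr hinj3 z (closedBall_subset_closedBall (by linarith) hz)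
    have h2 := moll_close hρ u hu.cont.aestronglyMeasurable (f z) 0 (by
      intro y hy
      have hy' : y ∈ f '' ball x0 r := by
        apply hδ'
        rw [mem_thickening_iff]
        exact ⟨f z, ⟨z, hz, rfl⟩, lt_of_lt_of_le hy (min_le_left _ _)⟩
      obtain ⟨z', hz', rfl⟩ := hy'
      rw [h1, hud, uu_one hr hinj3 z' (ball_subset_closedBall hz'), dist_self])
    rw [dist_le_zero.1 h2, h1]
  have hg0 : ∀ y, 2 * W ≤ dist y (f x0) → moll ρ u y = 0 := by
    intro y hy
    have h0 : ∀ y' ∈ ball y ρ, u y' = 0 := by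
      intro y' hy'
      apply uu_zero hr
      rintro ⟨z, hz, rfl⟩
      have h1 := hW z hz
      rw [← dist_eq_norm] at h1
      have h2 : dist (f z) y < W := lt_of_lt_of_le hy' (min_le_right _ _)
      have h3 := dist_triangle_left y (f x0) (f z)
      linarith
    have h1 := h0 y (mem_ball_self hρ)
    have h2 := moll_close hρ u hu.cont.aestronglyMeasurable y 0 (fun y' hy' => by rw [h0 y' hy', h1, dist_self])
    rw [dist_le_zero.1 h2, h1]
  -- coordinate
  obtain ⟨i, -, hi⟩ := Finset.exists_max_image (Finset.univ : Finset (Fin (m+1))) (fun j => ‖(f z1 - f x0) j‖) ⟨0, Finset.mem_univ _⟩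
  have hin : ‖f z1 - f x0‖ = |f z1 i - f x0 i| := by
    apply le_antisymm
    · rw [pi_norm_le_iff_of_nonneg (abs_nonneg _)]
      intro j; exact hi j (Finset.mem_univ _)
    · exact norm_le_pi_norm (f z1 - f x0) i
  have hball : ∀ z ∈ closedBall x0 (r/2), f z ∈ closedBall (f x0) W := fun z hz => by
    rw [mem_closedBall, dist_eq_norm]; exact hW z (closedBall_subset_closedBall (by linarith) hz)
  have hslice : ∀ t ∈ uIcc (f x0 i) (f z1 i), t ∈ closedBall (f x0 i) (3*W) ∧ 1 ≤ ENNReal.ofReal (kk m q ^ q * W ^ (q - m)) *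
      ∫⁻ w in closedBall (prj i (f x0)) (3*W), ‖fderiv ℝ (moll ρ u) (ins i t w)‖ₑ ^ q := by
    intro t ht
    have hpc : IsPreconnected (closedBall x0 (r/2)) := (convex_closedBall x0 (r/2)).isPreconnected
    have hfi : ContinuousOn (fun z => f z i) (closedBall x0 (r/2)) := ((continuous_apply i).comp hfc).continuousOn
    have hx0 : x0 ∈ closedBall x0 (r/2) := mem_closedBall_self (by positivity)
    have ht' : t ∈ (fun z => f z i) '' closedBall x0 (r/2) := by
      have hoc := (hpc.image _ hfi).ordConnected
      exact hoc.uIcc_subset ⟨x0, hx0, rfl⟩ ⟨z1, hz1, rfl⟩ ht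
    obtain ⟨z, hz, rfl⟩ := ht'
    have hzW := mem_closedBall.1 (hball z hz)
    constructor
    · rw [mem_closedBall]
      exact (dist_le_pi_dist (f z) (f x0) i).trans (by linarith)
    · refine slice_cap (by omega) hq hcd (f x0) W hW0 i _ (prj i (f z)) (fun k => prj i (f x0) k + 3 * W) ?_ ?_ ?_ ?_
      · rw [mem_closedBall, dist_pi_le_iff (by positivity)]
        intro k
        exact (dist_le_pi_dist (f z) (f x0) _).trans (by linarith)
      · rw [mem_closedBall, dist_pi_le_iff (by positivity)]
        intro k
        rw [Real.dist_eq, add_sub_cancel_left, abs_of_pos (by positivity)]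
      · show moll ρ u (ins i (f z i) (prj i (f z))) = 1
        rw [ins_eta]; exact hg1 z hz
      · apply hg0
        have hk : 0 < m := by omega
        refine le_trans ?_ (dist_le_pi_dist _ _ (i.succAbove ⟨0, hk⟩))
        rw [ins_succ, Real.dist_eq]
        show _ ≤ |f x0 _ + 3 * W - f x0 _|
        rw [add_sub_cancel_left, abs_of_pos (by positivity)]
        linarith
  have hGm : Measurable fun y => ‖fderiv ℝ (moll ρ u) y‖ₑ ^ q :=
    ((hcd.continuous_fderiv (by simp)).enorm.measurable).pow_const q
  have hkk : 0 < kk m q := by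
    have : 0 < 1 - m / q := by rw [sub_pos, div_lt_one hq0]; exact hq
    unfold kk; positivity
  calc ENNReal.ofReal ‖f z1 - f x0‖ = volume (uIcc (f x0 i) (f z1 i)) := by
        rw [hin, Real.volume_interval]
    _ = ∫⁻ t in uIcc (f x0 i) (f z1 i), 1 := by rw [setLIntegral_one]
    _ ≤ ∫⁻ t in uIcc (f x0 i) (f z1 i), ENNReal.ofReal (kk m q ^ q * W ^ (q - m)) *
      ∫⁻ w in closedBall (prj i (f x0)) (3*W), ‖fderiv ℝ (moll ρ u) (ins i t w)‖ₑ ^ q :=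
        setLIntegral_mono' measurableSet_uIcc fun t ht => (hslice t ht).2
    _ ≤ ∫⁻ t in closedBall (f x0 i) (3*W), ENNReal.ofReal (kk m q ^ q * W ^ (q - m)) *
      ∫⁻ w in closedBall (prj i (f x0)) (3*W), ‖fderiv ℝ (moll ρ u) (ins i t w)‖ₑ ^ q :=
        lintegral_mono_set fun t ht => (hslice t ht).1
    _ = ENNReal.ofReal (kk m q ^ q * W ^ (q - m)) * ∫⁻ y in closedBall (f x0) (3*W), ‖fderiv ℝ (moll ρ u) y‖ₑ ^ q := by
        rw [lintegral_const_mul' _ _ ENNReal.ofReal_ne_top, fub_cb i (fun y => ‖fderiv ℝ (moll ρ u) y‖ₑ ^ q) hGm (f x0) (3*W) (by positivity)]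
    _ ≤ ENNReal.ofReal (kk m q ^ q * W ^ (q - m)) * ((C7 m * ENNReal.ofReal (1/r)) ^ q * ∫⁻ x in closedBall x0 (3*r), K x ^ ((m:ℝ) / (p - m))) :=
        mul_le_mul_right ((setLIntegral_le_lintegral _ _).trans hen) _
    _ = _ := by
        rw [C8, ENNReal.ofReal_mul (by positivity), ENNReal.mul_rpow_of_nonneg _ _ hq0.le]
        ring

end

section

variable {m : ℕ} {U : Set (Fin (m+1) → ℝ)} {f : (Fin (m+1) → ℝ) → (Fin (m+1) → ℝ)}
    {A : (Fin (m+1) → ℝ) → (Fin (m+1) → ℝ) →L[ℝ] (Fin (m+1) → ℝ)} {a : (Fin (m+1) → ℝ) → ℝ} {φ : ℝ → ℝ}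

lemma iter {X : ℕ → ℝ} (hX : ∀ j, 0 < X j) {θ M : ℝ} (h0 : 0 < θ) (h1 : θ < 1) (hM : 0 < M)
    (hs : ∀ j, X (j+1) ≤ M * X j ^ θ) : ∃ N, ∀ j ≥ N, X j ≤ 2 * M ^ (1/(1-θ)) := by
  set L := M ^ (1/(1-θ)) with hL
  have hL0 : 0 < L := by positivity
  have h1' : 0 < 1 - θ := by linarith
  have hLM : M * L ^ θ = L := by
    rw [hL, ← Real.rpow_mul hM.le]
    nth_rewrite 1 [← Real.rpow_one M]
    rw [← Real.rpow_add hM]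
    congr 1
    field_simp
    ring
  set Y := max (X 0 / L) 1 with hY
  have hY0 : 1 ≤ Y := le_max_right _ _
  have hb : ∀ j, X j ≤ L * Y ^ (θ ^ j) := by
    intro j
    induction j with
    | zero =>
      rw [pow_zero, Real.rpow_one]
      have : X 0 / L ≤ Y := le_max_left _ _
      rw [div_le_iff₀ hL0] at this
      linarith
    | succ j ih =>
      refine (hs j).trans ?_
      have h2 : X j ^ θ ≤ (L * Y ^ (θ ^ j)) ^ θ := Real.rpow_le_rpow (hX j).le ih h0.le
      have h3 : (L * Y ^ (θ ^ j)) ^ θ = L ^ θ * Y ^ (θ ^ (j+1)) := by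
        rw [Real.mul_rpow hL0.le (by positivity), ← Real.rpow_mul (by positivity : 0 ≤ Y), pow_succ]
      rw [h3] at h2
      calc M * X j ^ θ ≤ M * (L ^ θ * Y ^ (θ ^ (j+1))) := by gcongr
        _ = M * L ^ θ * Y ^ (θ ^ (j+1)) := by ring
        _ = _ := by rw [hLM]
  have ht : Tendsto (fun j : ℕ => Y ^ (θ ^ j)) atTop (𝓝 1) := by
    have h2 := tendsto_pow_atTop_nhds_zero_of_lt_one h0.le h1
    have h3 := (Real.continuous_const_rpow (a := Y) (by linarith)).tendsto 0 |>.comp h2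
    rw [Real.rpow_zero] at h3
    exact h3
  obtain ⟨N, hN⟩ := eventually_atTop.1 (ht.eventually (ge_mem_nhds (by norm_num : (1:ℝ) < 2)))
  refine ⟨N, fun j hj => (hb j).trans ?_⟩
  have := hN j hj
  nlinarith

lemma C8_fin (m : ℕ) (q : ℝ) (hq : 0 ≤ q) : C8 m q ≠ ⊤ := by
  have hC5 : C5 m ≠ ⊤ := by unfold C5 K1; finiteness
  have hC6 : C6 m ≠ ⊤ := by unfold C6; finiteness
  have h7 : C7 m ≠ ⊤ := by unfold C7; finiteness
  unfold C8
  exact ENNReal.mul_ne_top ENNReal.ofReal_ne_top (ENNReal.rpow_ne_top_of_nonneg hq h7)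

def M9 (m : ℕ) (q Λ : ℝ) : ℝ := 2 * 2 ^ (q - m) * ((C8 m q).toReal + 1) * Λ

lemma grow (h : Core m U f A a φ) (x0 : Fin (m+1) → ℝ) (R : ℝ) (hR : 0 < R) (hU : closedBall x0 R ⊆ U)
    (hinj : InjOn f (ball x0 R)) (hop : ∀ V ⊆ ball x0 R, IsOpen V → IsOpen (f '' V))
    (p : ℝ) (hp : (m:ℝ) < p) (hq : (m:ℝ) < p / (p - m)) (hq1 : p / (p - m) < m + 1)
    (K : (Fin (m+1) → ℝ) → ℝ≥0∞) (hK : Measurable K)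
    (hb : ∀ᵐ x ∂volume.restrict (closedBall x0 R), ENNReal.ofReal (a x) ^ p ≤ K x * ENNReal.ofReal |(A x).det|)
    (Λ : ℝ) (hΛ0 : 0 < Λ) (hΛ : ∀ r, 0 < r → 4 * r ≤ R → ∫⁻ x in closedBall x0 (3*r), K x ^ ((m:ℝ) / (p - m)) ≤ ENNReal.ofReal (Λ * r ^ (m+1))) :
    ∃ s > 0, ∀ x ∈ closedBall x0 s, ‖f x - f x0‖ ≤ 8 * M9 m (p / (p-m)) Λ ^ (1/(1-(p / (p-m) - m))) * ‖x - x0‖ := by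
  have hfc := h.uc.continuous
  set q := p / (p - m) with hqd
  have hq0 : 0 < q := by have : (0:ℝ) ≤ m := by positivity
                         linarith
  set θ := q - m with hθ
  have hθ0 : 0 < θ := by linarith
  have hθ1 : θ < 1 := by linarith
  set ω : ℝ → ℝ := fun s => sSup ((fun x => ‖f x - f x0‖) '' closedBall x0 s) with hω
  have hcomp : ∀ s, IsCompact ((fun x => ‖f x - f x0‖) '' closedBall x0 s) := fun s =>
    (isCompact_closedBall x0 s).image (by fun_prop)
  have hle : ∀ s, ∀ z ∈ closedBall x0 s, ‖f z - f x0‖ ≤ ω s := fun s z hz =>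
    le_csSup (hcomp s).bddAbove ⟨z, hz, rfl⟩
  have hatt : ∀ s, 0 ≤ s → ∃ z ∈ closedBall x0 s, ‖f z - f x0‖ = ω s := fun s hs => by
    obtain ⟨z, hz, hz'⟩ := (hcomp s).sSup_mem ⟨_, ⟨x0, mem_closedBall_self hs, rfl⟩⟩
    exact ⟨z, hz, hz'⟩
  have hpos : ∀ s, 0 < s → s < R → 0 < ω s := by
    intro s hs hsR
    have hd : dist (x0 + fun _ => s) x0 = s := by
      rw [dist_eq_norm, add_sub_cancel_left, pi_norm_const, Real.norm_eq_abs, abs_of_pos hs]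
    have h1 : (x0 + fun _ => s) ∈ closedBall x0 s := hd.le
    refine lt_of_lt_of_le ?_ (hle s _ h1)
    rw [norm_pos_iff, sub_ne_zero]
    intro he
    have := hinj (by rw [mem_ball, hd]; exact hsR) (mem_ball_self hR) he
    rw [this, dist_self] at hd
    exact hs.ne hd
  set M := M9 m q Λ with hMd
  have hc8 := C8_fin m q hq0.le
  have hM0 : 0 < M := by rw [hMd, M9]; have : 0 ≤ (C8 m q).toReal := ENNReal.toReal_nonneg
                         positivity
  have hstep : ∀ r, 0 < r → 4 * r ≤ R → ω (r/2) / (r/2) ≤ M * (ω (2*r) / (2*r)) ^ θ := by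
    intro r hr hrR
    obtain ⟨z, hz, hz'⟩ := hatt (r/2) (by positivity)
    have hω2 := hpos (2*r) (by positivity) (by linarith)
    have h1 := cap h x0 r hr ((closedBall_subset_closedBall hrR).trans hU) (hinj.mono (ball_subset_ball hrR))
      (fun V hV => hop V (hV.trans (ball_subset_ball hrR))) p hp hq K hK
      (ae_restrict_of_ae_restrict_of_subset (closedBall_subset_closedBall (by linarith)) hb) (ω (2*r)) hω2 (hle (2*r)) z hz
    rw [hz', ← hqd] at h1
    have h2 := h1.trans (mul_le_mul_right (mul_le_mul_right (mul_le_mul_right (hΛ r hr hrR) _) _) _)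
    rw [ENNReal.ofReal_rpow_of_nonneg (by positivity) hq0.le, ← ENNReal.ofReal_mul (by positivity),
      ← ENNReal.ofReal_mul (by positivity), ← ENNReal.ofReal_toReal hc8, ← ENNReal.ofReal_mul ENNReal.toReal_nonneg,
      ENNReal.ofReal_le_ofReal_iff (by positivity), ← hθ] at h2
    have h3 : (C8 m q).toReal * (ω (2*r) ^ θ * ((1/r) ^ q * (Λ * r ^ (m+1)))) ≤
       ((C8 m q).toReal + 1) * (ω (2*r) ^ θ * ((1/r) ^ q * (Λ * r ^ (m+1)))) := by gcongr; linarith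
    rw [div_le_iff₀ (by positivity)]
    refine h2.trans (h3.trans (le_of_eq ?_))
    rw [hMd, M9, Real.div_rpow hω2.le (by positivity), Real.mul_rpow (by norm_num) hr.le, one_div, Real.inv_rpow hr.le, ← hθ]
    have h4 : r ^ q = r ^ θ * r ^ m := by
      rw [← Real.rpow_natCast r m, ← Real.rpow_add hr, hθ]; congr 1; ring
    rw [h4]
    field_simp
    ring
  set s0 := R / 4 with hs0
  have hs00 : 0 < s0 := by positivity
  obtain ⟨N, hN⟩ := iter (X := fun j => ω (s0 * (1/4)^j) / (s0 * (1/4)^j)) (fun j => by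
    have hj : ((1:ℝ)/4)^j ≤ 1 := pow_le_one₀ (by norm_num) (by norm_num)
    have hj0 : 0 < ((1:ℝ)/4)^j := by positivity
    exact div_pos (hpos _ (by positivity) (by nlinarith)) (by positivity)) hθ0 hθ1 hM0 (fun j => by
    have hj : ((1:ℝ)/4)^j ≤ 1 := pow_le_one₀ (by norm_num) (by norm_num)
    have h1 := hstep (s0 * (1/4)^j / 2) (by positivity) (by nlinarith)
    have e1 : s0 * (1/4)^j / 2 / 2 = s0 * (1/4)^(j+1) := by rw [pow_succ]; ring
    have e2 : 2 * (s0 * (1/4)^j / 2) = s0 * (1/4)^j := by ring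
    rw [e1, e2] at h1
    exact h1)
  refine ⟨s0 * (1/4)^N, by positivity, fun x hx => ?_⟩
  by_cases hxx : x = x0
  · subst hxx; simp
  have hd0 : 0 < ‖x - x0‖ := by rwa [norm_pos_iff, sub_ne_zero]
  rw [mem_closedBall, dist_eq_norm] at hx
  have hN1 : ((1:ℝ)/4)^N ≤ 1 := pow_le_one₀ (by norm_num) (by norm_num)
  have hxN : ‖x - x0‖ / s0 ≤ (1/4)^N := by rw [div_le_iff₀ hs00]; linarith
  obtain ⟨j, hj1, hj2⟩ := exists_nat_pow_near_of_lt_one (x := ‖x - x0‖ / s0) (y := (1:ℝ)/4) (by positivity) (hxN.trans hN1) (by norm_num) (by norm_num)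
  have hjN : N ≤ j := by
    have := (pow_lt_pow_iff_right_of_lt_one₀ (by norm_num : (0:ℝ) < 1/4) (by norm_num)).1 (hj1.trans_le hxN)
    omega
  have h1 := hN j hjN
  rw [div_le_iff₀ (by positivity)] at h1
  have h2 := hle (s0 * (1/4)^j) x (by rw [mem_closedBall, dist_eq_norm]; rw [div_le_iff₀ hs00] at hj2; linarith)
  rw [lt_div_iff₀ hs00, pow_succ] at hj1
  have h3 : s0 * (1/4)^j ≤ 4 * ‖x - x0‖ := by linarith
  have h4 : 0 < M ^ (1/(1-θ)) := by positivity
  calc ‖f x - f x0‖ ≤ _ := h2.trans h1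
    _ ≤ 2 * M ^ (1/(1-θ)) * (4 * ‖x - x0‖) := by gcongr
    _ = _ := by ring

end

section

variable {m : ℕ}

def ee (m : ℕ) : Eucl (m+1) ≃L[ℝ] (Fin (m+1) → ℝ) := PiLp.continuousLinearEquiv 2 ℝ (fun _ : Fin (m+1) => ℝ)

lemma ee_apply (x : Eucl (m+1)) (i : Fin (m+1)) : ee m x i = x i := rfl
lemma ees_apply (x : Fin (m+1) → ℝ) (i : Fin (m+1)) : (ee m).symm x i = x i := rfl

lemma ee_mp : MeasurePreserving (ee m) := PiLp.volume_preserving_ofLp (Fin (m+1))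
lemma ees_mp : MeasurePreserving (ee m).symm := PiLp.volume_preserving_toLp (Fin (m+1))
lemma ee_me : MeasurableEmbedding (ee m) := (ee m).toHomeomorph.measurableEmbedding
lemma ees_me : MeasurableEmbedding (ee m).symm := (ee m).symm.toHomeomorph.measurableEmbedding

lemma ee_norm (x : Eucl (m+1)) : ‖ee m x‖ ≤ ‖x‖ := by
  rw [pi_norm_le_iff_of_nonneg (norm_nonneg _)]
  intro i
  exact PiLp.norm_apply_le x i

lemma ee_norm' (x : Eucl (m+1)) : ‖x‖ ≤ (m+1) * ‖ee m x‖ := by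
  rw [EuclideanSpace.norm_eq]
  apply Real.sqrt_le_iff.2 ⟨by positivity, ?_⟩
  calc ∑ i, ‖x i‖ ^ 2 ≤ ∑ i : Fin (m+1), ‖ee m x‖ ^ 2 := by
        apply Finset.sum_le_sum
        intro i _
        have := norm_le_pi_norm (ee m x) i
        rw [ee_apply] at this
        gcongr
    _ = (m+1) * ‖ee m x‖ ^ 2 := by simp
    _ ≤ _ := by
        rw [mul_pow]
        have : (1:ℝ) ≤ m + 1 := by linarith [(Nat.cast_nonneg m : (0:ℝ) ≤ m)]
        gcongr
        nlinarith

def cj (L : Eucl (m+1) →L[ℝ] Eucl (m+1)) : (Fin (m+1) → ℝ) →L[ℝ] (Fin (m+1) → ℝ) :=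
  (ee m : Eucl (m+1) →L[ℝ] (Fin (m+1) → ℝ)) ∘L L ∘L ((ee m).symm : (Fin (m+1) → ℝ) →L[ℝ] Eucl (m+1))

lemma cj_apply (L : Eucl (m+1) →L[ℝ] Eucl (m+1)) (v) : cj L v = ee m (L ((ee m).symm v)) := rfl

lemma cj_det (L : Eucl (m+1) →L[ℝ] Eucl (m+1)) : (cj L).det = L.det :=
  LinearMap.det_conj (L : Eucl (m+1) →ₗ[ℝ] Eucl (m+1)) (ee m).toLinearEquiv

lemma cj_cont : Continuous (cj : (Eucl (m+1) →L[ℝ] Eucl (m+1)) → _) := by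
  unfold cj
  fun_prop

lemma le_frob (L : Eucl (m+1) →L[ℝ] Eucl (m+1)) (i j) : |L (EuclideanSpace.single j 1) i| ≤ frobNorm L := by
  unfold frobNorm
  apply Real.abs_le_sqrt
  refine le_trans ?_ (Finset.single_le_sum (f := fun i => ∑ j, (L (EuclideanSpace.single j 1) i) ^ 2) (fun i _ => Finset.sum_nonneg fun j _ => sq_nonneg _) (Finset.mem_univ i))
  exact Finset.single_le_sum (f := fun j => (L (EuclideanSpace.single j 1) i) ^ 2) (fun j _ => sq_nonneg _) (Finset.mem_univ j)

lemma frob_nonneg (L : Eucl (m+1) →L[ℝ] Eucl (m+1)) : 0 ≤ frobNorm L := Real.sqrt_nonneg _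

lemma frob_zero : frobNorm (0 : Eucl (m+1) →L[ℝ] Eucl (m+1)) = 0 := by simp [frobNorm]

lemma frob_le (L : Eucl (m+1) →L[ℝ] Eucl (m+1)) : frobNorm L ≤ (m+1) * ‖L‖ := by
  unfold frobNorm
  apply Real.sqrt_le_iff.2 ⟨by positivity, ?_⟩
  calc _ ≤ ∑ i : Fin (m+1), ∑ j : Fin (m+1), ‖L‖ ^ 2 := by
        apply Finset.sum_le_sum; intro i _
        apply Finset.sum_le_sum; intro j _
        rw [← sq_abs]
        have h1 : |L (EuclideanSpace.single j 1) i| ≤ ‖L (EuclideanSpace.single j 1)‖ := by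
          rw [← Real.norm_eq_abs]; exact PiLp.norm_apply_le (L (EuclideanSpace.single j 1)) i
        have h2 := L.le_opNorm (EuclideanSpace.single j 1)
        rw [EuclideanSpace.norm_single, norm_one, mul_one] at h2
        have := h1.trans h2
        gcongr
    _ = _ := by simp; ring

lemma cj_norm (L : Eucl (m+1) →L[ℝ] Eucl (m+1)) : ‖cj L‖ ≤ (m+1) * frobNorm L := by
  have hf := frob_nonneg L
  apply ContinuousLinearMap.opNorm_le_bound _ (by positivity)
  intro v
  rw [pi_norm_le_iff_of_nonneg (by positivity)]
  intro i
  have hv : (ee m).symm v = ∑ j, v j • (EuclideanSpace.single j (1:ℝ) : Eucl (m+1)) := by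
    ext k
    simp [ees_apply, Pi.single_apply]
  rw [cj_apply, ee_apply, hv, map_sum]
  have h1 : (∑ j, L (v j • (EuclideanSpace.single j (1:ℝ) : Eucl (m+1)))) i = ∑ j, v j * L (EuclideanSpace.single j (1:ℝ)) i := by
    simp
  rw [h1]
  refine (norm_sum_le _ _).trans ?_
  calc _ ≤ ∑ j : Fin (m+1), ‖v‖ * frobNorm L := by
        apply Finset.sum_le_sum; intro j _
        rw [norm_mul]
        exact mul_le_mul (norm_le_pi_norm v j) (le_frob L i j) (norm_nonneg _) (norm_nonneg _)
    _ = _ := by simp; ring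

lemma frob_cont : Continuous (frobNorm : (Eucl (m+1) →L[ℝ] Eucl (m+1)) → ℝ) := by
  unfold frobNorm
  fun_prop

lemma det_cont : Continuous (fun L : (Eucl (m+1) →L[ℝ] Eucl (m+1)) => L.det) :=
  ContinuousLinearMap.continuous_det

lemma dist_meas (p : ℝ) (B : Eucl (m+1) → Eucl (m+1) →L[ℝ] Eucl (m+1)) (hB : Measurable B) :
    Measurable (distortionKp p B) := by
  unfold distortionKp
  have hd : Measurable fun x => (B x).det := det_cont.measurable.comp hB
  refine Measurable.ite ?_ ?_ (Measurable.ite ?_ measurable_const measurable_const)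
  · exact (measurableSet_eq_fun hd measurable_const).compl
  · exact (((hB.norm).pow_const p).div hd).ennreal_ofReal
  · exact measurableSet_eq_fun hB measurable_const

lemma dist_key (p : ℝ) (hp : 0 < p) (B : Eucl (m+1) → Eucl (m+1) →L[ℝ] Eucl (m+1)) (x) (K : ℝ) (hK : 1 ≤ K)
    (hd : ‖B x‖ ^ (m+1) ≤ K * (B x).det) :
    ENNReal.ofReal (frobNorm (B x)) ^ p ≤ ENNReal.ofReal ((m+1) ^ p) * distortionKp p B x * ENNReal.ofReal |(cj (B x)).det| := by
  rw [cj_det]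
  by_cases h0 : (B x).det = 0
  · rw [h0, mul_zero] at hd
    have hB : B x = 0 := by
      have := pow_eq_zero_iff (by omega) |>.1 (le_antisymm hd (by positivity))
      simpa using this
    rw [hB, frob_zero, ENNReal.ofReal_zero, ENNReal.zero_rpow_of_pos hp]
    exact zero_le
  · have hd0 : 0 < (B x).det := by
      have h1 : 0 ≤ K * (B x).det := le_trans (by positivity) hd
      have h2 : 0 ≤ (B x).det := nonneg_of_mul_nonneg_right h1 (by linarith)
      exact lt_of_le_of_ne h2 (Ne.symm h0)
    rw [distortionKp, if_pos h0, ENNReal.ofReal_rpow_of_nonneg (frob_nonneg _) hp.le, ← ENNReal.ofReal_mul (by positivity),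
      ← ENNReal.ofReal_mul (by positivity), abs_of_pos hd0]
    apply ENNReal.ofReal_le_ofReal
    rw [mul_assoc, div_mul_cancel₀ _ h0, ← Real.mul_rpow (by positivity) (norm_nonneg _)]
    exact Real.rpow_le_rpow (frob_nonneg _) (frob_le _) hp.le

/-- clamp -/
def clm (y0 : Fin (m+1) → ℝ) (R : ℝ) (x : Fin (m+1) → ℝ) : Fin (m+1) → ℝ :=
  fun i => max (y0 i - R) (min (y0 i + R) (x i))

lemma clm_uc (y0 : Fin (m+1) → ℝ) (R : ℝ) : UniformContinuous (clm y0 R) := by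
  rw [uniformContinuous_pi]
  intro i
  exact (((LipschitzWith.eval i).const_min (y0 i + R)).const_max (y0 i - R)).uniformContinuous

lemma clm_mem (y0 : Fin (m+1) → ℝ) {R : ℝ} (hR : 0 ≤ R) (x) : clm y0 R x ∈ closedBall y0 R := by
  rw [mem_closedBall, dist_pi_le_iff hR]
  intro i
  rw [Real.dist_eq, abs_le]
  unfold clm
  constructor
  · linarith [le_max_left (y0 i - R) (min (y0 i + R) (x i))]
  · have : max (y0 i - R) (min (y0 i + R) (x i)) ≤ y0 i + R := max_le (by linarith) (min_le_left _ _)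
    linarith

lemma clm_id (y0 : Fin (m+1) → ℝ) {R : ℝ} (hR : 0 ≤ R) (x) (hx : x ∈ closedBall y0 R) : clm y0 R x = x := by
  ext i
  rw [mem_closedBall, dist_pi_le_iff hR] at hx
  have := hx i
  rw [Real.dist_eq, abs_le] at this
  unfold clm
  rw [min_eq_right (by linarith), max_eq_right (by linarith)]

lemma clm_comp_uc {g : (Fin (m+1) → ℝ) → (Fin (m+1) → ℝ)} (y0 : Fin (m+1) → ℝ) {R : ℝ} (hR : 0 ≤ R)
    (hg : ContinuousOn g (closedBall y0 R)) : UniformContinuous (fun x => g (clm y0 R x)) := by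
  have h1 := (isCompact_closedBall y0 R).uniformContinuousOn_of_continuous hg
  rw [Metric.uniformContinuousOn_iff] at h1
  have h2 := Metric.uniformContinuous_iff.1 (clm_uc y0 R)
  rw [Metric.uniformContinuous_iff]
  intro ε hε
  obtain ⟨δ, hδ, h3⟩ := h1 ε hε
  obtain ⟨δ', hδ', h4⟩ := h2 δ hδ
  exact ⟨δ', hδ', fun a b hab => h3 _ (clm_mem y0 hR a) _ (clm_mem y0 hR b) (h4 hab)⟩

end

section

variable {m : ℕ}

lemma pre_pre (S : Set (Fin (m+1) → ℝ)) : (ee m).symm ⁻¹' ((ee m) ⁻¹' S) = S := by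
  ext x; simp

lemma ae_pull {Q : Set (Fin (m+1) → ℝ)} (hQ : MeasurableSet Q) {P : Eucl (m+1) → Prop}
    (h : ∀ᵐ x ∂volume.restrict ((ee m) ⁻¹' Q), P x) : ∀ᵐ y, y ∈ Q → P ((ee m).symm y) := by
  rw [ae_restrict_iff' ((ee m).continuous.measurable hQ)] at h
  have := ees_mp.quasiMeasurePreserving.ae h
  filter_upwards [this] with y hy hyQ
  apply hy
  simpa using hyQ

lemma lint_pull (Q : Set (Fin (m+1) → ℝ)) (g : Eucl (m+1) → ℝ≥0∞) :
    ∫⁻ y in Q, g ((ee m).symm y) = ∫⁻ x in (ee m) ⁻¹' Q, g x := by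
  rw [← ees_mp.setLIntegral_comp_preimage_emb ees_me g ((ee m) ⁻¹' Q), pre_pre]

lemma mk_wd {D : Set (Eucl (m+1))} {f : Eucl (m+1) → Eucl (m+1)} {Df B : Eucl (m+1) → Eucl (m+1) →L[ℝ] Eucl (m+1)}
    (hw : IsWeakDerivOn D f Df) (y0 : Fin (m+1) → ℝ) {R : ℝ} (hR : 0 < R)
    (hQ : (ee m) ⁻¹' closedBall y0 R ⊆ D) (hB : B =ᵐ[volume.restrict ((ee m) ⁻¹' closedBall y0 R)] Df) :
    WD (closedBall y0 R) (fun x => ee m (f ((ee m).symm (clm y0 R x))))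
      ((closedBall y0 R).indicator fun x => cj (B ((ee m).symm x))) := by
  intro ψ h1 h2 h3 v
  have hts : tsupport (ψ ∘ ee m) ⊆ (ee m) ⁻¹' tsupport ψ := tsupport_comp_subset_preimage ψ (ee m).continuous
  have h4 := hw.2.2 (ψ ∘ ee m) (h1.comp (ee m).contDiff) (h2.comp_homeomorph (ee m).toHomeomorph)
    (hts.trans ((preimage_mono h3).trans hQ)) ((ee m).symm v)
  have h5 := congrArg (ee m) h4
  rw [map_neg, ← ContinuousLinearEquiv.integral_comp_comm, ← ContinuousLinearEquiv.integral_comp_comm,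
    ← ees_mp.integral_comp ees_me, ← ees_mp.integral_comp ees_me] at h5
  convert h5 using 1
  · apply integral_congr_ae
    filter_upwards [ae_pull measurableSet_closedBall hB] with y hy
    by_cases hyQ : y ∈ closedBall y0 R
    · rw [indicator_of_mem hyQ, hy hyQ]
      simp [cj_apply]
    · have : ψ y = 0 := by
        by_contra hne
        exact hyQ (h3 (subset_tsupport _ hne))
      simp [this]
  · congr 1
    apply integral_congr_ae
    refine Eventually.of_forall fun y => ?_
    simp only []
    rw [ContinuousLinearEquiv.comp_right_fderiv]
    by_cases hyQ : y ∈ closedBall y0 R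
    · rw [clm_id y0 hR.le y hyQ]
      simp
    · have : fderiv ℝ ψ y = 0 := by
        by_contra hne
        exact hyQ (h3 (support_fderiv_subset ℝ hne))
      simp [this]

lemma mk_core (hm : 2 ≤ m) {D : Set (Eucl (m+1))} {φ : ℝ → ℝ} (hφ : NondecPos φ) (hcal : CalderonCond (m+1) φ)
    {f : Eucl (m+1) → Eucl (m+1)} {Df B : Eucl (m+1) → Eucl (m+1) →L[ℝ] Eucl (m+1)}
    (hf : ContinuousOn f D) (hO : MemOrliczSobolevOn φ D f Df) (y0 : Fin (m+1) → ℝ) {R : ℝ} (hR : 0 < R)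
    (hQ : (ee m) ⁻¹' closedBall y0 R ⊆ D) (hBm : Measurable B) (hB : B =ᵐ[volume.restrict ((ee m) ⁻¹' closedBall y0 R)] Df) :
    Core m (closedBall y0 R) (fun x => ee m (f ((ee m).symm (clm y0 R x))))
      ((closedBall y0 R).indicator fun x => cj (B ((ee m).symm x)))
      ((closedBall y0 R).indicator fun x => frobNorm (B ((ee m).symm x))) (fun t => if 0 < t then φ t else 0) := by
  have hcomp : IsCompact ((ee m) ⁻¹' closedBall y0 R) :=
    (ee m).toHomeomorph.isClosedEmbedding.isCompact_preimage (isCompact_closedBall y0 R)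
  have hBs : Measurable fun x => B ((ee m).symm x) := hBm.comp (ee m).symm.continuous.measurable
  have hAm : Measurable ((closedBall y0 R).indicator fun x => cj (B ((ee m).symm x))) :=
    (cj_cont.measurable.comp hBs).indicator measurableSet_closedBall
  have ham : Measurable ((closedBall y0 R).indicator fun x => frobNorm (B ((ee m).symm x))) :=
    (frob_cont.measurable.comp hBs).indicator measurableSet_closedBall
  have hAa : ∀ x, ‖(closedBall y0 R).indicator (fun x => cj (B ((ee m).symm x))) x‖ ≤
      (m+1) * (closedBall y0 R).indicator (fun x => frobNorm (B ((ee m).symm x))) x := by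
    intro x
    by_cases hx : x ∈ closedBall y0 R
    · rw [indicator_of_mem hx, indicator_of_mem hx]; exact cj_norm _
    · rw [indicator_of_notMem hx, indicator_of_notMem hx]; simp
  have hai : Integrable ((closedBall y0 R).indicator fun x => frobNorm (B ((ee m).symm x))) := by
    rw [integrable_indicator_iff measurableSet_closedBall]
    have h1 : IntegrableOn B ((ee m) ⁻¹' closedBall y0 R) :=
      (hO.1.2.1.integrableOn_compact_subset hQ hcomp).congr hB.symm
    rw [← ees_mp.integrableOn_comp_preimage ees_me, pre_pre] at h1
    refine (h1.norm.const_mul ((m:ℝ)+1)).mono' (frob_cont.measurable.comp hBs).aestronglyMeasurable ?_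
    refine Eventually.of_forall fun x => ?_
    rw [Real.norm_of_nonneg (frob_nonneg _)]
    exact frob_le _
  refine ⟨hm, ?_, mk_wd hO.1 y0 hR hQ hB, hAm, ?_, ham, hai, ?_, hAa, ?_, ?_, ?_, ?_⟩
  · refine clm_comp_uc (g := fun x => ee m (f ((ee m).symm x))) y0 hR.le ?_
    refine (ee m).continuous.comp_continuousOn (hf.comp (ee m).symm.continuous.continuousOn ?_)
    intro y hy
    apply hQ
    simpa using hy
  · exact (hai.const_mul ((m:ℝ)+1)).mono' hAm.aestronglyMeasurable (Eventually.of_forall hAa)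
  · intro x
    exact indicator_nonneg (fun x _ => frob_nonneg _) x
  · intro s t hst
    simp only []
    by_cases hs : 0 < s
    · rw [if_pos hs, if_pos (hs.trans_le hst)]; exact hφ.1 s t hs hst
    · rw [if_neg hs]
      split_ifs with ht
      · exact (hφ.2 t ht).le
      · exact le_rfl
  · intro t ht
    simp only [if_pos ht]; exact hφ.2 t ht
  · have h1 := hO.2 _ hQ hcomp
    refine (lt_of_le_of_lt ?_ h1).ne
    rw [← lint_pull (closedBall y0 R) (fun x => ENNReal.ofReal (φ (frobNorm (Df x)))), ← lintegral_indicator measurableSet_closedBall]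
    apply lintegral_mono_ae
    filter_upwards [ae_pull measurableSet_closedBall hB] with y hy
    by_cases hyQ : y ∈ closedBall y0 R
    · rw [indicator_of_mem hyQ, indicator_of_mem hyQ, hy hyQ]
      split_ifs
      · exact le_rfl
      · simp
    · rw [indicator_of_notMem hyQ, indicator_of_notMem hyQ]; simp
  · obtain ⟨t0, ht0, hi⟩ := hcal
    refine ⟨t0, ht0, hi.congr_fun ?_ measurableSet_Ioi⟩
    intro t ht
    have : 0 < t := ht0.trans ht
    simp only [if_pos this]
    congr 2
    push_cast
    ring

end

section

variable {m : ℕ}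

def G1 (m : ℕ) (p : ℝ) : ℝ := (((m:ℝ)+1) ^ p) ^ ((m:ℝ)/(p-m)) * (8 * ((m:ℝ)+1)) ^ (m+1)

lemma G1_pos (m : ℕ) (p : ℝ) : 0 < G1 m p := by unfold G1; positivity

/-- integral bound from `kpAt`. -/
lemma kp_bound (p : ℝ) (hpm : (m:ℝ) < p) (hm : 1 ≤ m) (Df : Eucl (m+1) → Eucl (m+1) →L[ℝ] Eucl (m+1)) (x0) (k : ℝ) (hk0 : 0 < k)
    (hk : kpAt p Df x0 < ENNReal.ofReal k) :
    ∃ ε0 > 0, ∀ ε, 0 < ε → ε < ε0 → ∫⁻ x in ball x0 ε, distortionKp p Df x ^ ((m:ℝ)/(p-m)) ≤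
      ENNReal.ofReal (k ^ ((m:ℝ)/(p-m)) * (2 * ε) ^ (m+1)) := by
  have hm0 : (1:ℝ) ≤ m := by exact_mod_cast hm
  have hpm' : 0 < p - m := by linarith
  have h1 := eventually_lt_of_limsup_lt hk
  rw [eventually_nhdsWithin_iff, Metric.eventually_nhds_iff] at h1
  obtain ⟨ε0, hε0, h2⟩ := h1
  refine ⟨ε0, hε0, fun ε hε hεε => ?_⟩
  have h3 := h2 (y := ε) (by rw [Real.dist_eq, sub_zero, abs_of_pos hε]; exact hεε) hε
  have e1 : (((m+1:ℕ):ℝ) - 1) / (p - ((m+1:ℕ):ℝ) + 1) = (m:ℝ)/(p-m) := by push_cast; congr 1 <;> ring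
  have e2 : (p - ((m+1:ℕ):ℝ) + 1) / (((m+1:ℕ):ℝ) - 1) = (p-m)/(m:ℝ) := by push_cast; congr 1 <;> ring
  rw [e1, e2] at h3
  set α := (m:ℝ)/(p-m) with hα
  have hα0 : 0 < α := by positivity
  have h4 := ENNReal.rpow_lt_rpow h3 hα0
  rw [← ENNReal.rpow_mul, ENNReal.ofReal_rpow_of_nonneg hk0.le hα0.le] at h4
  have e3 : (p-m)/(m:ℝ) * α = 1 := by rw [hα]; field_simp
  rw [e3, ENNReal.rpow_one] at h4
  have hv0 : volume (ball x0 ε) ≠ 0 := (measure_ball_pos volume x0 hε).ne'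
  have hvt : volume (ball x0 ε) ≠ ⊤ := measure_ball_lt_top.ne
  have h5 := (ENNReal.div_le_iff hv0 hvt).1 h4.le
  refine h5.trans ?_
  rw [ENNReal.ofReal_mul (by positivity)]
  refine mul_le_mul_right ?_ _
  have h6 : ball x0 ε ⊆ (ee m) ⁻¹' closedBall (ee m x0) ε := by
    intro x hx
    rw [mem_preimage, mem_closedBall, dist_eq_norm, ← map_sub]
    rw [mem_ball, dist_eq_norm] at hx
    exact (ee_norm _).trans hx.le
  refine (measure_mono h6).trans ?_
  rw [ee_mp.measure_preimage measurableSet_closedBall.nullMeasurableSet, vol_cb _ hε.le]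

lemma main_step (hm : 2 ≤ m) (p : ℝ) (hp1 : (m:ℝ) + 1 < p) (hq : (m:ℝ) < p / (p - m))
    {D : Set (Eucl (m+1))} (hD : IsOpen D) {φ : ℝ → ℝ} (hφ : NondecPos φ) (hcal : CalderonCond (m+1) φ)
    {f : Eucl (m+1) → Eucl (m+1)} {Df : Eucl (m+1) → Eucl (m+1) →L[ℝ] Eucl (m+1)}
    {D' : Set (Eucl (m+1))} (hf : IsHomeoOn f D D') (hO : MemOrliczSobolevOn φ D f Df) (hK : HasFiniteDistortionOn D Df)
    (x0 : Eucl (m+1)) (hx0 : x0 ∈ D) (k : ℝ) (hk0 : 0 < k) (hk : kpAt p Df x0 < ENNReal.ofReal k) :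
    LAt f x0 ≤ ENNReal.ofReal ((m+1) * (8 * M9 m (p/(p-m)) (G1 m p * k ^ ((m:ℝ)/(p-m))) ^ (1/(1-(p/(p-m) - m))))) := by
  have hm0 : (2:ℝ) ≤ m := by exact_mod_cast hm
  have hpm : (m:ℝ) < p := by linarith
  have hpm' : 0 < p - m := by linarith
  have hq1 : p / (p - m) < m + 1 := by
    rw [div_lt_iff₀ hpm']; nlinarith
  obtain ⟨ε0, hε0, hkp⟩ := kp_bound p hpm (by omega) Df x0 k hk0 hk
  set α := (m:ℝ)/(p-m) with hα
  have hα0 : 0 < α := by positivity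
  set y0 := ee m x0 with hy0
  have hDo : IsOpen ((ee m).symm ⁻¹' D) := hD.preimage (ee m).symm.continuous
  obtain ⟨R1, hR1, hR1D⟩ := Metric.nhds_basis_closedBall.mem_iff.1 (hDo.mem_nhds (show y0 ∈ (ee m).symm ⁻¹' D by simpa [hy0] using hx0))
  set R := min R1 (ε0 / (2 * (m+1))) with hR
  have hR0 : 0 < R := lt_min hR1 (by positivity)
  have hRD : (ee m) ⁻¹' closedBall y0 R ⊆ D := by
    intro x hx
    have := hR1D (closedBall_subset_closedBall (min_le_left _ _) hx)
    simpa using this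
  have hcomp : IsCompact ((ee m) ⁻¹' closedBall y0 R) :=
    (ee m).toHomeomorph.isClosedEmbedding.isCompact_preimage (isCompact_closedBall y0 R)
  have hint := (hO.1.2.1.integrableOn_compact_subset hRD hcomp).aestronglyMeasurable
  set B := hint.mk Df with hBd
  have hBm : Measurable B := hint.stronglyMeasurable_mk.measurable
  have hB : B =ᵐ[volume.restrict ((ee m) ⁻¹' closedBall y0 R)] Df := hint.ae_eq_mk.symm
  have hcore := mk_core hm hφ hcal hf.continuousOn hO y0 hR0 hRD hBm hB
  have hinjD : InjOn (fun x => ee m (f ((ee m).symm (clm y0 R x)))) (ball y0 R) := by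
    intro x hx y hy hxy
    simp only [] at hxy
    rw [clm_id y0 hR0.le x (ball_subset_closedBall hx), clm_id y0 hR0.le y (ball_subset_closedBall hy)] at hxy
    exact (ee m).symm.injective (hf.injOn (hRD (by simpa using ball_subset_closedBall hx)) (hRD (by simpa using ball_subset_closedBall hy)) ((ee m).injective hxy))
  have hop : ∀ V ⊆ ball y0 R, IsOpen V → IsOpen ((fun x => ee m (f ((ee m).symm (clm y0 R x)))) '' V) := by
    intro V hV hVo
    have h1 : (fun x => ee m (f ((ee m).symm (clm y0 R x)))) '' V = ee m '' (f '' ((ee m).symm '' V)) := by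
      rw [image_image, image_image]
      apply image_congr
      intro x hx
      rw [clm_id y0 hR0.le x (ball_subset_closedBall (hV hx))]
    rw [h1]
    apply (ee m).toHomeomorph.isOpenMap
    apply hf.isOpenMapOn
    · rintro _ ⟨x, hx, rfl⟩
      exact hRD (by simpa using ball_subset_closedBall (hV hx))
    · exact (ee m).symm.toHomeomorph.isOpenMap _ hVo
  set K : (Fin (m+1) → ℝ) → ℝ≥0∞ := fun x => ENNReal.ofReal ((m+1) ^ p) * distortionKp p B ((ee m).symm x) with hKd
  have hKm : Measurable K := ((dist_meas p B hBm).comp (ee m).symm.continuous.measurable).const_mul _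
  obtain ⟨K0, -, hK0⟩ := hK
  have hK1 := ae_restrict_of_ae_restrict_of_subset hRD hK0
  have hb : ∀ᵐ x ∂volume.restrict (closedBall y0 R),
      ENNReal.ofReal ((closedBall y0 R).indicator (fun x => frobNorm (B ((ee m).symm x))) x) ^ p ≤
       K x * ENNReal.ofReal |((closedBall y0 R).indicator (fun x => cj (B ((ee m).symm x))) x).det| := by
    rw [ae_restrict_iff' measurableSet_closedBall]
    filter_upwards [ae_pull measurableSet_closedBall hB, ae_pull measurableSet_closedBall hK1] with x h1 h2 hx
    rw [indicator_of_mem hx, indicator_of_mem hx]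
    obtain ⟨h3, h4⟩ := h2 hx
    rw [← h1 hx] at h4
    exact dist_key p (by linarith) B _ _ h3 h4
  have hΛ : ∀ r, 0 < r → 4 * r ≤ R → ∫⁻ x in closedBall y0 (3*r), K x ^ ((m:ℝ) / (p - m)) ≤
      ENNReal.ofReal (G1 m p * k ^ α * r ^ (m+1)) := by
    intro r hr hrR
    have hsub : closedBall y0 (3*r) ⊆ closedBall y0 R := closedBall_subset_closedBall (by linarith)
    have hB' := ae_restrict_of_ae_restrict_of_subset (preimage_mono (f := ee m) hsub) hB
    have h1 : ∫⁻ x in closedBall y0 (3*r), K x ^ α = ENNReal.ofReal ((((m:ℝ)+1) ^ p) ^ α) *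
        ∫⁻ x in (ee m) ⁻¹' closedBall y0 (3*r), distortionKp p B x ^ α := by
      rw [← lint_pull (closedBall y0 (3*r)) (fun x => distortionKp p B x ^ α), ← lintegral_const_mul' _ _ ENNReal.ofReal_ne_top]
      apply lintegral_congr
      intro x
      rw [hKd]
      simp only []
      rw [ENNReal.mul_rpow_of_nonneg _ _ hα0.le, ENNReal.ofReal_rpow_of_nonneg (by positivity) hα0.le]
    have h2 : ∫⁻ x in (ee m) ⁻¹' closedBall y0 (3*r), distortionKp p B x ^ α =
        ∫⁻ x in (ee m) ⁻¹' closedBall y0 (3*r), distortionKp p Df x ^ α := by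
      apply lintegral_congr_ae
      filter_upwards [hB'] with x hx
      unfold distortionKp
      rw [hx]
    have hsub2 : (ee m) ⁻¹' closedBall y0 (3*r) ⊆ ball x0 (4 * (m+1) * r) := by
      intro x hx
      rw [mem_preimage, mem_closedBall, dist_eq_norm, hy0, ← map_sub] at hx
      rw [mem_ball, dist_eq_norm]
      have := ee_norm' (x - x0)
      nlinarith
    have hRε : R ≤ ε0 / (2 * (m+1)) := min_le_right _ _
    rw [le_div_iff₀ (by positivity)] at hRε
    have h3 := hkp (4 * (m+1) * r) (by positivity) (by nlinarith)
    rw [h1, h2]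
    refine (mul_le_mul_right ((lintegral_mono_set hsub2).trans h3) _).trans (le_of_eq ?_)
    rw [← ENNReal.ofReal_mul (by positivity), G1, ← hα]
    congr 1
    have : 2 * (4 * ((m:ℝ)+1) * r) = 8 * (m+1) * r := by ring
    rw [this, mul_pow _ r]
    ring
  obtain ⟨s, hs, hgrow⟩ := grow hcore y0 R hR0 le_rfl hinjD hop p hpm hq hq1 K hKm hb _ (by have := G1_pos m p; positivity) hΛ
  set C := 8 * M9 m (p/(p-m)) (G1 m p * k ^ α) ^ (1/(1-(p/(p-m) - m))) with hC
  apply limsup_le_of_le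
  · isBoundedDefault
  rw [eventually_nhdsWithin_iff]
  filter_upwards [ball_mem_nhds x0 (lt_min hs hR0)] with x hx hne
  rw [mem_ball, dist_eq_norm] at hx
  have hn : ‖ee m x - y0‖ ≤ ‖x - x0‖ := by rw [hy0, ← map_sub]; exact ee_norm _
  have hxR : ee m x ∈ closedBall y0 R := by
    rw [mem_closedBall, dist_eq_norm]; exact hn.trans (hx.le.trans (min_le_right _ _))
  have h1 := hgrow (ee m x) (by rw [mem_closedBall, dist_eq_norm]; exact hn.trans (hx.le.trans (min_le_left _ _)))
  rw [clm_id y0 hR0.le _ hxR, clm_id y0 hR0.le _ (mem_closedBall_self hR0.le), hy0, ContinuousLinearEquiv.symm_apply_apply,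
    ContinuousLinearEquiv.symm_apply_apply, ← map_sub, ← hy0] at h1
  have hC0 : 0 ≤ C := by
    rw [hC]
    have hh : 0 ≤ M9 m (p/(p-m)) (G1 m p * k ^ α) := by
      have := G1_pos m p
      have : 0 ≤ (C8 m (p/(p-m))).toReal := ENNReal.toReal_nonneg
      unfold M9; positivity
    positivity
  have h2 : ‖f x - f x0‖ ≤ (m+1) * C * ‖x - x0‖ := by
    calc ‖f x - f x0‖ ≤ (m+1) * ‖ee m (f x - f x0)‖ := ee_norm' _
      _ ≤ (m+1) * (C * ‖ee m x - y0‖) := by gcongr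
      _ ≤ (m+1) * (C * ‖x - x0‖) := by gcongr
      _ = _ := by ring
  have hd0 : edist x x0 ≠ 0 := by rw [Ne, edist_eq_zero]; exact hne
  rw [ENNReal.div_le_iff hd0 (edist_ne_top _ _), edist_dist, edist_dist, ← ENNReal.ofReal_mul (by positivity), dist_eq_norm, dist_eq_norm]
  exact ENNReal.ofReal_le_ofReal h2

end

end KP
end

/-- for `p ∈ (n, n + 1/(n-2))` there is a constant `c = c_{n,p}` such that for
every homeomorphism of finite distortion `f : D → D'` of class `W^{1,φ}_loc` (with the
Calderón-type condition on `φ`) and every `x₀ ∈ D` with `k_p(x₀) < ∞` one has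
`L(x₀,f) ≤ c · k_p(x₀)^{(n-1)/(n(p-n+1)-p)} < ∞`. -/
theorem stmt_8 (n : ℕ) (hn : 3 ≤ n) (p : ℝ)
    (hp : p ∈ Ioo (n : ℝ) ((n : ℝ) + 1 / ((n : ℝ) - 2))) :
    ∃ c : ℝ≥0∞, 0 < c ∧ c < ⊤ ∧
      ∀ (D D' : Set (Eucl n)), IsOpen D → IsConnected D → IsOpen D' → IsConnected D' →
      ∀ φ : ℝ → ℝ, NondecPos φ → CalderonCond n φ →
      ∀ (f : Eucl n → Eucl n) (Df : Eucl n → Eucl n →L[ℝ] Eucl n),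
        IsHomeoOn f D D' → MemOrliczSobolevOn φ D f Df → HasFiniteDistortionOn D Df →
      ∀ x₀ ∈ D, kpAt p Df x₀ < ⊤ →
        LAt f x₀ ≤ c * kpAt p Df x₀ ^ (((n:ℝ)-1)/((n:ℝ)*(p-(n:ℝ)+1)-p)) ∧
        c * kpAt p Df x₀ ^ (((n:ℝ)-1)/((n:ℝ)*(p-(n:ℝ)+1)-p)) < ⊤ := by
  obtain ⟨m, rfl⟩ : ∃ m, n = m + 1 := ⟨n - 1, by omega⟩
  have hm : 2 ≤ m := by omega
  have hm0 : (2:ℝ) ≤ m := by exact_mod_cast hm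
  obtain ⟨hp1, hp2⟩ := hp
  push_cast at hp1 hp2
  have hpm : 0 < p - m := by linarith
  have hq : (m:ℝ) < p / (p - m) := by
    rw [lt_div_iff₀ hpm]
    have e : (m:ℝ) + 1 - 2 = m - 1 := by ring
    have hm1 : (0:ℝ) < m - 1 := by linarith
    have h1 : (p - (m + 1)) * (m - 1) < 1 := by
      rw [← lt_div_iff₀ hm1, ← e]; linarith
    nlinarith
  have hq1 : p / (p - m) < m + 1 := by
    rw [div_lt_iff₀ hpm]; nlinarith
  set β := 1/(1-(p/(p-m) - m)) with hβ
  have hβ0 : 0 < β := by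
    apply one_div_pos.2; linarith
  set γ := (((m+1:ℕ):ℝ)-1)/(((m+1:ℕ):ℝ)*(p-((m+1:ℕ):ℝ)+1)-p) with hγ
  have hden : 0 < ((m:ℝ)+1)*(p-m) - p := by nlinarith
  have hγ' : γ = m / (((m:ℝ)+1)*(p-m) - p) := by
    rw [hγ]; push_cast; congr 1 <;> ring
  have hγ0 : 0 < γ := by rw [hγ']; positivity
  have hγβ : (m:ℝ)/(p-m) * β = γ := by
    have h1 : 1-(p/(p-m) - m) = (((m:ℝ)+1)*(p-m) - p) / (p - m) := by
      field_simp; ring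
    rw [hγ', hβ, h1]
    field_simp
  have hM : 0 < KP.M9 m (p/(p-m)) (KP.G1 m p) := by
    have := KP.G1_pos m p
    have : 0 ≤ (KP.C8 m (p/(p-m))).toReal := ENNReal.toReal_nonneg
    unfold KP.M9; positivity
  set C := ((m:ℝ)+1) * (8 * KP.M9 m (p/(p-m)) (KP.G1 m p) ^ β) with hC
  have hC0 : 0 < C := by positivity
  refine ⟨ENNReal.ofReal C, ENNReal.ofReal_pos.2 hC0, ENNReal.ofReal_lt_top, ?_⟩
  intro D D' hD _ _ _ φ hφ hcal f Df hf hO hK x₀ hx₀ hk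
  refine ⟨?_, ENNReal.mul_lt_top ENNReal.ofReal_lt_top (ENNReal.rpow_lt_top_of_nonneg hγ0.le hk.ne)⟩
  have key : ∀ k' : ℝ≥0∞, kpAt p Df x₀ < k' → k' < ⊤ → LAt f x₀ ≤ ENNReal.ofReal C * k' ^ γ := by
    intro k' h1 h2
    have h0 : 0 < k' := lt_of_le_of_lt zero_le h1
    have hkr : 0 < k'.toReal := ENNReal.toReal_pos h0.ne' h2.ne
    have h3 := KP.main_step hm p hp1 hq hD hφ hcal hf hO hK x₀ hx₀ k'.toReal hkr (by rwa [ENNReal.ofReal_toReal h2.ne])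
    refine h3.trans (le_of_eq ?_)
    have h4 : KP.M9 m (p/(p-m)) (KP.G1 m p * k'.toReal ^ ((m:ℝ)/(p-m))) = KP.M9 m (p/(p-m)) (KP.G1 m p) * k'.toReal ^ ((m:ℝ)/(p-m)) := by
      unfold KP.M9; ring
    nth_rewrite 2 [← ENNReal.ofReal_toReal h2.ne]
    rw [ENNReal.ofReal_rpow_of_pos hkr, ← ENNReal.ofReal_mul hC0.le, h4, ← hβ, Real.mul_rpow hM.le (by positivity),
      ← Real.rpow_mul hkr.le, hγβ, hC]
    congr 1
    ring
  have ht : Tendsto (fun k' : ℝ≥0∞ => ENNReal.ofReal C * k' ^ γ) (𝓝[>] (kpAt p Df x₀)) (𝓝 (ENNReal.ofReal C * kpAt p Df x₀ ^ γ)) := by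
    apply Tendsto.mono_left _ nhdsWithin_le_nhds
    exact ENNReal.Tendsto.const_mul (ENNReal.continuous_rpow_const.tendsto _) (Or.inr ENNReal.ofReal_ne_top)
  haveI : (𝓝[>] (kpAt p Df x₀)).NeBot := nhdsGT_neBot_of_exists_gt ⟨⊤, hk⟩
  apply ge_of_tendsto ht
  filter_upwards [self_mem_nhdsWithin, mem_nhdsWithin_of_mem_nhds (Iio_mem_nhds hk)] with k' h1 h2
  exact key k' h1 h2
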